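/- Let D = ℝ × (0,∞) be the half-plane, α ∈ (0, 1/4], and γ = 2α/(1−2α). Suppose ω = Σ_{n=1}^N θ_n χ_{Ω_n(t)} is a patch solution to the g-SQG equation on D (with the Dirichlet velocity u(x,t) = c_α ∫_D [ (x−y)^⊥/|x−y|^{2+2α} − (x−ȳ)^⊥/|x−ȳ|^{2+2α} ] ω(y,t) dy, where ȳ := (y₁,−y₂)) on a time interval [0,T) with T < ∞, and suppose sup_{t∈[0,T)} ‖Ω(t)‖_{C^{1,γ}} < ∞. Then sup_{t∈[0,T)} sup_{(n,ξ)≠(j,η)} (|n−j| + |ξ−η|) / |z_n(ξ,t) − z_j(η,t)| < ∞, where z_n(·,t) is a constant-speed parameterization of ∂Ω_n(t); that is, no splash-like singularity can occur at time T. -/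

import Mathlib

open Real Set Filter MeasureTheory

noncomputable section

abbrev R2 : Type := EuclideanSpace ℝ (Fin 2)

def mk2 (a b : ℝ) : R2 := (EuclideanSpace.equiv (Fin 2) ℝ).symm ![a, b]

/-- Counterclockwise rotation by 90°: `(v₁,v₂)^⊥ = (−v₂,v₁)`. -/
def perp (v : R2) : R2 := mk2 (-(v 1)) (v 0)

/-- The g-SQG Biot–Savart kernel `w ↦ w^⊥/|w|^{2+2α}`. -/
def kern (α : ℝ) (w : R2) : R2 := (‖w‖ ^ (2 + 2 * α))⁻¹ • perp w

/-- The open half-plane `D = ℝ × (0,∞)`. -/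
def halfPlane : Set R2 := {y : R2 | 0 < y 1}

/-- Reflection across the horizontal axis: `ȳ = (y₁, −y₂)`. -/
def reflect (y : R2) : R2 := mk2 (y 0) (-(y 1))

/-- The g-SQG (Dirichlet) velocity on the half-plane of `ω = Σ θₙ χ_{Ωₙ}`:
`u(x) = c_α ∫_D [(x−y)^⊥/|x−y|^{2+2α} − (x−ȳ)^⊥/|x−ȳ|^{2+2α}] ω(y) dy`. -/
def gSQGvel (α cα : ℝ) {N : ℕ} (θ : Fin N → ℝ) (Ω : Fin N → Set R2) (x : R2) : R2 :=
  cα • ∑ n, θ n • ∫ y in Ω n, (kern α (x - y) - kern α (x - reflect y))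

/-- The distance on the torus `𝕋 = ℝ/2πℤ` between (the classes of) two reals. -/
def distT (ξ η : ℝ) : ℝ := ⨅ k : ℤ, |ξ - η + 2 * π * k|

section
open Real Set Filter MeasureTheory

/-! ### distT -/

theorem distT_eq (ξ η : ℝ) : distT ξ η = ‖((ξ - η : ℝ) : AddCircle (2 * π))‖ := by
  have key : ∀ k : ℤ, ‖((ξ - η : ℝ) : AddCircle (2 * π))‖ ≤ |ξ - η + 2 * π * k| := by
    intro k
    have h : ((ξ - η : ℝ) : AddCircle (2 * π)) = ((ξ - η + 2 * π * k : ℝ) : AddCircle (2 * π)) := by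
      rw [AddCircle.coe_add, left_eq_add, AddCircle.coe_eq_zero_iff]
      exact ⟨k, by simp [mul_comm]⟩
    rw [h]
    exact QuotientAddGroup.norm_mk_le_norm
  apply le_antisymm
  · rw [AddCircle.norm_eq]
    have := ciInf_le (f := fun k : ℤ => |ξ - η + 2 * π * k|) ⟨0, by rintro _ ⟨k, rfl⟩; positivity⟩
      (-round ((2 * π)⁻¹ * (ξ - η)))
    refine this.trans (le_of_eq ?_)
    push_cast; congr 1; ring
  · exact le_ciInf key

theorem distT_le (ξ η : ℝ) (k : ℤ) : distT ξ η ≤ |ξ - η + 2 * π * k| :=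
  ciInf_le ⟨0, by rintro _ ⟨k, rfl⟩; positivity⟩ k

theorem distT_le_abs (ξ η : ℝ) : distT ξ η ≤ |ξ - η| := by
  simpa using distT_le ξ η 0

theorem distT_exists (ξ η : ℝ) : ∃ k : ℤ, distT ξ η = |ξ - η + 2 * π * k| := by
  refine ⟨-round ((2 * π)⁻¹ * (ξ - η)), ?_⟩
  rw [distT_eq, AddCircle.norm_eq]; push_cast; congr 1; ring

theorem distT_nonneg (ξ η : ℝ) : 0 ≤ distT ξ η := by rw [distT_eq]; positivity

theorem distT_triangle (a b c : ℝ) : distT a c ≤ distT a b + distT b c := by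
  simp only [distT_eq]
  have : ((a - c : ℝ) : AddCircle (2 * π)) = ((a - b : ℝ) : AddCircle (2 * π)) + ((b - c : ℝ) : AddCircle (2 * π)) := by
    rw [← AddCircle.coe_add]; congr 1; ring
  rw [this]; exact norm_add_le _ _

theorem distT_comm (a b : ℝ) : distT a b = distT b a := by
  simp only [distT_eq]
  rw [← neg_sub b a, AddCircle.coe_neg, norm_neg]

theorem distT_shift (a b s : ℝ) : distT (a + s) (b + s) = distT a b := by
  simp [distT]

theorem distT_le_pi (a b : ℝ) : distT a b ≤ π := by
  rw [distT_eq]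
  have := AddCircle.norm_le_half_period (2 * π) (x := ((a - b : ℝ) : AddCircle (2 * π))) (by positivity)
  rw [abs_of_pos (by positivity)] at this; linarith

theorem distT_of_le {a b : ℝ} (h : |a - b| ≤ π) : distT a b = |a - b| := by
  rw [distT_eq]
  exact (AddCircle.norm_coe_eq_abs_iff (2 * π) (by positivity)).mpr (by rw [abs_of_pos (by positivity : 0 < 2 * π)]; linarith)

theorem distT_continuous : Continuous (fun p : ℝ × ℝ => distT p.1 p.2) := by
  simp only [distT_eq]
  have : Continuous (fun x : ℝ => (x : AddCircle (2 * π))) := AddCircle.continuous_mk' (2 * π)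
  exact (this.comp (by fun_prop : Continuous fun p : ℝ × ℝ => p.1 - p.2)).norm

/-! ### planar vectors -/

def crs (a b : R2) : ℝ := a 0 * b 1 - a 1 * b 0
def dt (a b : R2) : ℝ := a 0 * b 0 + a 1 * b 1

theorem nsq (a : R2) : ‖a‖ ^ 2 = a 0 ^ 2 + a 1 ^ 2 := by
  rw [EuclideanSpace.norm_sq_eq]; simp [Fin.sum_univ_two]

theorem lagr (a b : R2) : crs a b ^ 2 + dt a b ^ 2 = (‖a‖ * ‖b‖) ^ 2 := by
  rw [mul_pow, nsq, nsq]; unfold crs dt; ring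

theorem abs_crs_le (a b : R2) : |crs a b| ≤ ‖a‖ * ‖b‖ := by
  apply abs_le_of_sq_le_sq _ (by positivity)
  nlinarith [lagr a b, sq_nonneg (dt a b)]

theorem abs_dt_le (a b : R2) : |dt a b| ≤ ‖a‖ * ‖b‖ := by
  apply abs_le_of_sq_le_sq _ (by positivity)
  nlinarith [lagr a b, sq_nonneg (crs a b)]

theorem dt_self (a : R2) : dt a a = ‖a‖ ^ 2 := by rw [nsq]; unfold dt; ring
theorem crs_self (a : R2) : crs a a = 0 := by unfold crs; ring

theorem abs_coord_le (a : R2) (i : Fin 2) : |a i| ≤ ‖a‖ := by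
  apply abs_le_of_sq_le_sq _ (by positivity)
  rw [nsq]; fin_cases i <;> simp <;> positivity

@[simp] theorem mk2_0 (a b : ℝ) : mk2 a b 0 = a := rfl
@[simp] theorem mk2_1 (a b : ℝ) : mk2 a b 1 = b := rfl
@[simp] theorem perp_0 (a : R2) : perp a 0 = - a 1 := rfl
@[simp] theorem perp_1 (a : R2) : perp a 1 = a 0 := rfl
@[simp] theorem reflect_0 (a : R2) : reflect a 0 = a 0 := rfl
@[simp] theorem reflect_1 (a : R2) : reflect a 1 = - a 1 := rfl

theorem R2_ext {a b : R2} (h0 : a 0 = b 0) (h1 : a 1 = b 1) : a = b := by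
  ext i; fin_cases i <;> simp [h0, h1]

theorem norm_perp (a : R2) : ‖perp a‖ = ‖a‖ := by
  have : ‖perp a‖ ^ 2 = ‖a‖ ^ 2 := by rw [nsq, nsq]; simp; ring
  exact (sq_eq_sq₀ (norm_nonneg _) (norm_nonneg _)).mp this

theorem norm_reflect (a : R2) : ‖reflect a‖ = ‖a‖ := by
  have : ‖reflect a‖ ^ 2 = ‖a‖ ^ 2 := by rw [nsq, nsq]; simp
  exact (sq_eq_sq₀ (norm_nonneg _) (norm_nonneg _)).mp this

theorem eq_of_crs {a p q : R2} (hs : crs p q ≠ 0) (h1 : crs a p = 0) (h2 : crs a q = 0) : a = 0 := by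
  unfold crs at *
  apply R2_ext
  · have : a 0 * (p 0 * q 1 - p 1 * q 0) = 0 := by linear_combination p 0 * h2 - q 0 * h1
    simpa [hs] using this
  · have : a 1 * (p 0 * q 1 - p 1 * q 0) = 0 := by linear_combination p 1 * h2 - q 1 * h1
    simpa [hs] using this

theorem hasDerivAt_coord {z : ℝ → R2} {v : R2} {ξ : ℝ} (h : HasDerivAt z v ξ) (i : Fin 2) :
    HasDerivAt (fun x => z x i) (v i) ξ :=
  (EuclideanSpace.proj i : R2 →L[ℝ] ℝ).hasFDerivAt.comp_hasDerivAt ξ h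

theorem hasDerivAt_dt {z : ℝ → R2} {v : R2} {ξ : ℝ} (h : HasDerivAt z v ξ) (a : R2) :
    HasDerivAt (fun x => dt (z x) a) (dt v a) ξ := by
  unfold dt
  exact ((hasDerivAt_coord h 0).mul_const _).add ((hasDerivAt_coord h 1).mul_const _)

theorem hasDerivAt_crs {z : ℝ → R2} {v : R2} {ξ : ℝ} (h : HasDerivAt z v ξ) (a : R2) :
    HasDerivAt (fun x => crs (z x) a) (crs v a) ξ := by
  unfold crs
  exact ((hasDerivAt_coord h 0).mul_const _).sub ((hasDerivAt_coord h 1).mul_const _)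

theorem continuous_coord (i : Fin 2) : Continuous (fun a : R2 => a i) := by fun_prop

@[fun_prop] theorem continuous_dt {X : Type*} [TopologicalSpace X] {f g : X → R2} (hf : Continuous f) (hg : Continuous g) :
    Continuous (fun x => dt (f x) (g x)) := by unfold dt; fun_prop
@[fun_prop] theorem continuous_crs {X : Type*} [TopologicalSpace X] {f g : X → R2} (hf : Continuous f) (hg : Continuous g) :
    Continuous (fun x => crs (f x) (g x)) := by unfold crs; fun_prop

@[fun_prop] theorem continuous_perp : Continuous perp := by
  unfold perp mk2
  refine (EuclideanSpace.equiv (Fin 2) ℝ).symm.continuous.comp ?_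
  refine continuous_pi fun i => ?_
  fin_cases i <;> simp <;> fun_prop
@[fun_prop] theorem continuous_reflect : Continuous reflect := by
  unfold reflect mk2
  refine (EuclideanSpace.equiv (Fin 2) ℝ).symm.continuous.comp ?_
  refine continuous_pi fun i => ?_
  fin_cases i <;> simp <;> fun_prop

theorem crs_sub_left (a b c : R2) : crs (a - b) c = crs a c - crs b c := by simp [crs]; ring
theorem crs_sub_right (a b c : R2) : crs a (b - c) = crs a b - crs a c := by simp [crs]; ring
theorem crs_add_left (a b c : R2) : crs (a + b) c = crs a c + crs b c := by simp [crs]; ring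
theorem crs_add_right (a b c : R2) : crs a (b + c) = crs a b + crs a c := by simp [crs]; ring
theorem crs_smul_left (r : ℝ) (a c : R2) : crs (r • a) c = r * crs a c := by simp [crs]; ring
theorem crs_smul_right (r : ℝ) (a c : R2) : crs a (r • c) = r * crs a c := by simp [crs]; ring
theorem dt_sub_left (a b c : R2) : dt (a - b) c = dt a c - dt b c := by simp [dt]; ring
theorem dt_sub_right (a b c : R2) : dt a (b - c) = dt a b - dt a c := by simp [dt]; ring
theorem dt_add_left (a b c : R2) : dt (a + b) c = dt a c + dt b c := by simp [dt]; ring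
theorem dt_smul_left (r : ℝ) (a c : R2) : dt (r • a) c = r * dt a c := by simp [dt]; ring
theorem dt_smul_right (r : ℝ) (a c : R2) : dt a (r • c) = r * dt a c := by simp [dt]; ring
theorem dt_comm (a b : R2) : dt a b = dt b a := by simp [dt]; ring
theorem crs_comm (a b : R2) : crs a b = - crs b a := by simp [crs]; ring

/-! ### curves -/

structure Crv (M γ c : ℝ) (z : ℝ → R2) : Prop where
  per : ∀ ξ, z (ξ + 2 * π) = z ξ
  inj : ∀ ξ η, z ξ = z η → distT ξ η = 0
  der : ∀ ξ, HasDerivAt z (deriv z ξ) ξ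
  cpos : 0 < c
  spd : ∀ ξ, ‖deriv z ξ‖ = c
  bd : ∀ ξ, ‖z ξ‖ ≤ M
  hol : ∀ ξ η, ‖deriv z ξ - deriv z η‖ ≤ M * |ξ - η| ^ γ
  g0 : 0 < γ
  g1 : γ ≤ 1
  M1 : 1 ≤ M
  cM : c ≤ M

theorem per_int {E : Type*} {z : ℝ → E} {p : ℝ} (h : ∀ ξ, z (ξ + p) = z ξ) (ξ : ℝ) (k : ℤ) :
    z (ξ + p * k) = z ξ := by
  have : Function.Periodic z p := h
  rw [mul_comm]
  exact (this.int_mul k) ξ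

theorem Crv.dper {M γ c : ℝ} {z : ℝ → R2} (h : Crv M γ c z) (ξ : ℝ) : deriv z (ξ + 2 * π) = deriv z ξ := by
  have : (fun x => z (x + 2 * π)) = z := funext h.per
  rw [← deriv_comp_add_const, this]

theorem taylor_aux {M γ : ℝ} {z v : ℝ → R2} (hd : ∀ ξ, HasDerivAt z (v ξ) ξ) (g0 : 0 < γ)
    (hol : ∀ ξ η, ‖v ξ - v η‖ ≤ M * |ξ - η| ^ γ) (M0 : 0 ≤ M) (ξ η : ℝ) :
    ‖z ξ - z η - (ξ - η) • v η‖ ≤ M * |ξ - η| ^ γ * |ξ - η| := by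
  have hg : ∀ x ∈ uIcc η ξ, HasDerivWithinAt (fun x => z x - x • v η) (v x - v η) (uIcc η ξ) x := by
    intro x _
    have h1 : HasDerivAt (fun x : ℝ => x • v η) ((1:ℝ) • v η) x := (hasDerivAt_id x).smul_const (v η)
    rw [one_smul] at h1
    exact ((hd x).sub h1).hasDerivWithinAt
  have := Convex.norm_image_sub_le_of_norm_hasDerivWithin_le (C := M * |ξ - η| ^ γ) hg ?_ (convex_uIcc η ξ)
    left_mem_uIcc right_mem_uIcc
  · rw [Real.norm_eq_abs] at this
    refine le_trans (le_of_eq ?_) this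
    congr 1; rw [sub_smul]; abel
  · intro x hx
    refine (hol x η).trans ?_
    have : |x - η| ≤ |ξ - η| := abs_sub_left_of_mem_uIcc hx
    gcongr

namespace Crv
variable {M γ c : ℝ} {z : ℝ → R2}

theorem zk (h : Crv M γ c z) (ξ : ℝ) (k : ℤ) : z (ξ + 2 * π * k) = z ξ := per_int h.per ξ k
theorem dk (h : Crv M γ c z) (ξ : ℝ) (k : ℤ) : deriv z (ξ + 2 * π * k) = deriv z ξ := per_int h.dper ξ k

theorem cont (h : Crv M γ c z) : Continuous z :=
  continuous_iff_continuousAt.mpr fun ξ => (h.der ξ).continuousAt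

theorem lip (h : Crv M γ c z) (ξ η : ℝ) : ‖z ξ - z η‖ ≤ c * |ξ - η| := by
  have := Convex.norm_image_sub_le_of_norm_hasDerivWithin_le (C := c) (s := univ) (f := z) (f' := deriv z)
    (fun x _ => (h.der x).hasDerivWithinAt) (fun x _ => (h.spd x).le) convex_univ (mem_univ η) (mem_univ ξ)
  simpa using this

theorem taylor (h : Crv M γ c z) (ξ η : ℝ) :
    ‖z ξ - z η - (ξ - η) • deriv z η‖ ≤ M * |ξ - η| ^ γ * |ξ - η| :=
  taylor_aux h.der h.g0 h.hol (by linarith [h.M1]) ξ η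

theorem lipT (h : Crv M γ c z) (ξ η : ℝ) : ‖z ξ - z η‖ ≤ c * distT ξ η := by
  obtain ⟨k, hk⟩ := distT_exists ξ η
  rw [hk, ← h.zk ξ k]
  refine (h.lip _ _).trans (le_of_eq ?_)
  congr 2; ring

theorem holT (h : Crv M γ c z) (ξ η : ℝ) : ‖deriv z ξ - deriv z η‖ ≤ M * (distT ξ η) ^ γ := by
  obtain ⟨k, hk⟩ := distT_exists ξ η
  rw [hk, ← h.dk ξ k]
  refine (h.hol _ _).trans (le_of_eq ?_)
  congr 3; ring

theorem dcont (h : Crv M γ c z) : Continuous (deriv z) := by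
  rw [continuous_iff_continuousAt]
  intro ξ
  rw [ContinuousAt, tendsto_iff_norm_sub_tendsto_zero]
  have h2 : Tendsto (fun η => M * |η - ξ| ^ γ) (nhds ξ) (nhds 0) := by
    have hc : Continuous (fun η => M * |η - ξ| ^ γ) := by
      have := h.g0
      exact continuous_const.mul ((by fun_prop : Continuous fun η => |η - ξ|).rpow_const (fun x => Or.inr this.le))
    have := hc.tendsto ξ
    simpa [Real.zero_rpow h.g0.ne'] using this
  exact squeeze_zero (fun _ => norm_nonneg _) (fun η => h.hol η ξ) h2

theorem short (h : Crv M γ c z) {r : ℝ} (hr : M * r ^ γ ≤ c / 2) {ξ η : ℝ} (hx : distT ξ η ≤ r) :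
    c / 2 * distT ξ η ≤ ‖z ξ - z η‖ := by
  obtain ⟨k, hk⟩ := distT_exists ξ η
  rw [hk] at hx ⊢
  rw [← h.zk ξ k]
  have h1 := h.taylor (ξ + 2 * π * k) η
  have e : ξ + 2 * π * k - η = ξ - η + 2 * π * k := by ring
  rw [e] at h1
  set x := |ξ - η + 2 * π * k| with hxd
  have h2 : M * x ^ γ ≤ c / 2 := by
    refine le_trans ?_ hr
    have := h.M1; have := h.g0
    gcongr
  have h3 : ‖(ξ - η + 2 * π * k) • deriv z η‖ = x * c := by
    rw [norm_smul, h.spd]; rfl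
  have h4 := norm_sub_norm_le ((ξ - η + 2 * π * k) • deriv z η) ((ξ - η + 2 * π * k) • deriv z η - (z (ξ + 2 * π * k) - z η))
  rw [sub_sub_cancel, norm_sub_rev _ (z (ξ + 2 * π * k) - z η), h3] at h4
  have h5 : M * x ^ γ * x ≤ c / 2 * x := by gcongr
  linarith

theorem inj' (h : Crv M γ c z) {ξ η : ℝ} (he : z ξ = z η) : ∃ k : ℤ, ξ = η + 2 * π * k := by
  obtain ⟨k, hk⟩ := distT_exists ξ η
  rw [h.inj ξ η he] at hk
  refine ⟨-k, ?_⟩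
  have := abs_eq_zero.mp hk.symm
  push_cast; linarith

theorem exists_r {M γ c : ℝ} (hγ : 0 < γ) (_ : 1 ≤ M) (hc : 0 < c) : ∃ r, 0 < r ∧ r ≤ 1 ∧ M * r ^ γ ≤ c := by
  have : Tendsto (fun r : ℝ => M * r ^ γ) (nhdsWithin 0 (Ioi 0)) (nhds 0) := by
    have hc : Continuous (fun r : ℝ => M * r ^ γ) :=
      continuous_const.mul (continuous_id.rpow_const (fun x => Or.inr hγ.le))
    have := (hc.tendsto 0).mono_left (nhdsWithin_le_nhds (s := Ioi (0:ℝ)))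
    simpa [Real.zero_rpow hγ.ne'] using this
  have h1 := this.eventually (gt_mem_nhds hc)
  have h2 : ∀ᶠ r : ℝ in nhdsWithin 0 (Ioi 0), r ∈ Ioo (0:ℝ) 1 := Ioo_mem_nhdsGT one_pos
  obtain ⟨r, hr, hr2⟩ := (h1.and h2).exists
  exact ⟨r, hr2.1, hr2.2.le, hr.le⟩

theorem reduce (ξ : ℝ) : ∃ k : ℤ, ξ + 2 * π * k ∈ Icc 0 (2 * π) := by
  obtain ⟨k, hk, -⟩ := existsUnique_add_zsmul_mem_Ico (by positivity : (0:ℝ) < 2 * π) ξ 0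
  refine ⟨k, ?_⟩
  rw [zsmul_eq_mul, zero_add, mul_comm (k : ℝ)] at hk
  exact Ico_subset_Icc_self hk

theorem arcchord (h : Crv M γ c z) : ∃ κ, 0 < κ ∧ ∀ ξ η, κ * distT ξ η ≤ ‖z ξ - z η‖ := by
  obtain ⟨r, hr0, hr1, hr⟩ := exists_r h.g0 h.M1 (half_pos h.cpos)
  set S : Set (ℝ × ℝ) := (Icc 0 (2 * π) ×ˢ Icc 0 (2 * π)) ∩ {p | r ≤ distT p.1 p.2}
  have hS : IsCompact S := (isCompact_Icc.prod isCompact_Icc).inter_right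
    (isClosed_le continuous_const distT_continuous)
  obtain ⟨m, hm0, hm⟩ : ∃ m, 0 < m ∧ ∀ p ∈ S, m ≤ ‖z p.1 - z p.2‖ := by
    rcases S.eq_empty_or_nonempty with hE | hE
    · exact ⟨1, one_pos, by simp [hE]⟩
    · have hc := h.cont
      obtain ⟨p, hp, hmin⟩ := hS.exists_isMinOn hE
        (by fun_prop : Continuous fun p : ℝ × ℝ => ‖z p.1 - z p.2‖).continuousOn
      refine ⟨‖z p.1 - z p.2‖, ?_, fun q hq => hmin hq⟩
      rw [norm_pos_iff, sub_ne_zero]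
      intro he
      have := h.inj _ _ he
      have h2 : r ≤ distT p.1 p.2 := hp.2
      linarith
  refine ⟨min (c / 2) (m / π), lt_min (half_pos h.cpos) (by positivity), fun ξ η => ?_⟩
  by_cases hd : distT ξ η ≤ r
  · refine le_trans ?_ (h.short hr hd)
    have := distT_nonneg ξ η
    gcongr; exact min_le_left _ _
  · push Not at hd
    obtain ⟨k, hk⟩ := reduce ξ
    obtain ⟨l, hl⟩ := reduce η
    have := hm (ξ + 2 * π * k, η + 2 * π * l) ⟨⟨hk, hl⟩, ?_⟩
    · simp only [h.zk] at this
      refine le_trans ?_ this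
      calc min (c / 2) (m / π) * distT ξ η ≤ m / π * π := by
            have := distT_le_pi ξ η
            have h0 := distT_nonneg ξ η
            gcongr; exact min_le_right _ _
        _ = m := by field_simp
    · have e1 : distT (ξ + 2 * π * k) ξ = 0 := by
        apply le_antisymm _ (distT_nonneg _ _)
        refine (distT_le _ _ (-k)).trans (le_of_eq ?_)
        push_cast; rw [abs_eq_zero]; ring
      have e2 : distT η (η + 2 * π * l) = 0 := by
        apply le_antisymm _ (distT_nonneg _ _)
        refine (distT_le _ _ l).trans (le_of_eq ?_)
        rw [abs_eq_zero]; ring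
      have e3 : distT ξ (ξ + 2 * π * k) = 0 := by rw [distT_comm, e1]
      have e4 : distT (η + 2 * π * l) η = 0 := by rw [distT_comm, e2]
      have t1 := distT_triangle ξ (ξ + 2 * π * k) η
      have t2 := distT_triangle (ξ + 2 * π * k) (η + 2 * π * l) η
      simp only [mem_ofPred_eq]
      linarith

end Crv
end

section
open Real Set Filter MeasureTheory

theorem impl_zero {F : ℝ → ℝ → ℝ} (hF : Continuous (Function.uncurry F)) {a b : ℝ} (hab : a < b) {S : Set ℝ}
    (mono : ∀ σ ∈ S, StrictMonoOn (F σ) (Icc a b)) (hneg : ∀ σ ∈ S, F σ a < 0) (hpos : ∀ σ ∈ S, 0 < F σ b) :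
    ∃ θ : ℝ → ℝ, ContinuousOn θ S ∧ ∀ σ ∈ S, θ σ ∈ Icc a b ∧ F σ (θ σ) = 0 := by
  have hex : ∀ σ, ∃ x, σ ∈ S → x ∈ Icc a b ∧ F σ x = 0 := by
    intro σ
    by_cases hσ : σ ∈ S
    · have hc : ContinuousOn (F σ) (Icc a b) := by
        have : Continuous (F σ) := hF.comp (by fun_prop : Continuous fun x : ℝ => (σ, x))
        exact this.continuousOn
      obtain ⟨x, hx, h0⟩ := intermediate_value_Icc hab.le hc ⟨(hneg σ hσ).le, (hpos σ hσ).le⟩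
      exact ⟨x, fun _ => ⟨hx, h0⟩⟩
    · exact ⟨0, fun h => absurd h hσ⟩
  choose θ hθ using hex
  refine ⟨θ, ?_, hθ⟩
  intro σ0 h0
  have hcl : ∀ l, Continuous (fun σ => F σ l) := fun l =>
    hF.comp (by fun_prop : Continuous fun x : ℝ => (x, l))
  obtain ⟨hm0, hz0⟩ := hθ σ0 h0
  refine tendsto_order.2 ⟨fun l hl => ?_, fun l hl => ?_⟩
  · by_cases hla : l < a
    · filter_upwards [self_mem_nhdsWithin] with σ hσ
      exact hla.trans_le (hθ σ hσ).1.1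
    · push Not at hla
      have hlm : l ∈ Icc a b := ⟨hla, hl.le.trans hm0.2⟩
      have : F σ0 l < 0 := hz0 ▸ mono σ0 h0 hlm hm0 hl
      have hev := ((hcl l).tendsto σ0).mono_left (nhdsWithin_le_nhds (s := S)) |>.eventually (gt_mem_nhds this)
      filter_upwards [self_mem_nhdsWithin, hev] with σ hσ h1
      rw [← (hθ σ hσ).2] at h1
      exact ((mono σ hσ).lt_iff_lt hlm (hθ σ hσ).1).mp h1
  · by_cases hla : b < l
    · filter_upwards [self_mem_nhdsWithin] with σ hσ
      exact (hθ σ hσ).1.2.trans_lt hla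
    · push Not at hla
      have hlm : l ∈ Icc a b := ⟨hm0.1.trans hl.le, hla⟩
      have : 0 < F σ0 l := hz0 ▸ mono σ0 h0 hm0 hlm hl
      have hev := ((hcl l).tendsto σ0).mono_left (nhdsWithin_le_nhds (s := S)) |>.eventually (lt_mem_nhds this)
      filter_upwards [self_mem_nhdsWithin, hev] with σ hσ h1
      rw [← (hθ σ hσ).2] at h1
      exact ((mono σ hσ).lt_iff_lt (hθ σ hσ).1 hlm).mp h1

theorem strictMonoOn_of_der {f f' : ℝ → ℝ} (h : ∀ x, HasDerivAt f (f' x) x) {a b : ℝ}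
    (hpos : ∀ x ∈ Icc a b, 0 < f' x) : StrictMonoOn f (Icc a b) := by
  apply strictMonoOn_of_deriv_pos (convex_Icc a b)
  · exact fun x _ => (h x).continuousAt.continuousWithinAt
  · intro x hx
    rw [(h x).deriv]
    exact hpos x (interior_subset hx)

theorem dperp (a b : R2) : dt a (perp b) = crs b a := by simp [dt, crs]; ring

/-- doubling lemma -/
theorem doubling {M γ c : ℝ} {z : ℝ → R2} (h : Crv M γ c z) :
    ∃ ε > 0, ∀ (Y V : ℝ → R2) (k : ℕ), 1 ≤ k → (∀ σ, HasDerivAt Y (V σ) σ) →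
      (∀ σ, ‖Y σ - z σ‖ ≤ ε) → (∀ σ, ‖V σ - deriv z σ‖ ≤ ε) → (∀ σ, Y (σ + 2 * π * k) = Y σ) →
      ∃ σ τ₁ τ₂, |τ₁ - σ| ≤ 1 ∧ |τ₂ - (σ + 2 * π)| ≤ 1 ∧ Y τ₁ = Y τ₂ := by
  have hc := h.cpos
  obtain ⟨r, hr0, hr1, hr⟩ := Crv.exists_r h.g0 h.M1 (by linarith : 0 < c / 4)
  refine ⟨min (c / 4) (r * c / 4), by positivity, ?_⟩
  intro Y V k hk hY hYz hVz hper
  set ε := min (c / 4) (r * c / 4) with hε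
  have hε1 : ε ≤ c / 4 := min_le_left _ _
  have hε2 : ε ≤ r * c / 4 := min_le_right _ _
  have hYc : Continuous Y := continuous_iff_continuousAt.mpr fun ξ => (hY ξ).continuousAt
  have hzc := h.cont
  have hdc := h.dcont
  set F : ℝ → ℝ → ℝ := fun σ θ => dt (Y (σ + θ) - z σ) (deriv z σ) with hF
  have hFc : Continuous (Function.uncurry F) := by
    simp only [hF, Function.uncurry_def]; fun_prop
  have hFd : ∀ σ θ, HasDerivAt (F σ) (dt (V (σ + θ)) (deriv z σ)) θ := by
    intro σ θ
    have h1 : HasDerivAt (fun x => Y (σ + x) - z σ) (V (σ + θ)) θ := by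
      have := (hY (σ + θ)).comp_const_add σ θ
      exact this.sub_const _
    exact hasDerivAt_dt h1 _
  have hFl : ∀ σ, ∀ θ ∈ Icc (-r) r, c ^ 2 / 2 ≤ dt (V (σ + θ)) (deriv z σ) := by
    intro σ θ hθ
    have e : dt (V (σ + θ)) (deriv z σ) = c ^ 2 + dt (V (σ + θ) - deriv z σ) (deriv z σ) := by
      rw [dt_sub_left, dt_self, h.spd]; ring
    have h1 := abs_dt_le (V (σ + θ) - deriv z σ) (deriv z σ)
    rw [h.spd] at h1
    have h2 : ‖V (σ + θ) - deriv z σ‖ ≤ c / 4 + c / 4 := by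
      have t := norm_add_le (V (σ + θ) - deriv z (σ + θ)) (deriv z (σ + θ) - deriv z σ)
      rw [sub_add_sub_cancel] at t
      have h3 := h.hol (σ + θ) σ
      have h4 : M * |σ + θ - σ| ^ γ ≤ M * r ^ γ := by
        have h5 : |σ + θ - σ| ≤ r := by rw [add_sub_cancel_left]; exact abs_le.mpr hθ
        have := h.M1; have := h.g0
        gcongr
      linarith [hVz (σ + θ)]
    have h3 := (abs_le.mp h1).1
    nlinarith
  have hF0 : ∀ σ, |F σ 0| ≤ r * c / 4 * c := by
    intro σ
    refine (abs_dt_le _ _).trans ?_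
    rw [h.spd]
    have := hYz (σ + 0)
    simp only [add_zero] at this ⊢
    gcongr; linarith
  have mono : ∀ σ ∈ univ, StrictMonoOn (F σ) (Icc (-r) r) := fun σ _ =>
    strictMonoOn_of_der (hFd σ) (fun θ hθ => lt_of_lt_of_le (by positivity) (hFl σ θ hθ))
  have hmv : ∀ σ, ∀ a b, a ∈ Icc (-r) r → b ∈ Icc (-r) r → a ≤ b → c ^ 2 / 2 * (b - a) ≤ F σ b - F σ a := by
    intro σ a b ha hb hab
    apply Convex.mul_sub_le_image_sub_of_le_deriv (convex_Icc (-r) r) (f := F σ) _ _ _ a ha b hb hab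
    · exact fun x _ => (hFd σ x).continuousAt.continuousWithinAt
    · exact fun x _ => (hFd σ x).differentiableAt.differentiableWithinAt
    · intro x hx
      rw [(hFd σ x).deriv]; exact hFl σ x (interior_subset hx)
  have m0 : (0:ℝ) ∈ Icc (-r) r := ⟨by linarith, hr0.le⟩
  have mr : r ∈ Icc (-r) r := ⟨by linarith, le_rfl⟩
  have mr' : -r ∈ Icc (-r) r := ⟨le_rfl, by linarith⟩
  have hrc : 0 < r * c * c := by positivity
  obtain ⟨θ, hθc, hθ⟩ := impl_zero hFc (by linarith : -r < r) (S := univ) mono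
    (fun σ _ => by
      have := hmv σ (-r) 0 mr' m0 (by linarith)
      have := (abs_le.mp (hF0 σ)).2
      nlinarith)
    (fun σ _ => by
      have := hmv σ 0 r m0 mr (by linarith)
      have := (abs_le.mp (hF0 σ)).1
      nlinarith)
  rw [continuousOn_univ] at hθc
  set ρ : ℝ → ℝ := fun σ => dt (Y (σ + θ σ) - z σ) (perp (deriv z σ)) with hρ
  have hρc : Continuous ρ := by simp only [hρ]; fun_prop
  have hzk : ∀ σ, z (σ + 2 * π * k) = z σ := fun σ => by exact_mod_cast h.zk σ k
  have hdk : ∀ σ, deriv z (σ + 2 * π * k) = deriv z σ := fun σ => by exact_mod_cast h.dk σ k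
  have hθper : ∀ σ, θ (σ + 2 * π * k) = θ σ := by
    intro σ
    obtain ⟨ha, hb⟩ := hθ (σ + 2 * π * k) trivial
    obtain ⟨ha', hb'⟩ := hθ σ trivial
    apply (mono σ trivial).injOn ha ha'
    rw [hb', ← hb]
    simp only [hF, hzk, hdk]
    rw [show σ + 2 * π * k + θ (σ + 2 * π * k) = σ + θ (σ + 2 * π * k) + 2 * π * k by ring, hper]
  have hρper : ∀ σ, ρ (σ + 2 * π * k) = ρ σ := by
    intro σ
    simp only [hρ, hzk, hdk, hθper]
    rw [show σ + 2 * π * k + θ σ = σ + θ σ + 2 * π * k by ring, hper]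
  set g : ℝ → ℝ := fun σ => ρ (σ + 2 * π) - ρ σ with hg
  have hgc : Continuous g := by simp only [hg]; fun_prop
  have hsum : ∑ i ∈ Finset.range k, g (2 * π * i) = 0 := by
    have : ∀ i : ℕ, g (2 * π * i) = ρ (2 * π * ((i + 1 : ℕ) : ℝ)) - ρ (2 * π * i) := by
      intro i; simp only [hg]; push_cast; congr 2; ring
    simp only [this]
    rw [Finset.sum_range_sub (fun i : ℕ => ρ (2 * π * (i : ℝ)))]
    have := hρper 0
    simp at this ⊢
    linarith
  have hkne : (Finset.range k).Nonempty := Finset.nonempty_range_iff.mpr (by omega)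
  obtain ⟨i, -, hi⟩ : ∃ i ∈ Finset.range k, g (2 * π * i) ≤ 0 := by
    by_contra! hcon
    have := Finset.sum_pos hcon hkne
    linarith
  obtain ⟨j, -, hj⟩ : ∃ i ∈ Finset.range k, 0 ≤ g (2 * π * i) := by
    by_contra! hcon
    have := Finset.sum_neg hcon hkne
    linarith
  obtain ⟨σ, hσ⟩ : ∃ σ, g σ = 0 := by
    have := mem_range_of_exists_le_of_exists_ge hgc ⟨_, hi⟩ ⟨_, hj⟩
    exact this
  refine ⟨σ, σ + θ σ, σ + 2 * π + θ (σ + 2 * π), ?_, ?_, ?_⟩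
  · rw [add_sub_cancel_left]
    exact (abs_le.mpr (hθ σ trivial).1).trans hr1
  · rw [add_sub_cancel_left]
    exact (abs_le.mpr (hθ _ trivial).1).trans hr1
  · have a1 := (hθ σ trivial).2
    have a2 := (hθ (σ + 2 * π) trivial).2
    simp only [hF, hg, hρ, h.per, h.dper] at a1 a2 hσ
    set P := Y (σ + θ σ)
    set Q := Y (σ + 2 * π + θ (σ + 2 * π))
    set e := deriv z σ with he
    have hne : ‖e‖ = c := h.spd σ
    have d1 : dt (P - Q) e = 0 := by rw [dt_sub_left] at *; linarith
    have d2 : crs (P - Q) e = 0 := by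
      rw [dperp, dperp, crs_sub_right, crs_sub_right] at hσ
      rw [crs_comm, crs_sub_right]; linarith
    have := lagr (P - Q) e
    rw [d1, d2, hne] at this
    have h0 : ‖P - Q‖ = 0 := by
      have h1 : ‖P - Q‖ * c = 0 := by
        apply pow_eq_zero_iff (two_ne_zero) |>.mp; linarith
      rcases mul_eq_zero.mp h1 with h2 | h2
      · exact h2
      · exact absurd h2 hc.ne'
    exact sub_eq_zero.mp (norm_eq_zero.mp h0)

/-- rigidity -/
theorem rigid {M γ c : ℝ} {z : ℝ → R2} (h : Crv M γ c z) {w v : ℝ → R2} {c' : ℝ} (hc' : 0 < c')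
    (hw : ∀ ξ, HasDerivAt w (v ξ) ξ) (hv : Continuous v) (hvn : ∀ ξ, ‖v ξ‖ = c')
    (hr : ∀ ξ, w ξ ∈ range z) :
    ∃ s φ₀ : ℝ, |s| = c' / c ∧ ∀ ξ, w ξ = z (φ₀ + s * ξ) ∧ v ξ = s • deriv z (φ₀ + s * ξ) := by
  have hc := h.cpos
  obtain ⟨κ, hκ, hac⟩ := h.arcchord
  choose φ hφ using hr
  have hwlip : ∀ ξ η, ‖w ξ - w η‖ ≤ c' * |ξ - η| := by
    intro ξ η
    have := Convex.norm_image_sub_le_of_norm_hasDerivWithin_le (C := c') (s := univ) (f := w) (f' := v)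
      (fun x _ => (hw x).hasDerivWithinAt) (fun x _ => (hvn x).le) convex_univ (mem_univ η) (mem_univ ξ)
    simpa using this
  have hdist : ∀ ξ η, distT (φ ξ) (φ η) ≤ c' / κ * |ξ - η| := by
    intro ξ η
    have h1 := hac (φ ξ) (φ η)
    rw [hφ, hφ] at h1
    have h2 := hwlip ξ η
    rw [div_mul_eq_mul_div, le_div_iff₀ hκ]; linarith
  set s : ℝ → ℝ := fun ξ => dt (v ξ) (deriv z (φ ξ)) / c ^ 2 with hs
  -- local lift
  have hlift : ∀ ξ0, ∃ ψ : ℝ → ℝ, (∀ ξ, ∃ k : ℤ, ψ ξ = φ ξ + 2 * π * k) ∧ ψ ξ0 = φ ξ0 ∧ HasDerivAt ψ (s ξ0) ξ0 := by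
    intro ξ0
    have : ∀ ξ, ∃ k : ℤ, distT (φ ξ) (φ ξ0) = |φ ξ - φ ξ0 + 2 * π * k| := fun ξ => distT_exists _ _
    choose k hk using this
    set ψ : ℝ → ℝ := fun ξ => φ ξ + 2 * π * k ξ with hψ
    have hψl : ∀ ξ, |ψ ξ - φ ξ0| ≤ c' / κ * |ξ - ξ0| := by
      intro ξ
      refine le_trans (le_of_eq ?_) (hdist ξ ξ0)
      rw [hk]; congr 1; simp only [hψ]; ring
    have hψ0 : ψ ξ0 = φ ξ0 := by
      have := hψl ξ0
      rw [sub_self, abs_zero, mul_zero] at this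
      have := abs_nonpos_iff.mp this
      linarith
    refine ⟨ψ, fun ξ => ⟨k ξ, rfl⟩, hψ0, ?_⟩
    have hψl' : ∀ ξ, |ψ ξ - ψ ξ0| ≤ c' / κ * |ξ - ξ0| := by rw [hψ0]; exact hψl
    have hwψ : ∀ ξ, z (ψ ξ) = w ξ := fun ξ => by simp only [hψ]; rw [h.zk, hφ]
    have hψc : Tendsto ψ (nhds ξ0) (nhds (ψ ξ0)) := by
      rw [tendsto_iff_norm_sub_tendsto_zero]
      refine squeeze_zero (fun _ => norm_nonneg _) hψl' ?_
      have : Continuous fun ξ => c' / κ * |ξ - ξ0| := by fun_prop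
      simpa using this.tendsto ξ0
    have hO : (fun ξ => ψ ξ - ψ ξ0) =O[nhds ξ0] (fun ξ => ξ - ξ0) :=
      Asymptotics.IsBigO.of_bound (c' / κ) (Eventually.of_forall fun ξ => by
        simpa [Real.norm_eq_abs] using hψl' ξ)
    set e := deriv z (ψ ξ0) with he
    have hG : HasDerivAt (fun x => dt (z x) e) (c ^ 2) (ψ ξ0) := by
      have := hasDerivAt_dt (h.der (ψ ξ0)) e
      rwa [← he, dt_self, he, h.spd] at this
    have hW : HasDerivAt (fun x => dt (w x) e) (dt (v ξ0) e) ξ0 := hasDerivAt_dt (hw ξ0) e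
    have o1 := (hasDerivAt_iff_isLittleO.mp hG).comp_tendsto hψc |>.trans_isBigO hO
    have o2 := hasDerivAt_iff_isLittleO.mp hW
    rw [hasDerivAt_iff_isLittleO]
    have o3 := (o2.sub o1).const_mul_left (1 / c ^ 2)
    refine o3.congr' (Eventually.of_forall fun ξ => ?_) EventuallyEq.rfl
    simp only [Function.comp_apply, hwψ, smul_eq_mul, hs]
    rw [← hψ0, ← he]
    field_simp
    ring
  have hvs : ∀ ξ, v ξ = s ξ • deriv z (φ ξ) := by
    intro ξ0
    obtain ⟨ψ, hk, h0, hd⟩ := hlift ξ0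
    have : HasDerivAt (z ∘ ψ) (s ξ0 • deriv z (ψ ξ0)) ξ0 := HasDerivAt.scomp ξ0 (h.der _) hd
    have e : z ∘ ψ = w := by
      funext ξ; obtain ⟨k, hk⟩ := hk ξ
      rw [Function.comp_apply, hk, h.zk, hφ]
    rw [e, h0] at this
    exact (hw ξ0).unique this
  have hsabs : ∀ ξ, |s ξ| = c' / c := by
    intro ξ
    have := congrArg norm (hvs ξ)
    rw [hvn, norm_smul, h.spd, Real.norm_eq_abs] at this
    field_simp; linarith
  have hsc : Continuous s := by
    have h1 : Continuous (fun ξ => deriv z (φ ξ)) := by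
      rw [continuous_iff_continuousAt]
      intro ξ
      rw [ContinuousAt, tendsto_iff_norm_sub_tendsto_zero]
      have hc : Continuous (fun η => M * (c' / κ * |η - ξ|) ^ γ) := by
        have := h.g0
        exact continuous_const.mul ((by fun_prop : Continuous fun η => c' / κ * |η - ξ|).rpow_const
          (fun x => Or.inr this.le))
      have h2 := hc.tendsto ξ
      simp only [sub_self, abs_zero, mul_zero, Real.zero_rpow h.g0.ne'] at h2
      refine squeeze_zero (fun _ => norm_nonneg _) (fun η => ?_) h2
      refine (h.holT _ _).trans ?_
      have := h.M1; have := h.g0; have := hdist η ξ; have := distT_nonneg (φ η) (φ ξ)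
      gcongr
    simp only [hs]; fun_prop
  obtain ⟨s0, hs0⟩ : ∃ s0, ∀ ξ, s ξ = s0 := by
    have hsq : ∀ ξ, s ξ ^ 2 = (s 0) ^ 2 := fun ξ => by
      rw [← sq_abs, hsabs, ← sq_abs (s 0), hsabs]
    have hne : s 0 ≠ 0 := by
      intro h0
      have := hsabs 0
      rw [h0, abs_zero] at this
      have : 0 < c' / c := by positivity
      linarith
    have := (isPreconnected_univ (α := ℝ)).eq_or_eq_neg_of_sq_eq (f := s) (g := fun _ => s 0)
      hsc.continuousOn continuousOn_const (fun ξ _ => hsq ξ) (fun _ => hne)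
    rcases this with h1 | h1
    · exact ⟨s 0, fun ξ => h1 (mem_univ ξ)⟩
    · exact ⟨-s 0, fun ξ => h1 (mem_univ ξ)⟩
  set E : ℝ → ℂ := fun ξ => Complex.exp ((φ ξ : ℂ) * Complex.I) with hE
  have hEd : ∀ ξ, HasDerivAt E (E ξ * ((s0 : ℂ) * Complex.I)) ξ := by
    intro ξ0
    obtain ⟨ψ, hk, h0, hd⟩ := hlift ξ0
    have h1 : HasDerivAt (fun ξ => Complex.exp ((ψ ξ : ℂ) * Complex.I))
        (Complex.exp ((ψ ξ0 : ℂ) * Complex.I) * ((s ξ0 : ℂ) * Complex.I)) ξ0 :=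
      (hd.ofReal_comp.mul_const Complex.I).cexp
    have e : (fun ξ => Complex.exp ((ψ ξ : ℂ) * Complex.I)) = E := by
      funext ξ
      obtain ⟨k, hk⟩ := hk ξ
      simp only [hE]
      rw [Complex.exp_eq_exp_iff_exists_int]
      refine ⟨k, ?_⟩
      rw [hk]; push_cast; ring
    rw [e, h0, hs0] at h1
    exact h1
  have hconst : ∀ ξ, E ξ * Complex.exp (-((s0 : ℂ) * ξ * Complex.I)) = E 0 := by
    have hd : ∀ ξ : ℝ, HasDerivAt (fun ξ : ℝ => E ξ * Complex.exp (-((s0 : ℂ) * ξ * Complex.I))) 0 ξ := by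
      intro ξ
      have h1 : HasDerivAt (fun ξ : ℝ => Complex.exp (-((s0 : ℂ) * ξ * Complex.I)))
          (Complex.exp (-((s0 : ℂ) * ξ * Complex.I)) * (-((s0 : ℂ) * ((1 : ℝ) : ℂ) * Complex.I))) ξ :=
        ((((hasDerivAt_id ξ).ofReal_comp.const_mul (s0 : ℂ)).mul_const Complex.I).neg).cexp
      have h2 := (hEd ξ).mul h1
      have h3 : E ξ * ((s0 : ℂ) * Complex.I) * Complex.exp (-((s0 : ℂ) * ξ * Complex.I)) + E ξ * (Complex.exp (-((s0 : ℂ) * ξ * Complex.I)) * (-((s0 : ℂ) * ((1 : ℝ) : ℂ) * Complex.I))) = 0 := by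
        push_cast; ring
      rw [h3] at h2
      exact h2
    intro ξ
    have := is_const_of_deriv_eq_zero (fun x => (hd x).differentiableAt) (fun x => (hd x).deriv) ξ 0
    rw [this]; simp
  have hφf : ∀ ξ, ∃ k : ℤ, φ ξ = (φ 0 + s0 * ξ) + 2 * π * k := by
    intro ξ
    have h1 := hconst ξ
    simp only [hE] at h1
    rw [← Complex.exp_add, Complex.exp_eq_exp_iff_exists_int] at h1
    obtain ⟨n, hn⟩ := h1
    refine ⟨n, ?_⟩
    have h2 := congrArg Complex.im hn
    simp at h2
    linarith
  refine ⟨s0, φ 0, by rw [← hs0 0]; exact hsabs 0, fun ξ => ?_⟩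
  obtain ⟨k, hk⟩ := hφf ξ
  refine ⟨?_, ?_⟩
  · rw [← hφ ξ, hk, h.zk]
  · rw [hvs, hs0, hk, h.dk]
end

section
open Real Set Filter MeasureTheory

theorem ulim {ι E : Type*} [NormedAddCommGroup E] [ProperSpace E] (U : Ultrafilter ι) {f : ι → E} {R : ℝ}
    (h : ∀ᶠ i in (U : Filter ι), ‖f i‖ ≤ R) : ∃ x, Tendsto f (U : Filter ι) (nhds x) := by
  obtain ⟨x, -, hx⟩ := (isCompact_closedBall (0 : E) R).ultrafilter_le_nhds (U.map f) (by
    rw [le_principal_iff]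
    exact h.mono fun i hi => by simpa using hi)
  exact ⟨x, hx⟩

theorem unif {ι E : Type*} [NormedAddCommGroup E] {F : Filter ι} [F.NeBot] {f : ι → ℝ → E} {g : ℝ → E} {K γ : ℝ}
    (hγ : 0 < γ) (hK : 1 ≤ K)
    (hp : ∀ᶠ i in F, ∀ ξ, f i (ξ + 2 * π) = f i ξ) (hh : ∀ᶠ i in F, ∀ ξ η, ‖f i ξ - f i η‖ ≤ K * |ξ - η| ^ γ)
    (hl : ∀ ξ, Tendsto (fun i => f i ξ) F (nhds (g ξ))) {ε : ℝ} (hε : 0 < ε) :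
    ∀ᶠ i in F, ∀ ξ, ‖f i ξ - g ξ‖ ≤ ε := by
  have hgp : ∀ ξ, g (ξ + 2 * π) = g ξ := fun ξ =>
    tendsto_nhds_unique_of_eventuallyEq (hl _) (hl _) (hp.mono fun i hi => hi ξ)
  have hgh : ∀ ξ η, ‖g ξ - g η‖ ≤ K * |ξ - η| ^ γ := fun ξ η =>
    le_of_tendsto ((hl ξ).sub (hl η)).norm (hh.mono fun i hi => hi ξ η)
  obtain ⟨r, hr0, hr1, hr⟩ := Crv.exists_r hγ hK (by linarith : 0 < ε / 3)
  obtain ⟨t, -, hfin, hcov⟩ := (isCompact_Icc (a := (0:ℝ)) (b := 2 * π)).finite_cover_balls hr0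
  have hev : ∀ᶠ i in F, ∀ x ∈ t, ‖f i x - g x‖ ≤ ε / 3 := by
    rw [eventually_all_finite hfin]
    intro x _
    have := (tendsto_iff_norm_sub_tendsto_zero.mp (hl x)).eventually (gt_mem_nhds (by linarith : 0 < ε / 3))
    exact this.mono fun i hi => hi.le
  filter_upwards [hp, hh, hev] with i hp hh hev ξ
  obtain ⟨k, hk⟩ := Crv.reduce ξ
  rw [← per_int hp ξ k, ← per_int hgp ξ k]
  set η := ξ + 2 * π * k
  obtain ⟨x, hx, hηx⟩ := mem_iUnion₂.mp (hcov hk)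
  rw [Metric.mem_ball, Real.dist_eq] at hηx
  have e1 : K * |η - x| ^ γ ≤ ε / 3 := le_trans (by gcongr) hr
  have h1 := hh η x
  have h2 := hgh η x
  have h3 := hev x hx
  have : f i η - g η = (f i η - f i x) + (f i x - g x) - (g η - g x) := by abel
  rw [this]
  have := norm_sub_le ((f i η - f i x) + (f i x - g x)) (g η - g x)
  have := norm_add_le (f i η - f i x) (f i x - g x)
  linarith

theorem der_of_taylor {M γ : ℝ} {w : ℝ → R2} {v : R2} {η : ℝ} (g0 : 0 < γ)
    (h : ∀ ξ, ‖w ξ - w η - (ξ - η) • v‖ ≤ M * |ξ - η| ^ γ * |ξ - η|) : HasDerivAt w v η := by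
  rw [hasDerivAt_iff_isLittleO, Asymptotics.isLittleO_iff]
  intro e he
  have hc : Continuous (fun ξ => M * |ξ - η| ^ γ) :=
    continuous_const.mul ((by fun_prop : Continuous fun ξ => |ξ - η|).rpow_const (fun x => Or.inr g0.le))
  have h2 := hc.tendsto η
  simp only [sub_self, abs_zero, Real.zero_rpow g0.ne', mul_zero] at h2
  filter_upwards [h2.eventually (gt_mem_nhds he)] with ξ hξ
  refine (h ξ).trans ?_
  rw [Real.norm_eq_abs]; gcongr

theorem area_mul {M γ c : ℝ} {z : ℝ → R2} (h : Crv M γ c z) (k : ℤ) (φ : ℝ) :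
    ∫ ξ in (0:ℝ)..(2 * π), crs (z (φ + k * ξ)) ((k : ℝ) • deriv z (φ + k * ξ)) =
      k * ∫ ξ in (0:ℝ)..(2 * π), crs (z ξ) (deriv z ξ) := by
  have hp : Function.Periodic (fun ξ => crs (z ξ) (deriv z ξ)) (2 * π) := fun ξ => by
    simp only [h.per, h.dper]
  simp only [crs_smul_right]
  rw [intervalIntegral.integral_const_mul]
  have h1 := intervalIntegral.smul_integral_comp_add_mul (a := 0) (b := 2 * π)
    (fun ξ => crs (z ξ) (deriv z ξ)) (k : ℝ) φ
  rw [smul_eq_mul] at h1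
  rw [h1]
  have h2 := hp.intervalIntegral_add_zsmul_eq k φ
  have h3 := hp.intervalIntegral_add_eq φ 0
  simp only [zsmul_eq_mul, zero_add] at h2 h3
  rw [mul_zero, add_zero, h2 (fun a b => Continuous.intervalIntegrable (by have := h.cont; have := h.dcont; fun_prop) _ _), h3]

theorem near_area {y v w x : ℝ → R2} {M ε : ℝ} (hy : Continuous y) (hv : Continuous v) (hw : Continuous w) (hx : Continuous x)
    (h1 : ∀ ξ, ‖y ξ - w ξ‖ ≤ ε) (h2 : ∀ ξ, ‖v ξ - x ξ‖ ≤ ε) (h3 : ∀ ξ, ‖v ξ‖ ≤ M) (h4 : ∀ ξ, ‖w ξ‖ ≤ M) :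
    |(∫ ξ in (0:ℝ)..(2 * π), crs (y ξ) (v ξ)) - ∫ ξ in (0:ℝ)..(2 * π), crs (w ξ) (x ξ)| ≤ 2 * M * ε * (2 * π) := by
  rw [← intervalIntegral.integral_sub (Continuous.intervalIntegrable (by fun_prop) _ _)
    (Continuous.intervalIntegrable (by fun_prop) _ _)]
  have := intervalIntegral.norm_integral_le_of_norm_le_const (a := 0) (b := 2 * π) (C := 2 * M * ε)
    (f := fun ξ => crs (y ξ) (v ξ) - crs (w ξ) (x ξ)) ?_
  · rwa [Real.norm_eq_abs, sub_zero, abs_of_pos two_pi_pos] at this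
  · intro ξ _
    have e : crs (y ξ) (v ξ) - crs (w ξ) (x ξ) = crs (y ξ - w ξ) (v ξ) + crs (w ξ) (v ξ - x ξ) := by
      rw [crs_sub_left, crs_sub_right]; ring
    rw [e]
    refine (norm_add_le _ _).trans ?_
    have a1 := (abs_crs_le (y ξ - w ξ) (v ξ))
    have a2 := (abs_crs_le (w ξ) (v ξ - x ξ))
    have b1 : ‖y ξ - w ξ‖ * ‖v ξ‖ ≤ ε * M :=
      mul_le_mul (h1 ξ) (h3 ξ) (norm_nonneg _) ((norm_nonneg _).trans (h1 ξ))
    have b2 : ‖w ξ‖ * ‖v ξ - x ξ‖ ≤ M * ε :=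
      mul_le_mul (h4 ξ) (h2 ξ) (norm_nonneg _) ((norm_nonneg _).trans (h4 ξ))
    rw [Real.norm_eq_abs, Real.norm_eq_abs]
    linarith

theorem Crv.range_closed {M γ c : ℝ} {z : ℝ → R2} (h : Crv M γ c z) : IsCompact (range z) := by
  have : range z = z '' Icc 0 (2 * π) := by
    ext p; constructor
    · rintro ⟨ξ, rfl⟩
      obtain ⟨k, hk⟩ := Crv.reduce ξ
      exact ⟨_, hk, h.zk ξ k⟩
    · rintro ⟨ξ, -, rfl⟩; exact ⟨ξ, rfl⟩
  rw [this]
  exact isCompact_Icc.image h.cont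

/-- convergence lemma -/
theorem convC {ι : Type*} {F : Filter ι} {M γ c : ℝ} {z : ℝ → R2} (h : Crv M γ c z)
    (hA : 0 < ∫ ξ in (0:ℝ)..(2 * π), crs (z ξ) (deriv z ξ)) {y : ι → ℝ → R2} {cc : ι → ℝ}
    (hy : ∀ᶠ i in F, Crv M γ (cc i) (y i))
    (hyA : ∀ᶠ i in F, 0 < ∫ ξ in (0:ℝ)..(2 * π), crs (y i ξ) (deriv (y i) ξ))
    (hH : ∀ ε > 0, ∀ᶠ i in F, (∀ ξ, ∃ η, ‖y i ξ - z η‖ ≤ ε) ∧ ∀ η, ∃ ξ, ‖y i ξ - z η‖ ≤ ε)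
    {ε : ℝ} (hε : 0 < ε) :
    ∀ᶠ i in F, ∃ s, ∀ ξ, ‖y i ξ - z (ξ + s)‖ ≤ ε ∧ ‖deriv (y i) ξ - deriv z (ξ + s)‖ ≤ ε := by
  rw [Filter.Eventually, mem_iff_ultrafilter]
  intro U hU
  replace hy : ∀ᶠ i in (U : Filter ι), Crv M γ (cc i) (y i) := hU hy
  replace hyA := hyA.filter_mono hU
  replace hH := fun ε hε => (hH ε hε).filter_mono hU
  change ∀ᶠ i in (U : Filter ι), _
  have hM := h.M1
  have hc := h.cpos
  have hw : ∀ ξ, ∃ x, Tendsto (fun i => y i ξ) (U : Filter ι) (nhds x) := fun ξ =>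
    ulim U (R := M) (hy.mono fun i hi => hi.bd ξ)
  have hv : ∀ ξ, ∃ x, Tendsto (fun i => deriv (y i) ξ) (U : Filter ι) (nhds x) := fun ξ =>
    ulim U (R := M) (hy.mono fun i hi => (hi.spd ξ).le.trans hi.cM)
  obtain ⟨c', hc'⟩ : ∃ c', Tendsto cc (U : Filter ι) (nhds c') :=
    ulim U (R := M) (hy.mono fun i hi => by rw [Real.norm_eq_abs, abs_of_pos hi.cpos]; exact hi.cM)
  choose w hw using hw
  choose v hv using hv
  have uw := fun {e : ℝ} (he : 0 < e) => unif (K := M) (γ := 1) one_pos hM (hy.mono fun i hi => hi.per)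
    (hy.mono fun i hi ξ η => by
      rw [Real.rpow_one]; exact (hi.lip ξ η).trans (by gcongr; exact hi.cM)) hw he
  have uv := fun {e : ℝ} (he : 0 < e) => unif (K := M) (γ := γ) h.g0 hM (hy.mono fun i hi => hi.dper)
    (hy.mono fun i hi => hi.hol) hv he
  have hvn : ∀ ξ, ‖v ξ‖ = c' := fun ξ =>
    tendsto_nhds_unique_of_eventuallyEq (hv ξ).norm hc' (hy.mono fun i hi => hi.spd ξ)
  have hwd : ∀ ξ, HasDerivAt w (v ξ) ξ := fun η => der_of_taylor (M := M) h.g0 fun ξ =>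
    le_of_tendsto (((hw ξ).sub (hw η)).sub ((hv η).const_smul (ξ - η))).norm (hy.mono fun i hi => hi.taylor ξ η)
  have hvh : ∀ ξ η, ‖v ξ - v η‖ ≤ M * |ξ - η| ^ γ := fun ξ η =>
    le_of_tendsto ((hv ξ).sub (hv η)).norm (hy.mono fun i hi => hi.hol ξ η)
  have hwb : ∀ ξ, ‖w ξ‖ ≤ M := fun ξ => le_of_tendsto (hw ξ).norm (hy.mono fun i hi => hi.bd ξ)
  have hvc : Continuous v := by
    rw [continuous_iff_continuousAt]
    intro η
    rw [ContinuousAt, tendsto_iff_norm_sub_tendsto_zero]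
    have hc : Continuous (fun ξ => M * |ξ - η| ^ γ) :=
      continuous_const.mul ((by fun_prop : Continuous fun ξ => |ξ - η|).rpow_const (fun x => Or.inr h.g0.le))
    have h2 := hc.tendsto η
    simp only [sub_self, abs_zero, Real.zero_rpow h.g0.ne', mul_zero] at h2
    exact squeeze_zero (fun _ => norm_nonneg _) (fun ξ => hvh ξ η) h2
  have hwp : ∀ ξ, w (ξ + 2 * π) = w ξ := fun ξ =>
    tendsto_nhds_unique_of_eventuallyEq (hw _) (hw _) (hy.mono fun i hi => hi.per ξ)
  have hwr : ∀ ξ, w ξ ∈ range z := by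
    intro ξ
    rw [← h.range_closed.isClosed.closure_eq, Metric.mem_closure_iff]
    intro e he
    obtain ⟨i, h1, h2⟩ := ((hH (e / 3) (by linarith)).and (uw (by linarith : 0 < e / 3))).exists
    obtain ⟨η, hη⟩ := h1.1 ξ
    refine ⟨z η, ⟨η, rfl⟩, ?_⟩
    have := h2 ξ
    rw [norm_sub_rev] at this
    have := norm_sub_le_norm_sub_add_norm_sub (w ξ) (y i ξ) (z η)
    rw [dist_eq_norm]; linarith
  have hc'0 : 0 < c' := by
    have h0 : 0 ≤ c' := by rw [← hvn 0]; positivity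
    rcases h0.lt_or_eq with h1 | h1
    · exact h1
    exfalso
    have hcst : ∀ ξ, w ξ = w 0 := fun ξ =>
      is_const_of_deriv_eq_zero (fun x => (hwd x).differentiableAt)
        (fun x => by rw [(hwd x).deriv, ← norm_eq_zero, hvn, h1]) ξ 0
    have : ∀ η, z η = w 0 := by
      intro η
      refine eq_of_forall_dist_le fun e he => ?_
      obtain ⟨i, h1, h2⟩ := ((hH (e / 3) (by linarith)).and (uw (by linarith : 0 < e / 3))).exists
      obtain ⟨ξ, hξ⟩ := h1.2 η
      have := h2 ξ
      rw [hcst] at this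
      rw [norm_sub_rev] at hξ
      have := norm_sub_le_norm_sub_add_norm_sub (z η) (y i ξ) (w 0)
      rw [dist_eq_norm]; linarith
    have h3 := h.inj 0 π ((this 0).trans (this π).symm)
    rw [distT_of_le (by rw [zero_sub, abs_neg, abs_of_pos pi_pos]), zero_sub, abs_neg, abs_of_pos pi_pos] at h3
    linarith [pi_pos]
  obtain ⟨s, φ, hs, hsw⟩ := rigid h hc'0 hwd hvc hvn hwr
  obtain ⟨k, hk⟩ : ∃ k : ℤ, s = k := by
    have h1 := hwp 0
    rw [(hsw _).1, (hsw _).1] at h1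
    obtain ⟨k, hk⟩ := h.inj' h1
    refine ⟨k, ?_⟩
    have := two_pi_pos
    have : 2 * π * s = 2 * π * k := by linarith
    exact mul_left_cancel₀ (by positivity) this
  subst hk
  have hkne : k ≠ 0 := by
    rintro rfl
    simp only [Int.cast_zero, abs_zero] at hs
    have : 0 < c' / c := by positivity
    linarith
  have hwcont : Continuous w := continuous_iff_continuousAt.mpr fun ξ => (hwd ξ).continuousAt
  have hAw : ∫ ξ in (0:ℝ)..(2 * π), crs (w ξ) (v ξ) = k * ∫ ξ in (0:ℝ)..(2 * π), crs (z ξ) (deriv z ξ) := by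
    rw [← area_mul h k φ]
    congr 1; funext ξ; rw [(hsw ξ).1, (hsw ξ).2]
  have hkpos : 0 < k := by
    rcases lt_or_gt_of_ne hkne with h1 | h1
    swap
    · exact h1
    exfalso
    set A := ∫ ξ in (0:ℝ)..(2 * π), crs (z ξ) (deriv z ξ)
    have h2 : (k : ℝ) ≤ -1 := by exact_mod_cast (by omega : k ≤ -1)
    have he : 0 < A / (2 * M * (2 * π) * 2) := by positivity
    obtain ⟨i, h3, h4, h5, h6⟩ := (hy.and (hyA.and ((uw he).and (uv he)))).exists
    have h7 := near_area h3.cont h3.dcont hwcont hvc h5 h6 (fun ξ => (h3.spd ξ).le.trans h3.cM) hwb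
    have : 2 * M * (A / (2 * M * (2 * π) * 2)) * (2 * π) = A / 2 := by field_simp
    rw [this, hAw] at h7
    have := abs_le.mp h7
    nlinarith
  have hk1 : k = 1 := by
    obtain ⟨e, he, hdb⟩ := doubling h
    obtain ⟨i, h3, h5, h6⟩ := (hy.and ((uw he).and (uv he))).exists
    obtain ⟨m, rfl⟩ := Int.eq_ofNat_of_zero_le hkpos.le
    simp only [Int.cast_natCast] at *
    have hm1 : 1 ≤ m := by omega
    have hm0 : (0:ℝ) < m := by exact_mod_cast hm1
    have hm1' : (1:ℝ) ≤ m := by exact_mod_cast hm1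
    obtain ⟨σ, τ₁, τ₂, a1, a2, a3⟩ := hdb (fun σ => y i ((σ - φ) / m)) (fun σ => (1 / (m:ℝ)) • deriv (y i) ((σ - φ) / m)) m hm1
      (fun σ => by
        have : HasDerivAt (fun σ : ℝ => (σ - φ) / m) (1 / (m:ℝ)) σ := ((hasDerivAt_id σ).sub_const φ).div_const _
        exact HasDerivAt.scomp σ (h3.der _) this)
      (fun σ => by
        have := h5 ((σ - φ) / m)
        rw [(hsw _).1] at this
        rwa [show φ + (m:ℝ) * ((σ - φ) / m) = σ by field_simp; ring] at this)
      (fun σ => by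
        have := h6 ((σ - φ) / m)
        rw [(hsw _).2] at this
        rw [show φ + (m:ℝ) * ((σ - φ) / m) = σ by field_simp; ring] at this
        have e1 : (1 / (m:ℝ)) • deriv (y i) ((σ - φ) / m) - deriv z σ
          = (1 / (m:ℝ)) • (deriv (y i) ((σ - φ) / m) - (m:ℝ) • deriv z σ) := by
          rw [smul_sub, smul_smul, one_div_mul_cancel hm0.ne', one_smul]
        rw [e1, norm_smul, Real.norm_eq_abs, abs_of_pos (by positivity)]
        calc _ ≤ 1 * e := by gcongr; rw [div_le_one hm0]; exact hm1'
          _ = e := one_mul e)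
      (fun σ => by
        rw [← h3.per ((σ - φ) / m)]; congr 1; field_simp; ring)
    obtain ⟨q, hq⟩ := h3.inj' a3
    have hq' : τ₁ - τ₂ = 2 * π * (q * m) := by
      field_simp at hq; linarith
    have b1 := abs_le.mp a1
    have b2 := abs_le.mp a2
    have hp3 := pi_gt_three
    have c1 : ((q * m : ℤ) : ℝ) < 0 := by push_cast; nlinarith
    have c2 : (-2 : ℝ) < ((q * m : ℤ) : ℝ) := by push_cast; nlinarith
    have c1' : q * m < 0 := by exact_mod_cast c1
    have c2' : -2 < q * (m : ℤ) := by exact_mod_cast c2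
    have : q * (m : ℤ) = -1 := by omega
    have : (-q) * (m : ℤ) = 1 := by linarith
    rcases Int.mul_eq_one_iff_eq_one_or_neg_one.mp this with h | h <;> omega
  subst hk1
  filter_upwards [uw hε, uv hε] with i h1 h2
  refine ⟨φ, fun ξ => ?_⟩
  have a := h1 ξ
  have b := h2 ξ
  rw [(hsw ξ).1] at a
  rw [(hsw ξ).2] at b
  simp only [Int.cast_one, one_mul, one_smul] at a b
  rw [add_comm ξ φ]
  exact ⟨a, b⟩
end

section
open Real Set Filter MeasureTheory

theorem norm_kern (α : ℝ) (w : R2) : ‖kern α w‖ ≤ ‖w‖ ^ (-(1 + 2 * α)) := by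
  unfold kern
  rw [norm_smul, norm_perp, Real.norm_eq_abs, abs_of_nonneg (by positivity)]
  rcases eq_or_lt_of_le (norm_nonneg w) with h | h
  · rw [← h, mul_zero]; positivity
  · rw [← Real.rpow_neg h.le]
    nth_rewrite 2 [← Real.rpow_one ‖w‖]
    rw [← Real.rpow_add h]
    apply le_of_eq; congr 1; ring

theorem measurable_kern (α : ℝ) : Measurable (kern α) := by
  have : Measurable perp := continuous_perp.measurable
  unfold kern; fun_prop

theorem fr2 : Module.finrank ℝ R2 = 2 := by simp

theorem rpow_locint {s : ℝ} (hs : s < 2) : LocallyIntegrable (fun w : R2 => ‖w‖ ^ (-s)) := by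
  refine locallyIntegrable_of_norm_le_rpow (C := 1) (α := s) (by rw [fr2]; norm_num) (by rw [fr2]; exact_mod_cast hs) ?_ ?_
  · refine Eventually.of_forall fun x => ?_
    rw [one_mul, Real.norm_eq_abs, abs_of_nonneg (by positivity)]
  · exact (by fun_prop : Measurable (fun w : R2 => ‖w‖ ^ (-s))).aestronglyMeasurable

theorem rpow_int {s R : ℝ} (hs : s < 2) (x : R2) : IntegrableOn (fun y : R2 => ‖x - y‖ ^ (-s)) (Metric.closedBall 0 R) := by
  have h1 := ((rpow_locint hs).integrableOn_isCompact (isCompact_closedBall x R))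
  have hm := (MeasureTheory.Measure.measurePreserving_sub_left (volume : Measure R2) x)
  have h2 := (hm.integrableOn_comp_preimage (Homeomorph.subLeft x).measurableEmbedding (f := fun w : R2 => ‖w‖ ^ (-s)) (s := Metric.closedBall x R)).mpr h1
  refine h2.mono_set fun y hy => ?_
  simp at hy ⊢
  exact hy

theorem rpow_int' {s : ℝ} (hs : s < 2) (x : R2) {E : Set R2} (hE : Bornology.IsBounded E) :
    IntegrableOn (fun y : R2 => ‖x - y‖ ^ (-s)) E := by
  obtain ⟨R, hR⟩ := hE.subset_closedBall 0
  exact (rpow_int hs x).mono_set hR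

theorem rpow_int_bound {s : ℝ} (hs0 : 0 < s) (hs : s < 2) {E : Set R2} (hE : Bornology.IsBounded E) :
    ∃ K, ∀ x, ∫ y in E, ‖x - y‖ ^ (-s) ≤ K := by
  refine ⟨(∫ w in Metric.closedBall (0:R2) 1, ‖w‖ ^ (-s)) + volume.real E, fun x => ?_⟩
  have hi := rpow_int' hs x hE
  have hb1 : IntegrableOn (fun w : R2 => ‖w‖ ^ (-s)) (Metric.closedBall 0 1) :=
    (rpow_locint hs).integrableOn_isCompact (isCompact_closedBall 0 1)
  have hB : Integrable ((Metric.closedBall (0:R2) 1).indicator (fun w : R2 => ‖w‖ ^ (-s))) :=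
    (integrable_indicator_iff Metric.isClosed_closedBall.measurableSet).mpr hb1
  have hB' := hB.comp_sub_left x
  have hfin : volume E ≠ ⊤ := hE.measure_lt_top.ne
  have h1 : IntegrableOn (fun _ : R2 => (1:ℝ)) E := integrableOn_const hfin
  calc ∫ y in E, ‖x - y‖ ^ (-s)
      ≤ ∫ y in E, ((Metric.closedBall (0:R2) 1).indicator (fun w : R2 => ‖w‖ ^ (-s)) (x - y) + 1) := by
        refine integral_mono hi (hB'.integrableOn.add h1) fun y => ?_
        by_cases hy : x - y ∈ Metric.closedBall (0:R2) 1
        · simp only [indicator_of_mem hy]; linarith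
        · simp only [indicator_of_notMem hy, zero_add]
          simp only [Metric.mem_closedBall, dist_zero_right, not_le] at hy
          exact Real.rpow_le_one_of_one_le_of_nonpos hy.le (by linarith)
    _ = (∫ y in E, (Metric.closedBall (0:R2) 1).indicator (fun w : R2 => ‖w‖ ^ (-s)) (x - y)) + volume.real E := by
        rw [integral_add hB'.integrableOn h1]; simp
    _ ≤ _ := by
        gcongr
        calc _ ≤ ∫ y, (Metric.closedBall (0:R2) 1).indicator (fun w : R2 => ‖w‖ ^ (-s)) (x - y) :=
              setIntegral_le_integral hB' (Eventually.of_forall fun y => indicator_nonneg (fun _ _ => by positivity) _)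
          _ = _ := by
              rw [integral_sub_left_eq_self (fun w => (Metric.closedBall (0:R2) 1).indicator (fun w : R2 => ‖w‖ ^ (-s)) w) volume x,
                integral_indicator Metric.isClosed_closedBall.measurableSet]

/-- potential velocity of a set -/
def Vv (α : ℝ) (E : Set R2) (x : R2) : R2 := ∫ y in E, kern α (x - y)

theorem kern_int {α : ℝ} (hα : α ≤ 1 / 4) (x : R2) {E : Set R2} (hE : Bornology.IsBounded E) :
    IntegrableOn (fun y => kern α (x - y)) E := by
  refine Integrable.mono' (rpow_int' (s := 1 + 2 * α) (by linarith) x hE)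
    ((measurable_kern α).comp (by fun_prop)).aestronglyMeasurable (Eventually.of_forall fun y => norm_kern α _)

def keps (α e : ℝ) (w : R2) : R2 := ((max ‖w‖ e) ^ (2 + 2 * α))⁻¹ • perp w

theorem keps_cont {α e : ℝ} (he : 0 < e) : Continuous (keps α e) := by
  unfold keps
  refine Continuous.smul (Continuous.inv₀ (Continuous.rpow_const (by fun_prop) fun x => Or.inl ?_) fun x => ?_) (by fun_prop)
  · exact (lt_max_of_lt_right he).ne'
  · have : 0 < max ‖x‖ e := lt_max_of_lt_right he
    positivity

theorem keps_diff {α e : ℝ} (hα0 : 0 < α) (he : 0 < e) (w : R2) :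
    ‖kern α w - keps α e w‖ ≤ e ^ (1 / 4 : ℝ) * ‖w‖ ^ (-(5 / 4 + 2 * α)) := by
  rcases le_or_gt e ‖w‖ with h | h
  · have : keps α e w = kern α w := by unfold keps kern; rw [max_eq_left h]
    rw [this, sub_self, norm_zero]; positivity
  rcases eq_or_lt_of_le (norm_nonneg w) with h0 | h0
  · have : w = 0 := norm_eq_zero.mp h0.symm
    have hp : perp w = 0 := by rw [← norm_eq_zero, norm_perp, ← h0]
    unfold keps kern
    rw [hp, smul_zero, smul_zero, sub_self, norm_zero]; positivity
  unfold keps kern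
  rw [max_eq_right h.le, ← sub_smul, norm_smul, norm_perp, Real.norm_eq_abs]
  have h1 : (e ^ (2 + 2 * α))⁻¹ ≤ (‖w‖ ^ (2 + 2 * α))⁻¹ := by gcongr
  have h2 : 0 ≤ (e ^ (2 + 2 * α))⁻¹ := by positivity
  rw [abs_of_nonneg (by linarith)]
  calc _ ≤ (‖w‖ ^ (2 + 2 * α))⁻¹ * ‖w‖ := by gcongr; linarith
    _ = ‖w‖ ^ (1 / 4 : ℝ) * ‖w‖ ^ (-(5 / 4 + 2 * α)) := by
      rw [← Real.rpow_neg h0.le, ← Real.rpow_add h0]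
      nth_rewrite 2 [← Real.rpow_one ‖w‖]
      rw [← Real.rpow_add h0]
      congr 1; ring
    _ ≤ _ := by gcongr

theorem Vv_cont {α : ℝ} (hα0 : 0 < α) (hα : α ≤ 1 / 4) {E : Set R2} (hE : Bornology.IsBounded E) :
    Continuous (Vv α E) := by
  obtain ⟨K, hK⟩ := rpow_int_bound (s := 5 / 4 + 2 * α) (by linarith) (by linarith) hE
  have hfin : volume E ≠ ⊤ := hE.measure_lt_top.ne
  have hki : ∀ e > 0, ∀ x, IntegrableOn (fun y => keps α e (x - y)) E := by
    intro e he x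
    have := keps_cont (α := α) he
    have h2 : Continuous (fun y => keps α e (x - y)) := by fun_prop
    obtain ⟨R, hR⟩ := hE.subset_closedBall 0
    exact (h2.continuousOn.integrableOn_compact (isCompact_closedBall 0 R)).mono_set hR
  refine continuous_of_uniform_approx_of_continuous fun u hu => ?_
  obtain ⟨d, hd, hdu⟩ := Metric.mem_uniformity_dist.mp hu
  obtain ⟨e, he, hed⟩ : ∃ e : ℝ, 0 < e ∧ e ^ (1 / 4 : ℝ) * (|K| + 1) < d := by
    have hc : Continuous (fun e : ℝ => e ^ (1 / 4 : ℝ) * (|K| + 1)) :=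
      (continuous_id.rpow_const (fun _ => Or.inr (by norm_num))).mul continuous_const
    have h2 := hc.tendsto 0
    rw [Real.zero_rpow (by norm_num), zero_mul] at h2
    have h3 : ∀ᶠ e in nhdsWithin (0:ℝ) (Ioi 0), e ^ (1 / 4 : ℝ) * (|K| + 1) < d :=
      (h2.eventually (gt_mem_nhds hd)).filter_mono nhdsWithin_le_nhds
    obtain ⟨e, h4, h5⟩ := (h3.and self_mem_nhdsWithin).exists
    exact ⟨e, h5, h4⟩
  refine ⟨fun x => ∫ y in E, keps α e (x - y), ?_, fun x => hdu ?_⟩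
  · have hbd : ∀ w, ‖keps α e w‖ ≤ (e ^ (1 + 2 * α))⁻¹ := by
      intro w
      unfold keps
      have hm : 0 < max ‖w‖ e := lt_max_of_lt_right he
      rw [norm_smul, norm_perp, Real.norm_eq_abs, abs_of_nonneg (by positivity)]
      calc _ ≤ ((max ‖w‖ e) ^ (2 + 2 * α))⁻¹ * max ‖w‖ e := by gcongr; exact le_max_left _ _
        _ = ((max ‖w‖ e) ^ (1 + 2 * α))⁻¹ := by
          rw [← Real.rpow_neg hm.le, ← Real.rpow_neg hm.le]
          nth_rewrite 2 [← Real.rpow_one (max ‖w‖ e)]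
          rw [← Real.rpow_add hm]
          congr 1; ring
        _ ≤ _ := by gcongr; exact le_max_right _ _
    have hkc := keps_cont (α := α) he
    refine continuous_of_dominated (bound := fun _ => (e ^ (1 + 2 * α))⁻¹) (fun x => (hki e he x).aestronglyMeasurable)
      (fun x => Eventually.of_forall fun y => hbd _) (integrableOn_const hfin) (Eventually.of_forall fun y => by fun_prop)
  · rw [dist_eq_norm]
    unfold Vv
    rw [← integral_sub (kern_int hα x hE) (hki e he x)]
    refine lt_of_le_of_lt ?_ hed
    calc _ ≤ ∫ y in E, e ^ (1 / 4 : ℝ) * ‖x - y‖ ^ (-(5 / 4 + 2 * α)) := by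
          refine norm_integral_le_of_norm_le ((rpow_int' (by linarith) x hE).const_mul _) (Eventually.of_forall fun y => keps_diff hα0 he _)
      _ = e ^ (1 / 4 : ℝ) * ∫ y in E, ‖x - y‖ ^ (-(5 / 4 + 2 * α)) := by rw [integral_const_mul]
      _ ≤ _ := by gcongr; have := hK x; have := le_abs_self K; linarith

/-- reflection as isometry -/
def reflE : R2 ≃ₗᵢ[ℝ] R2 where
  toFun := reflect
  invFun := reflect
  left_inv := fun x => by apply R2_ext <;> simp
  right_inv := fun x => by apply R2_ext <;> simp
  map_add' := fun x y => by apply R2_ext <;> simp; ring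
  map_smul' := fun r x => by apply R2_ext <;> simp
  norm_map' := fun x => norm_reflect x

theorem reflE_apply (x : R2) : reflE x = reflect x := rfl

theorem reflect_reflect (x : R2) : reflect (reflect x) = x := by apply R2_ext <;> simp

theorem Vv_reflect (α : ℝ) (E : Set R2) (x : R2) :
    ∫ y in E, kern α (x - reflect y) = Vv α (reflect ⁻¹' E) x := by
  have := (reflE.measurePreserving).setIntegral_preimage_emb reflE.toHomeomorph.measurableEmbedding (fun y => kern α (x - reflect y)) E
  simp only [reflE_apply, reflect_reflect] at this
  rw [← this]; rfl

theorem refl_bdd {E : Set R2} (hE : Bornology.IsBounded E) : Bornology.IsBounded (reflect ⁻¹' E) := by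
  obtain ⟨R, hR⟩ := hE.subset_closedBall 0
  refine (Metric.isBounded_closedBall (x := (0:R2)) (r := R)).subset fun y hy => ?_
  have := hR hy
  simpa [norm_reflect] using this

theorem vel_eq {α cα : ℝ} (hα : α ≤ 1 / 4) {N : ℕ} (θ : Fin N → ℝ) {Ω : Fin N → Set R2} (hb : ∀ n, Bornology.IsBounded (Ω n)) (x : R2) :
    gSQGvel α cα θ Ω x = cα • ∑ n, θ n • (Vv α (Ω n) x - Vv α (reflect ⁻¹' (Ω n)) x) := by
  unfold gSQGvel
  congr 1
  refine Finset.sum_congr rfl fun n _ => ?_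
  congr 1
  rw [integral_sub (kern_int hα x (hb n)), Vv_reflect]
  · rfl
  · have := kern_int hα x (refl_bdd (hb n))
    have h2 := (reflE.measurePreserving.integrableOn_comp_preimage reflE.toHomeomorph.measurableEmbedding (f := fun y => kern α (x - y)) (s := reflect ⁻¹' (Ω n))).mpr this
    have e : (reflE : R2 → R2) ⁻¹' (reflect ⁻¹' (Ω n)) = Ω n := by
      ext y; simp [reflE_apply, reflect_reflect]
    rw [e] at h2
    exact h2

theorem vel_cont {α cα : ℝ} (hα0 : 0 < α) (hα : α ≤ 1 / 4) {N : ℕ} (θ : Fin N → ℝ) {Ω : Fin N → Set R2} (hb : ∀ n, Bornology.IsBounded (Ω n)) :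
    Continuous (gSQGvel α cα θ Ω) := by
  have : gSQGvel α cα θ Ω = fun x => cα • ∑ n, θ n • (Vv α (Ω n) x - Vv α (reflect ⁻¹' (Ω n)) x) := funext (vel_eq hα θ hb)
  rw [this]
  have h1 := fun n => Vv_cont hα0 hα (hb n)
  have h2 := fun n => Vv_cont hα0 hα (refl_bdd (hb n))
  fun_prop
end

section
open Real Set Filter MeasureTheory

theorem Crv.null {M γ c : ℝ} {z : ℝ → R2} (h : Crv M γ c z) : volume (range z) = 0 := by
  have e : range z = (fun v : R2 => z (v 0)) '' univ := by
    ext p; constructor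
    · rintro ⟨ξ, rfl⟩; exact ⟨mk2 ξ 0, trivial, by simp⟩
    · rintro ⟨v, -, rfl⟩; exact ⟨v 0, rfl⟩
  rw [e]
  refine addHaar_image_eq_zero_of_det_fderivWithin_eq_zero volume
    (f' := fun v => (ContinuousLinearMap.toSpanSingleton ℝ (deriv z (v 0))).comp (EuclideanSpace.proj (0 : Fin 2) : R2 →L[ℝ] ℝ)) ?_ ?_
  · intro v _
    have h1 := (h.der (v 0)).hasFDerivAt
    have h2 : HasFDerivAt (fun v : R2 => v 0) (EuclideanSpace.proj (0 : Fin 2) : R2 →L[ℝ] ℝ) v :=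
      (EuclideanSpace.proj (0 : Fin 2) : R2 →L[ℝ] ℝ).hasFDerivAt
    exact (HasFDerivAt.comp v h1 h2).hasFDerivWithinAt
  · intro v _
    rw [ContinuousLinearMap.det, LinearMap.det_eq_zero_iff_ker_ne_bot, Submodule.ne_bot_iff]
    refine ⟨mk2 0 1, ?_, ?_⟩
    · rw [LinearMap.mem_ker]; simp
    · intro h0
      have := congrArg (fun a : R2 => a 1) h0
      simp at this

theorem crs_kern (α : ℝ) (w v : R2) : crs (kern α w) v = -((‖w‖ ^ (2 + 2 * α))⁻¹ * dt w v) := by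
  unfold kern
  rw [crs_smul_left]; simp [crs, dt]; ring

theorem circ_pt {M γ c α : ℝ} (hα0 : 0 < α) {z : ℝ → R2} (h : Crv M γ c z) {y : R2} (hy : y ∉ range z) :
    ∫ ξ in (0:ℝ)..(2 * π), crs (kern α (z ξ - y)) (deriv z ξ) = 0 := by
  have hne : ∀ ξ, 0 < ‖z ξ - y‖ := fun ξ => by
    rw [norm_pos_iff, sub_ne_zero]; intro h0; exact hy ⟨ξ, h0⟩
  have hd : ∀ ξ, HasDerivAt (fun ξ => (dt (z ξ - y) (z ξ - y)) ^ (-α) / (2 * α)) (crs (kern α (z ξ - y)) (deriv z ξ)) ξ := by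
    intro ξ
    have a0 := (hasDerivAt_coord (h.der ξ) 0).sub_const (y 0)
    have a1 := (hasDerivAt_coord (h.der ξ) 1).sub_const (y 1)
    have h1 : HasDerivAt (fun ξ => dt (z ξ - y) (z ξ - y)) (2 * dt (z ξ - y) (deriv z ξ)) ξ := by
      refine ((a0.mul a0).add (a1.mul a1)).congr_deriv ?_
      simp [dt]; ring
    have hp : 0 < dt (z ξ - y) (z ξ - y) := by rw [dt_self]; have := hne ξ; positivity
    have h2 := (h1.rpow_const (p := -α) (Or.inl hp.ne')).div_const (2 * α)
    refine h2.congr_deriv ?_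
    rw [crs_kern, dt_self]
    have : (‖z ξ - y‖ ^ (2 + 2 * α))⁻¹ = (‖z ξ - y‖ ^ 2) ^ (-α - 1) := by
      rw [← Real.rpow_neg (hne ξ).le, ← Real.rpow_natCast, ← Real.rpow_mul (hne ξ).le]
      congr 1; push_cast; ring
    rw [this]; field_simp
  rw [intervalIntegral.integral_eq_sub_of_hasDerivAt (fun ξ _ => hd ξ)]
  · have := h.per 0
    rw [zero_add] at this
    rw [this, sub_self]
  · apply Continuous.intervalIntegrable
    have h1 := h.cont
    have h2 := h.dcont
    simp only [crs_kern]
    refine (Continuous.mul (Continuous.inv₀ (Continuous.rpow_const (by fun_prop) fun x => Or.inl (hne x).ne') fun x => ?_) (by fun_prop)).neg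
    have := hne x; positivity

theorem circ_V {M γ c α : ℝ} (hα0 : 0 < α) (hα : α ≤ 1 / 4) {z : ℝ → R2} (h : Crv M γ c z) {E : Set R2}
    (hE : Bornology.IsBounded E) :
    ∫ ξ in (0:ℝ)..(2 * π), crs (Vv α E (z ξ)) (deriv z ξ) = 0 := by
  have hz := h.cont
  have hz' := h.dcont
  have hcrs : ∀ ξ, crs (Vv α E (z ξ)) (deriv z ξ) = ∫ y in E, crs (kern α (z ξ - y)) (deriv z ξ) := by
    intro ξ
    set L : R2 →L[ℝ] ℝ := (deriv z ξ 1) • (EuclideanSpace.proj (0 : Fin 2) : R2 →L[ℝ] ℝ) - (deriv z ξ 0) • (EuclideanSpace.proj (1 : Fin 2) : R2 →L[ℝ] ℝ) with hL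
    have : ∀ a, crs a (deriv z ξ) = L a := fun a => by simp [hL, crs]; ring
    simp only [this]
    unfold Vv
    rw [L.integral_comp_comm (kern_int hα _ hE)]
  simp only [hcrs]
  rw [intervalIntegral.integral_of_le two_pi_pos.le]
  have hmeas : Measurable (fun p : ℝ × R2 => crs (kern α (z p.1 - p.2)) (deriv z p.1)) := by
    have h1 : Measurable (fun p : ℝ × R2 => kern α (z p.1 - p.2)) :=
      (measurable_kern α).comp (by fun_prop : Continuous fun p : ℝ × R2 => z p.1 - p.2).measurable
    have h2 : Measurable (fun p : ℝ × R2 => deriv z p.1) := (by fun_prop : Continuous fun p : ℝ × R2 => deriv z p.1).measurable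
    have : Measurable (fun p : R2 × R2 => crs p.1 p.2) := (by fun_prop : Continuous fun p : R2 × R2 => crs p.1 p.2).measurable
    exact this.comp (h1.prodMk h2)
  obtain ⟨K, hK⟩ := rpow_int_bound (s := 1 + 2 * α) (by linarith) (by linarith) hE
  have hb : ∀ ξ y, ‖crs (kern α (z ξ - y)) (deriv z ξ)‖ ≤ c * ‖z ξ - y‖ ^ (-(1 + 2 * α)) := by
    intro ξ y
    refine (abs_crs_le _ _).trans ?_
    rw [h.spd, mul_comm]
    have := h.cpos
    gcongr
    exact norm_kern α _
  have hint : ∀ ξ, IntegrableOn (fun y => crs (kern α (z ξ - y)) (deriv z ξ)) E := fun ξ =>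
    Integrable.mono' ((rpow_int' (by linarith) (z ξ) hE).const_mul c) (hmeas.comp (by fun_prop : Measurable fun y : R2 => (ξ, y))).aestronglyMeasurable
      (Eventually.of_forall fun y => hb ξ y)
  have : IsFiniteMeasure (volume.restrict E) := ⟨by simpa using hE.measure_lt_top⟩
  have hF : Integrable (Function.uncurry fun ξ y => crs (kern α (z ξ - y)) (deriv z ξ))
      ((volume.restrict (Ioc 0 (2 * π))).prod (volume.restrict E)) := by
    refine (integrable_prod_iff hmeas.aestronglyMeasurable).mpr ?_
    refine ⟨Eventually.of_forall fun ξ => hint ξ, ?_⟩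
    refine Integrable.mono' (integrable_const (c * K)) hmeas.norm.aestronglyMeasurable.integral_prod_right' (Eventually.of_forall fun ξ => ?_)
    rw [Real.norm_eq_abs, abs_of_nonneg (integral_nonneg fun y => norm_nonneg _)]
    have hc := h.cpos
    calc _ ≤ ∫ y in E, c * ‖z ξ - y‖ ^ (-(1 + 2 * α)) :=
          integral_mono (hint ξ).norm ((rpow_int' (by linarith) (z ξ) hE).const_mul c) (hb ξ)
      _ = c * ∫ y in E, ‖z ξ - y‖ ^ (-(1 + 2 * α)) := integral_const_mul _ _
      _ ≤ _ := by gcongr; exact hK _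
  rw [integral_integral_swap hF]
  have : ∀ᵐ y ∂(volume.restrict E), ∫ ξ in Ioc 0 (2 * π), crs (kern α (z ξ - y)) (deriv z ξ) = 0 := by
    have h1 : ∀ᵐ y ∂(volume : Measure R2), y ∉ range z := measure_eq_zero_iff_ae_notMem.mp h.null
    filter_upwards [ae_restrict_of_ae h1] with y hy
    rw [← intervalIntegral.integral_of_le two_pi_pos.le]
    exact circ_pt hα0 h hy
  rw [integral_congr_ae this]; simp

theorem circ_u {M γ c α cα : ℝ} (hα0 : 0 < α) (hα : α ≤ 1 / 4) {z : ℝ → R2} (h : Crv M γ c z) {N : ℕ} (θ : Fin N → ℝ)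
    {Ω : Fin N → Set R2} (hb : ∀ n, Bornology.IsBounded (Ω n)) :
    ∫ ξ in (0:ℝ)..(2 * π), crs (gSQGvel α cα θ Ω (z ξ)) (deriv z ξ) = 0 := by
  have hz := h.cont
  have hz' := h.dcont
  have h1 := fun n => Vv_cont hα0 hα (hb n)
  have h2 := fun n => Vv_cont hα0 hα (refl_bdd (hb n))
  have : ∀ ξ, crs (gSQGvel α cα θ Ω (z ξ)) (deriv z ξ) = ∑ n, cα * (θ n * (crs (Vv α (Ω n) (z ξ)) (deriv z ξ) - crs (Vv α (reflect ⁻¹' (Ω n)) (z ξ)) (deriv z ξ))) := by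
    intro ξ
    rw [vel_eq hα θ hb, crs_smul_left, ← Finset.mul_sum]
    congr 1
    have hs : ∀ (s : Finset (Fin N)) (f : Fin N → R2) (v : R2), crs (∑ n ∈ s, f n) v = ∑ n ∈ s, crs (f n) v := by
      intro s f v
      induction s using Finset.cons_induction with
      | empty => simp [crs]
      | cons a s ha ih => rw [Finset.sum_cons, Finset.sum_cons, crs_add_left, ih]
    rw [hs]
    exact Finset.sum_congr rfl fun n _ => by rw [crs_smul_left, crs_sub_left]
  simp only [this]
  rw [intervalIntegral.integral_finsetSum fun n _ => Continuous.intervalIntegrable (by have := h1 n; have := h2 n; fun_prop) _ _]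
  refine Finset.sum_eq_zero fun n _ => ?_
  have := h1 n; have := h2 n
  rw [intervalIntegral.integral_const_mul, intervalIntegral.integral_const_mul,
    intervalIntegral.integral_sub (Continuous.intervalIntegrable (by fun_prop) _ _) (Continuous.intervalIntegrable (by fun_prop) _ _),
    circ_V hα0 hα h (hb n), circ_V hα0 hα h (refl_bdd (hb n))]
  simp
end

section
open Real Set Filter MeasureTheory

theorem chord_area {M γ c : ℝ} {z : ℝ → R2} (h : Crv M γ c z) (a b : ℝ) :
    |(∫ x in a..b, crs (z x) (deriv z x)) - crs (z a) (z b)| ≤ 2 * M ^ 2 * |b - a| ^ γ * |b - a| ^ 2 := by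
  have hz := h.cont
  have hz' := h.dcont
  have hM := h.M1
  have hγ := h.g0
  have h1 : ∫ x in a..b, crs (z a) (deriv z x) = crs (z a) (z b) := by
    rw [intervalIntegral.integral_eq_sub_of_hasDerivAt (f := fun x => crs (z a) (z x)) (fun x _ => ?_)
      (Continuous.intervalIntegrable (by fun_prop) _ _), crs_self, sub_zero]
    have := (hasDerivAt_crs (h.der x) (z a)).neg
    refine (this.congr_deriv (crs_comm _ _).symm).congr_of_eventuallyEq (Eventually.of_forall fun y => crs_comm _ _)
  rw [← h1, ← intervalIntegral.integral_sub (Continuous.intervalIntegrable (by fun_prop) _ _)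
    (Continuous.intervalIntegrable (by fun_prop) _ _)]
  have := intervalIntegral.norm_integral_le_of_norm_le_const (a := a) (b := b) (C := 2 * M ^ 2 * |b - a| ^ γ * |b - a|)
    (f := fun x => crs (z x) (deriv z x) - crs (z a) (deriv z x)) ?_
  · rw [Real.norm_eq_abs] at this
    refine this.trans (le_of_eq (by ring))
  intro x hx
  have hx' : |x - a| ≤ |b - a| := abs_sub_left_of_mem_uIcc (uIoc_subset_uIcc hx)
  set R := z x - z a - (x - a) • deriv z a with hR
  have e : crs (z x) (deriv z x) - crs (z a) (deriv z x) = crs R (deriv z x) + (x - a) * crs (deriv z a) (deriv z x - deriv z a) := by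
    rw [hR, crs_sub_left, crs_sub_left, crs_smul_left, crs_sub_right, crs_self]; ring
  rw [e]
  have b1 : ‖R‖ ≤ M * |b - a| ^ γ * |b - a| := (h.taylor x a).trans (by gcongr)
  have b2 : ‖deriv z x - deriv z a‖ ≤ M * |b - a| ^ γ := (h.hol x a).trans (by gcongr)
  have b3 : ‖deriv z x‖ ≤ M := (h.spd x).le.trans h.cM
  have b4 : ‖deriv z a‖ ≤ M := (h.spd a).le.trans h.cM
  refine (norm_add_le _ _).trans ?_
  rw [norm_mul, Real.norm_eq_abs, Real.norm_eq_abs, Real.norm_eq_abs]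
  calc _ ≤ (M * |b - a| ^ γ * |b - a|) * M + |b - a| * (M * (M * |b - a| ^ γ)) := by
        refine add_le_add ((abs_crs_le _ _).trans (by gcongr)) (mul_le_mul hx' ((abs_crs_le _ _).trans (by gcongr)) (abs_nonneg _) (abs_nonneg _))
    _ = _ := by ring

theorem per_uc {U : ℝ → R2} (hU : Continuous U) (hp : ∀ ξ, U (ξ + 2 * π) = U ξ) {e : ℝ} (he : 0 < e) :
    ∃ d > 0, ∀ a b, |a - b| ≤ d → ‖U a - U b‖ ≤ e := by
  have h1 := (isCompact_Icc (a := (-1 : ℝ)) (b := 2 * π + 1)).uniformContinuousOn_of_continuous hU.continuousOn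
  rw [Metric.uniformContinuousOn_iff] at h1
  obtain ⟨d, hd, h2⟩ := h1 e he
  refine ⟨min (d / 2) 1, by positivity, fun a b hab => ?_⟩
  obtain ⟨k, hk⟩ := Crv.reduce a
  rw [← per_int hp a k, ← per_int hp b k]
  have h3 := hab.trans (min_le_left _ _)
  have h4 := abs_le.mp (hab.trans (min_le_right _ _))
  rw [← dist_eq_norm]
  refine (h2 _ ⟨by linarith [hk.1], by linarith [hk.2]⟩ _ ⟨by linarith [hk.1], by linarith [hk.2]⟩ ?_).le
  rw [Real.dist_eq, add_sub_add_right_eq_sub]; linarith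

theorem per_bd {U : ℝ → R2} (hU : Continuous U) (hp : ∀ ξ, U (ξ + 2 * π) = U ξ) :
    ∃ K ≥ 1, ∀ a, ‖U a‖ ≤ K := by
  obtain ⟨K, hK⟩ := (isCompact_Icc (a := (0 : ℝ)) (b := 2 * π)).exists_bound_of_continuousOn hU.continuousOn
  refine ⟨max K 1, le_max_right _ _, fun a => ?_⟩
  obtain ⟨k, hk⟩ := Crv.reduce a
  rw [← per_int hp a k]
  exact (hK _ hk).trans (le_max_left _ _)

set_option maxHeartbeats 1000000 in
theorem area_cell {M γ c c' κ K C h e1 bb ξ ξ' φ φ' : ℝ} {z y U : ℝ → R2} (hz : Crv M γ c z) (hy : Crv M γ c' y)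
    (hU : Continuous U) (hK : 1 ≤ K) (hUK : ∀ a, ‖U a‖ ≤ K) (hκ : 0 < κ)
    (hac : ∀ ξ η, κ * distT ξ η ≤ ‖z ξ - z η‖) (hC : C = (M + 2 * K + 2) / κ + 1) (he0 : 0 ≤ e1) (he1 : e1 ≤ 1)
    (hUe : ∀ a b, |a - b| ≤ C * |h| → ‖U a - U b‖ ≤ e1)
    (hbb : (C * |h|) ^ γ ≤ bb)
    (h1 : ‖y ξ - (z φ + h • U φ)‖ ≤ e1 * |h|) (h2 : ‖y ξ' - (z φ' + h • U φ')‖ ≤ e1 * |h|)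
    (hξ : |ξ' - ξ| ≤ |h|) (hφ : |φ' - φ| ≤ π) :
    |(∫ x in ξ..ξ', crs (y x) (deriv y x)) - (∫ x in φ..φ', crs (z x) (deriv z x))
      - 2 * h * (∫ x in φ..φ', crs (U x) (deriv z x)) + crs (y ξ' - z φ') (z φ') - crs (y ξ - z φ) (z φ)|
      ≤ (4 * M ^ 2 * C ^ 2 * bb + e1 * (5 * M * C + 3 * (K + 1))) * |h| ^ 2 := by
  have hM := hz.M1
  have hγ := hz.g0
  have hzc := hz.cont
  have hz' := hz.dcont
  set H := |h| with hH
  have hH0 : 0 ≤ H := abs_nonneg h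
  set w := y ξ - z φ with hw
  set w' := y ξ' - z φ' with hw'
  set e := y ξ - (z φ + h • U φ) with he
  set e' := y ξ' - (z φ' + h • U φ') with he'
  set Δ := z φ' - z φ with hΔ
  have ew : w = h • U φ + e := by rw [hw, he]; abel
  have ew' : w' = h • U φ' + e' := by rw [hw', he']; abel
  have nw : ‖w‖ ≤ (K + 1) * H := by
    rw [ew]
    refine (norm_add_le _ _).trans ?_
    rw [norm_smul, Real.norm_eq_abs]
    have : |h| * ‖U φ‖ ≤ H * K := by rw [hH]; gcongr; exact hUK φ
    nlinarith
  have nw' : ‖w'‖ ≤ (K + 1) * H := by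
    rw [ew']
    refine (norm_add_le _ _).trans ?_
    rw [norm_smul, Real.norm_eq_abs]
    have : |h| * ‖U φ'‖ ≤ H * K := by rw [hH]; gcongr; exact hUK φ'
    nlinarith
  have nΔ : ‖Δ‖ ≤ (M + 2 * K + 2) * H := by
    have : Δ = (y ξ' - y ξ) - w' + w := by rw [hΔ, hw, hw']; abel
    rw [this]
    have a1 := norm_add_le (y ξ' - y ξ - w') w
    have a2 := norm_sub_le (y ξ' - y ξ) w'
    have a3 : ‖y ξ' - y ξ‖ ≤ M * H := (hy.lip ξ' ξ).trans (mul_le_mul hy.cM hξ (abs_nonneg _) (by linarith))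
    nlinarith
  have hC0 : 1 ≤ C := by rw [hC]; have : 0 ≤ (M + 2 * K + 2) / κ := by positivity
                         linarith
  have nφ : |φ' - φ| ≤ C * H := by
    have := hac φ' φ
    rw [distT_of_le hφ] at this
    have h3 : |φ' - φ| ≤ (M + 2 * K + 2) / κ * H := by
      rw [div_mul_eq_mul_div, le_div_iff₀ hκ]; linarith
    rw [hC]; nlinarith
  have hbb0 : 0 ≤ bb := le_trans (by positivity) hbb
  have nΔ' : ‖Δ‖ ≤ M * (C * H) := (hz.lip φ' φ).trans (mul_le_mul hz.cM nφ (abs_nonneg _) (by linarith))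
  have p1 : |(∫ x in ξ..ξ', crs (y x) (deriv y x)) - crs (y ξ) (y ξ')| ≤ 2 * M ^ 2 * bb * (C * H) ^ 2 := by
    have hh : |ξ' - ξ| ≤ C * H := by nlinarith
    have hq : |ξ' - ξ| ^ γ ≤ bb := le_trans (Real.rpow_le_rpow (abs_nonneg _) hh hγ.le) hbb
    refine (chord_area hy ξ ξ').trans ?_
    gcongr
  have p2 : |(∫ x in φ..φ', crs (z x) (deriv z x)) - crs (z φ) (z φ')| ≤ 2 * M ^ 2 * bb * (C * H) ^ 2 := by
    have hq : |φ' - φ| ^ γ ≤ bb := le_trans (Real.rpow_le_rpow (abs_nonneg _) nφ hγ.le) hbb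
    refine (chord_area hz φ φ').trans ?_
    gcongr
  have dU : ‖U φ' - U φ‖ ≤ e1 := hUe _ _ nφ
  have p3 : |crs (h • (U φ' - U φ) + e + e') Δ| ≤ 3 * e1 * H * (M * (C * H)) := by
    refine (abs_crs_le _ _).trans ?_
    refine mul_le_mul ?_ nΔ' (norm_nonneg _) (by positivity)
    have a1 := norm_add_le (h • (U φ' - U φ) + e) e'
    have a2 := norm_add_le (h • (U φ' - U φ)) e
    rw [norm_smul, Real.norm_eq_abs] at a2
    have : |h| * ‖U φ' - U φ‖ ≤ H * e1 := by rw [hH]; gcongr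
    linarith
  have p4 : |crs w (h • (U φ' - U φ) + e' - e)| ≤ ((K + 1) * H) * (3 * e1 * H) := by
    refine (abs_crs_le _ _).trans ?_
    refine mul_le_mul nw ?_ (norm_nonneg _) (by positivity)
    have a1 := norm_sub_le (h • (U φ' - U φ) + e') e
    have a2 := norm_add_le (h • (U φ' - U φ)) e'
    rw [norm_smul, Real.norm_eq_abs] at a2
    have : |h| * ‖U φ' - U φ‖ ≤ H * e1 := by rw [hH]; gcongr
    linarith
  have p5 : |crs (U φ) Δ - ∫ x in φ..φ', crs (U x) (deriv z x)| ≤ e1 * M * (C * H) := by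
    have i1 : ∫ x in φ..φ', crs (U φ) (deriv z x) = crs (U φ) Δ := by
      rw [intervalIntegral.integral_eq_sub_of_hasDerivAt (f := fun x => crs (U φ) (z x)) (fun x _ => ?_)
        (Continuous.intervalIntegrable (by fun_prop) _ _), hΔ, crs_sub_right]
      have := (hasDerivAt_crs (hz.der x) (U φ)).neg
      refine (this.congr_deriv (crs_comm _ _).symm).congr_of_eventuallyEq (Eventually.of_forall fun y => crs_comm _ _)
    rw [← i1, ← intervalIntegral.integral_sub (Continuous.intervalIntegrable (by fun_prop) _ _)
      (Continuous.intervalIntegrable (by fun_prop) _ _)]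
    have := intervalIntegral.norm_integral_le_of_norm_le_const (a := φ) (b := φ') (C := e1 * M)
      (f := fun x => crs (U φ) (deriv z x) - crs (U x) (deriv z x)) ?_
    · rw [Real.norm_eq_abs] at this
      refine this.trans (by gcongr)
    intro x hx
    rw [← crs_sub_left]
    refine (abs_crs_le _ _).trans (mul_le_mul (hUe _ _ ?_) ((hz.spd x).le.trans hz.cM) (norm_nonneg _) he0)
    rw [abs_sub_comm]
    exact (abs_sub_left_of_mem_uIcc (uIoc_subset_uIcc hx)).trans nφ
  have key : (∫ x in ξ..ξ', crs (y x) (deriv y x)) - (∫ x in φ..φ', crs (z x) (deriv z x))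
      - 2 * h * (∫ x in φ..φ', crs (U x) (deriv z x)) + crs w' (z φ') - crs w (z φ)
      = ((∫ x in ξ..ξ', crs (y x) (deriv y x)) - crs (y ξ) (y ξ'))
        - ((∫ x in φ..φ', crs (z x) (deriv z x)) - crs (z φ) (z φ'))
        + crs (h • (U φ' - U φ) + e + e') Δ + crs w (h • (U φ' - U φ) + e' - e)
        + 2 * h * (crs (U φ) Δ - ∫ x in φ..φ', crs (U x) (deriv z x)) := by
    have ey : y ξ = z φ + w := by rw [hw]; abel
    have ey' : y ξ' = z φ' + w' := by rw [hw']; abel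
    rw [ey, ey', ew, ew', hΔ]
    simp only [crs_add_left, crs_add_right, crs_sub_left, crs_sub_right, crs_smul_left, crs_smul_right, crs_self]
    rw [crs_comm e (U φ), crs_comm (z φ) (U φ'), crs_comm (z φ) e']
    ring
  rw [key]
  set X1 := (∫ x in ξ..ξ', crs (y x) (deriv y x)) - crs (y ξ) (y ξ')
  set X2 := (∫ x in φ..φ', crs (z x) (deriv z x)) - crs (z φ) (z φ')
  set X3 := crs (h • (U φ' - U φ) + e + e') Δ
  set X4 := crs w (h • (U φ' - U φ) + e' - e)
  set X5 := crs (U φ) Δ - ∫ x in φ..φ', crs (U x) (deriv z x)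
  have p6 : |2 * h * X5| ≤ 2 * H * (e1 * M * (C * H)) := by
    rw [abs_mul, abs_mul, abs_two, ← hH]; gcongr
  have er : (4 * M ^ 2 * C ^ 2 * bb + e1 * (5 * M * C + 3 * (K + 1))) * H ^ 2 = 2 * M ^ 2 * bb * (C * H) ^ 2
      + 2 * M ^ 2 * bb * (C * H) ^ 2 + 3 * e1 * H * (M * (C * H)) + ((K + 1) * H) * (3 * e1 * H)
      + 2 * H * (e1 * M * (C * H)) := by ring
  rw [er]
  rw [abs_le] at p1 p2 p3 p4 p6 ⊢
  constructor <;> linarith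

theorem area_step {M γ c : ℝ} {z U : ℝ → R2} (hz : Crv M γ c z) (hU : Continuous U) (hp : ∀ ξ, U (ξ + 2 * π) = U ξ)
    (h0 : ∫ ξ in (0:ℝ)..(2 * π), crs (U ξ) (deriv z ξ) = 0) {ε : ℝ} (hε : 0 < ε) :
    ∃ h₀ > 0, ∃ e₀ > 0, ∀ h c', 0 < |h| → |h| ≤ h₀ → ∀ y : ℝ → R2, Crv M γ c' y →
      (∃ s, ∀ ξ, ‖y ξ - z (ξ + s)‖ ≤ e₀) → (∀ ξ, ∃ φ, ‖y ξ - (z φ + h • U φ)‖ ≤ e₀ * |h|) →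
      |(∫ ξ in (0:ℝ)..(2 * π), crs (y ξ) (deriv y ξ)) - ∫ ξ in (0:ℝ)..(2 * π), crs (z ξ) (deriv z ξ)| ≤ ε * |h| := by
  obtain ⟨κ, hκ, hac⟩ := hz.arcchord
  obtain ⟨K, hK, hUK⟩ := per_bd hU hp
  have hM := hz.M1
  have hγ := hz.g0
  set C := (M + 2 * K + 2) / κ + 1 with hC
  have hC1 : 1 ≤ C := by rw [hC]; have : 0 ≤ (M + 2 * K + 2) / κ := by positivity
                         linarith
  set B := 4 * M ^ 2 * C ^ 2 + (5 * M * C + 3 * (K + 1)) with hB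
  have hB0 : 0 < B := by positivity
  set e1 := min 1 (min (ε / (8 * B)) (κ / 4)) with he1
  have he10 : 0 < e1 := by positivity
  obtain ⟨d, hd, hUd⟩ := per_uc hU hp he10
  obtain ⟨r, hr0, hr1, hr⟩ := Crv.exists_r hγ le_rfl he10
  refine ⟨min (min 1 (d / C)) (min (r / C) (κ / (4 * (K + 1)))), by positivity, e1, he10, ?_⟩
  intro h c' hh0 hhle y hy ⟨s, hs⟩ hφ
  have q1 : |h| ≤ 1 := hhle.trans ((min_le_left _ _).trans (min_le_left _ _))
  have q2 : C * |h| ≤ d := by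
    have := hhle.trans ((min_le_left _ _).trans (min_le_right _ _))
    rw [le_div_iff₀ (by linarith)] at this; linarith
  have q3 : C * |h| ≤ r := by
    have := hhle.trans ((min_le_right _ _).trans (min_le_left _ _))
    rw [le_div_iff₀ (by linarith)] at this; linarith
  have q4 : (K + 1) * |h| ≤ κ / 4 := by
    have := hhle.trans ((min_le_right _ _).trans (min_le_right _ _))
    rw [le_div_iff₀ (by positivity)] at this; linarith
  have e11 : e1 ≤ 1 := min_le_left _ _
  have e12 : e1 ≤ ε / (8 * B) := (min_le_right _ _).trans (min_le_left _ _)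
  have e13 : e1 ≤ κ / 4 := (min_le_right _ _).trans (min_le_right _ _)
  have hbb : (C * |h|) ^ γ ≤ e1 := by
    refine le_trans ?_ hr
    rw [one_mul]; gcongr
  -- choose parameters
  have hφ' : ∀ ξ, ∃ φ, ‖y ξ - (z φ + h • U φ)‖ ≤ e1 * |h| ∧ |φ - (ξ + s)| ≤ 1 := by
    intro ξ
    obtain ⟨φ, hφ⟩ := hφ ξ
    have h1 : ‖z φ - z (ξ + s)‖ ≤ κ := by
      have e : z φ - z (ξ + s) = (y ξ - z (ξ + s)) - (y ξ - (z φ + h • U φ)) - h • U φ := by abel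
      rw [e]
      have a1 := norm_sub_le ((y ξ - z (ξ + s)) - (y ξ - (z φ + h • U φ))) (h • U φ)
      have a2 := norm_sub_le (y ξ - z (ξ + s)) (y ξ - (z φ + h • U φ))
      have a3 := hs ξ
      have a4 : ‖h • U φ‖ ≤ |h| * K := by rw [norm_smul, Real.norm_eq_abs]; gcongr; exact hUK φ
      nlinarith
    have h2 := (hac φ (ξ + s)).trans h1
    obtain ⟨k, hk⟩ := distT_exists φ (ξ + s)
    refine ⟨φ + 2 * π * k, ?_, ?_⟩
    · rw [hz.zk, per_int hp]; exact hφ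
    · rw [hk] at h2
      have : |φ + 2 * π * k - (ξ + s)| = |φ - (ξ + s) + 2 * π * k| := by congr 1; ring
      rw [this]
      nlinarith
  choose φ hφ1 hφ2 using hφ'
  set m := ⌈2 * π / |h|⌉₊ with hm
  have hπ := two_pi_pos
  have hm0 : 0 < m := Nat.ceil_pos.mpr (by positivity)
  have hm0' : (0:ℝ) < m := by exact_mod_cast hm0
  have hmge : 2 * π / |h| ≤ m := Nat.le_ceil _
  have hmle : (m : ℝ) * |h| ≤ 8 := by
    have h1 := Nat.ceil_lt_add_one (by positivity : 0 ≤ 2 * π / |h|)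
    rw [← hm] at h1
    have h2 : 2 * π / |h| * |h| = 2 * π := by field_simp
    have := pi_lt_d2
    nlinarith
  set X : ℕ → ℝ := fun i => 2 * π * i / m with hX
  set Φ : ℕ → ℝ := fun i => if i = m then φ 0 + 2 * π else φ (X i) with hΦ
  have X0 : X 0 = 0 := by simp [hX]
  have Xm : X m = 2 * π := by simp only [hX]; field_simp
  have Φ0 : Φ 0 = φ 0 := by simp only [hΦ, if_neg hm0.ne, X0]
  have Φm : Φ m = φ 0 + 2 * π := by simp [hΦ]
  have c1 : ∀ i, ‖y (X i) - (z (Φ i) + h • U (Φ i))‖ ≤ e1 * |h| := by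
    intro i
    by_cases hi : i = m
    · rw [hi, Xm, Φm, hz.per, hp]
      have := hy.per 0
      rw [zero_add] at this
      rw [this]; exact hφ1 0
    · simp only [hΦ, if_neg hi]; exact hφ1 _
  have c2 : ∀ i, |Φ i - (X i + s)| ≤ 1 := by
    intro i
    by_cases hi : i = m
    · rw [hi, Xm, Φm]
      have := hφ2 0
      rw [show φ 0 + 2 * π - (2 * π + s) = φ 0 - (0 + s) by ring]
      exact this
    · simp only [hΦ, if_neg hi]; exact hφ2 _
  have c3 : ∀ i, |X (i + 1) - X i| ≤ |h| := by
    intro i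
    have : X (i + 1) - X i = 2 * π / m := by simp only [hX]; push_cast; field_simp; ring
    rw [this, abs_of_pos (by positivity), div_le_iff₀ hm0']
    rw [div_le_iff₀ hh0] at hmge; linarith
  have c4 : ∀ i, |Φ (i + 1) - Φ i| ≤ π := by
    intro i
    have a1 := abs_le.mp (c2 i)
    have a2 := abs_le.mp (c2 (i + 1))
    have a3 := abs_le.mp ((c3 i).trans q1)
    have := pi_gt_three
    rw [abs_le]; constructor <;> linarith
  set Y := fun a b => ∫ x in a..b, crs (y x) (deriv y x) with hY
  set Z := fun a b => ∫ x in a..b, crs (z x) (deriv z x) with hZ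
  set V := fun a b => ∫ x in a..b, crs (U x) (deriv z x) with hV
  have hyc := hy.cont
  have hyd := hy.dcont
  have hzc := hz.cont
  have hzd := hz.dcont
  have addY : ∀ a b d, Y a b + Y b d = Y a d := fun a b d => intervalIntegral.integral_add_adjacent_intervals
    (Continuous.intervalIntegrable (by fun_prop) _ _) (Continuous.intervalIntegrable (by fun_prop) _ _)
  have addZ : ∀ a b d, Z a b + Z b d = Z a d := fun a b d => intervalIntegral.integral_add_adjacent_intervals
    (Continuous.intervalIntegrable (by fun_prop) _ _) (Continuous.intervalIntegrable (by fun_prop) _ _)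
  have addV : ∀ a b d, V a b + V b d = V a d := fun a b d => intervalIntegral.integral_add_adjacent_intervals
    (Continuous.intervalIntegrable (by fun_prop) _ _) (Continuous.intervalIntegrable (by fun_prop) _ _)
  set G : ℕ → ℝ := fun i => Y 0 (X i) - Z (φ 0) (Φ i) - 2 * h * V (φ 0) (Φ i) + crs (y (X i) - z (Φ i)) (z (Φ i)) with hG
  have step : ∀ i, dist (G i) (G (i + 1)) ≤ B * e1 * |h| ^ 2 := by
    intro i
    have := area_cell hz hy hU hK hUK hκ hac hC he10.le e11 (fun a b hab => hUd a b (hab.trans q2)) hbb (c1 i) (c1 (i + 1)) (c3 i) (c4 i)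
    rw [dist_comm, Real.dist_eq]
    have e : G (i + 1) - G i = Y (X i) (X (i + 1)) - Z (Φ i) (Φ (i + 1)) - 2 * h * V (Φ i) (Φ (i + 1))
        + crs (y (X (i + 1)) - z (Φ (i + 1))) (z (Φ (i + 1))) - crs (y (X i) - z (Φ i)) (z (Φ i)) := by
      simp only [hG]
      rw [← addY 0 (X i) (X (i + 1)), ← addZ (φ 0) (Φ i) (Φ (i + 1)), ← addV (φ 0) (Φ i) (Φ (i + 1))]; ring
    rw [e]
    refine this.trans (le_of_eq ?_)
    rw [hB]; ring
  have tot := dist_le_range_sum_of_dist_le m (fun {i} _ => step i)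
  rw [Finset.sum_const, Finset.card_range, nsmul_eq_mul, dist_comm, Real.dist_eq] at tot
  have perZ : Z (φ 0) (φ 0 + 2 * π) = Z 0 (2 * π) := by
    have hpp : Function.Periodic (fun ξ => crs (z ξ) (deriv z ξ)) (2 * π) := fun ξ => by simp only [hz.per, hz.dper]
    have := hpp.intervalIntegral_add_eq (φ 0) 0
    rw [zero_add] at this; exact this
  have perV : V (φ 0) (φ 0 + 2 * π) = 0 := by
    have hpp : Function.Periodic (fun ξ => crs (U ξ) (deriv z ξ)) (2 * π) := fun ξ => by simp only [hp, hz.dper]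
    have := hpp.intervalIntegral_add_eq (φ 0) 0
    rw [zero_add] at this; exact this.trans h0
  have eG : G m - G 0 = Y 0 (2 * π) - Z 0 (2 * π) := by
    simp only [hG]
    rw [Xm, X0, Φm, Φ0, perZ, perV, hz.per]
    have a1 := hy.per 0
    rw [zero_add] at a1
    have a2 : Y 0 0 = 0 := intervalIntegral.integral_same
    have a3 : Z (φ 0) (φ 0) = 0 := intervalIntegral.integral_same
    have a4 : V (φ 0) (φ 0) = 0 := intervalIntegral.integral_same
    rw [a1, a2, a3, a4]; ring
  rw [eG] at tot
  refine tot.trans ?_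
  have f1 : B * e1 ≤ ε / 8 := by
    calc B * e1 ≤ B * (ε / (8 * B)) := by gcongr
      _ = ε / 8 := by field_simp
  calc (m : ℝ) * (B * e1 * |h| ^ 2) = (m * |h|) * (B * e1) * |h| := by ring
    _ ≤ 8 * (ε / 8) * |h| := by gcongr
    _ = ε * |h| := by ring
end

section
open Real Set Filter MeasureTheory

structure Cfg {N : ℕ} (M γ : ℝ) (c : Fin N → ℝ) (Ω : Fin N → Set R2) (z : Fin N → ℝ → R2) : Prop where
  crv : ∀ n, Crv M γ (c n) (z n)
  rng : ∀ n, range (z n) = frontier (Ω n)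
  opn : ∀ n, IsOpen (Ω n)
  bdd : ∀ n, Bornology.IsBounded (Ω n)
  sub : ∀ n, Ω n ⊆ halfPlane
  disj : ∀ n j, n ≠ j → ∀ ξ η, z n ξ ≠ z j η
  ccw : ∀ n, 0 < ∫ ξ in (0:ℝ)..(2 * π), crs (z n ξ) (deriv (z n) ξ)

theorem Cfg.sep {N : ℕ} {M γ : ℝ} {c : Fin N → ℝ} {Ω : Fin N → Set R2} {z : Fin N → ℝ → R2} (h : Cfg M γ c Ω z) :
    ∃ κ > 0, ∀ n j, n ≠ j → ∀ ξ η, κ ≤ ‖z n ξ - z j η‖ := by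
  have : ∀ᶠ κ in nhdsWithin (0:ℝ) (Ioi 0), ∀ n j, n ≠ j → ∀ ξ η, κ ≤ ‖z n ξ - z j η‖ := by
    rw [eventually_all]; intro n
    rw [eventually_all]; intro j
    by_cases hnj : n = j
    · exact Eventually.of_forall fun _ h' => absurd hnj h'
    have hd : Disjoint (range (z n)) (range (z j)) := by
      rw [Set.disjoint_left]
      rintro _ ⟨ξ, rfl⟩ ⟨η, hη⟩
      exact h.disj n j hnj ξ η hη.symm
    obtain ⟨r, hr, hr'⟩ := hd.exists_thickenings (h.crv n).range_closed (h.crv j).range_closed.isClosed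
    filter_upwards [nhdsWithin_le_nhds (Iic_mem_nhds hr)] with κ hκ _ ξ η
    by_contra hlt
    push Not at hlt
    refine (Set.disjoint_left.mp hr') (Metric.self_subset_thickening hr _ (mem_range_self ξ)) ?_
    refine Metric.mem_thickening_iff.mpr ⟨z j η, ⟨η, rfl⟩, ?_⟩
    rw [dist_eq_norm]; exact hlt.trans_le hκ
  obtain ⟨κ, h1, h2⟩ := (this.and self_mem_nhdsWithin).exists
  exact ⟨κ, h2, h1⟩

structure Dyn {N : ℕ} (α γ T cα M : ℝ) (θ : Fin N → ℝ) (Ω : Fin N → ℝ → Set R2) (Z : Fin N → ℝ → ℝ → R2)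
    (c : Fin N → ℝ → ℝ) : Prop where
  cfg : ∀ t ∈ Ico 0 T, Cfg M γ (fun n => c n t) (fun n => Ω n t) (fun n => Z n t)
  haus : ∀ n, ∀ t₀ ∈ Ico 0 T, ∀ ε > 0, ∀ᶠ t in nhdsWithin t₀ (Ico 0 T),
    (∀ ξ, ∃ η, ‖Z n t ξ - Z n t₀ η‖ ≤ ε) ∧ ∀ η, ∃ ξ, ‖Z n t ξ - Z n t₀ η‖ ≤ ε
  patch : ∀ t ∈ Ioo 0 T, ∀ ε > 0, ∀ᶠ h in nhdsWithin (0:ℝ) {0}ᶜ,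
    (∀ n ξ, ∃ j φ, ‖Z n (t + h) ξ - (Z j t φ + h • gSQGvel α cα θ (fun n => Ω n t) (Z j t φ))‖ ≤ ε * |h|) ∧
    (∀ j φ, ∃ n ξ, ‖Z n (t + h) ξ - (Z j t φ + h • gSQGvel α cα θ (fun n => Ω n t) (Z j t φ))‖ ≤ ε * |h|)

variable {N : ℕ} {α γ T cα M : ℝ} {θ : Fin N → ℝ} {Ω : Fin N → ℝ → Set R2} {Z : Fin N → ℝ → ℝ → R2}
    {c : Fin N → ℝ → ℝ}

theorem Dyn.conv (D : Dyn α γ T cα M θ Ω Z c) (n : Fin N) {t₀ : ℝ} (ht : t₀ ∈ Ico 0 T) {ε : ℝ} (hε : 0 < ε) :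
    ∀ᶠ t in nhdsWithin t₀ (Ico 0 T), ∃ s, ∀ ξ, ‖Z n t ξ - Z n t₀ (ξ + s)‖ ≤ ε ∧
      ‖deriv (Z n t) ξ - deriv (Z n t₀) (ξ + s)‖ ≤ ε :=
  convC (cc := c n) ((D.cfg t₀ ht).crv n) ((D.cfg t₀ ht).ccw n)
    (eventually_nhdsWithin_of_forall fun t ht' => (D.cfg t ht').crv n)
    (eventually_nhdsWithin_of_forall fun t ht' => (D.cfg t ht').ccw n) (D.haus n t₀ ht) hε

theorem Dyn.matching (hα0 : 0 < α) (hα : α ≤ 1 / 4) (D : Dyn α γ T cα M θ Ω Z c) {t : ℝ} (ht : t ∈ Ioo 0 T) {ε : ℝ} (hε : 0 < ε) :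
    ∀ᶠ h in nhdsWithin (0:ℝ) {0}ᶜ, t + h ∈ Ico 0 T ∧ ∀ n, ∃ s, (∀ ξ, ‖Z n (t + h) ξ - Z n t (ξ + s)‖ ≤ ε ∧
      ‖deriv (Z n (t + h)) ξ - deriv (Z n t) (ξ + s)‖ ≤ ε) ∧
      (∀ ξ, ∃ φ, ‖Z n (t + h) ξ - (Z n t φ + h • gSQGvel α cα θ (fun n => Ω n t) (Z n t φ))‖ ≤ ε * |h|) ∧
      (∀ φ, ∃ ξ, ‖Z n (t + h) ξ - (Z n t φ + h • gSQGvel α cα θ (fun n => Ω n t) (Z n t φ))‖ ≤ ε * |h|) := by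
  have ht' : t ∈ Ico 0 T := ⟨ht.1.le, ht.2⟩
  have cf := D.cfg t ht'
  obtain ⟨κ, hκ, hsep⟩ := cf.sep
  set u := gSQGvel α cα θ (fun n => Ω n t) with hu
  have huc : Continuous u := vel_cont hα0 hα θ cf.bdd
  set ε' := min ε (κ / 4) with hε'
  have hε'0 : 0 < ε' := by positivity
  have tt : Tendsto (fun h => t + h) (nhdsWithin (0:ℝ) {0}ᶜ) (nhdsWithin t (Ico 0 T)) := by
    have h1 : nhdsWithin t (Ico 0 T) = nhds t := nhdsWithin_eq_nhds.mpr (Ico_mem_nhds ht.1 ht.2)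
    rw [h1]
    have : Tendsto (fun h => t + h) (nhds (0:ℝ)) (nhds (t + 0)) := (continuous_const.add continuous_id).tendsto 0
    rw [add_zero] at this
    exact this.mono_left nhdsWithin_le_nhds
  have e1 : ∀ᶠ h in nhdsWithin (0:ℝ) {0}ᶜ, t + h ∈ Ico 0 T := tt.eventually self_mem_nhdsWithin
  have e2 : ∀ᶠ h in nhdsWithin (0:ℝ) {0}ᶜ, ∀ n, ∃ s, ∀ ξ, ‖Z n (t + h) ξ - Z n t (ξ + s)‖ ≤ ε' ∧
      ‖deriv (Z n (t + h)) ξ - deriv (Z n t) (ξ + s)‖ ≤ ε' :=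
    eventually_all.mpr fun n => tt.eventually (D.conv n ht' hε'0)
  have e3 : ∀ᶠ h in nhdsWithin (0:ℝ) {0}ᶜ, ∀ n, ∀ φ, ‖h • u (Z n t φ)‖ ≤ κ / 4 := by
    refine eventually_all.mpr fun n => ?_
    obtain ⟨K, hK, hUK⟩ := per_bd (huc.comp (cf.crv n).cont) (fun ξ => congrArg u ((cf.crv n).per ξ))
    have : ∀ᶠ h in nhds (0:ℝ), |h| < κ / (4 * K) := by
      have := Metric.ball_mem_nhds (0:ℝ) (by positivity : 0 < κ / (4 * K))
      filter_upwards [this] with h hh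
      simpa using hh
    refine (this.filter_mono nhdsWithin_le_nhds).mono fun h hh φ => ?_
    rw [norm_smul, Real.norm_eq_abs]
    rw [lt_div_iff₀ (by positivity)] at hh
    have := mul_le_mul_of_nonneg_left (hUK φ) (abs_nonneg h)
    simp only [Function.comp] at this
    linarith
  have e4 : ∀ᶠ h in nhdsWithin (0:ℝ) {0}ᶜ, |h| < 1 := by
    have := Metric.ball_mem_nhds (0:ℝ) one_pos
    refine Eventually.filter_mono nhdsWithin_le_nhds ?_
    filter_upwards [this] with h hh
    simpa using hh
  filter_upwards [e1, e2, e3, e4, D.patch t ht ε' hε'0] with h h1 h2 h3 h4 ⟨h5, h6⟩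
  refine ⟨h1, fun n => ?_⟩
  have le1 : ε' ≤ ε := min_le_left _ _
  have le2 : ε' ≤ κ / 4 := min_le_right _ _
  have hh0 := abs_nonneg h
  have idx : ∀ n j ξ φ, ‖Z n (t + h) ξ - (Z j t φ + h • u (Z j t φ))‖ ≤ ε' * |h| → n = j := by
    intro n j ξ φ hle
    by_contra hne
    obtain ⟨s, hs⟩ := h2 n
    have a1 := hsep n j hne (ξ + s) φ
    have e : Z n t (ξ + s) - Z j t φ = (Z n (t + h) ξ - (Z j t φ + h • u (Z j t φ))) + h • u (Z j t φ) -
      (Z n (t + h) ξ - Z n t (ξ + s)) := by abel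
    rw [e] at a1
    have a2 := norm_sub_le ((Z n (t + h) ξ - (Z j t φ + h • u (Z j t φ))) + h • u (Z j t φ)) (Z n (t + h) ξ - Z n t (ξ + s))
    have a3 := norm_add_le (Z n (t + h) ξ - (Z j t φ + h • u (Z j t φ))) (h • u (Z j t φ))
    have a4 := h3 j φ
    have a5 := (hs ξ).1
    nlinarith
  obtain ⟨s, hs⟩ := h2 n
  refine ⟨s, fun ξ => ⟨(hs ξ).1.trans le1, (hs ξ).2.trans le1⟩, fun ξ => ?_, fun φ => ?_⟩
  · obtain ⟨j, φ, hj⟩ := h5 n ξ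
    obtain rfl := idx _ _ _ _ hj
    exact ⟨φ, hj.trans (by gcongr)⟩
  · obtain ⟨j, ξ, hj⟩ := h6 n φ
    obtain rfl := idx _ _ _ _ hj
    exact ⟨ξ, hj.trans (by gcongr)⟩

theorem Dyn.area_der (hα0 : 0 < α) (hα : α ≤ 1 / 4) (D : Dyn α γ T cα M θ Ω Z c) (n : Fin N) {t : ℝ} (ht : t ∈ Ioo 0 T) :
    HasDerivAt (fun t => ∫ ξ in (0:ℝ)..(2 * π), crs (Z n t ξ) (deriv (Z n t) ξ)) 0 t := by
  have ht' : t ∈ Ico 0 T := ⟨ht.1.le, ht.2⟩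
  have cf := D.cfg t ht'
  set u := gSQGvel α cα θ (fun n => Ω n t) with hu
  have huc : Continuous u := vel_cont hα0 hα θ cf.bdd
  rw [hasDerivAt_iff_isLittleO_nhds_zero, Asymptotics.isLittleO_iff]
  intro ε hε
  obtain ⟨h₀, hh₀, e₀, he₀, H⟩ := area_step (cf.crv n) (huc.comp (cf.crv n).cont) (fun ξ => congrArg u ((cf.crv n).per ξ))
    (circ_u (cα := cα) hα0 hα (cf.crv n) θ cf.bdd) hε
  have e1 : ∀ᶠ h in nhds (0:ℝ), |h| ≤ h₀ := by
    filter_upwards [Metric.ball_mem_nhds (0:ℝ) hh₀] with h hh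
    exact le_of_lt (by simpa using hh)
  have e2 := D.matching hα0 hα ht he₀
  rw [eventually_nhdsWithin_iff] at e2
  filter_upwards [e1, e2] with h h1 h2
  by_cases hh : h = 0
  · simp [hh]
  obtain ⟨h3, h4⟩ := h2 hh
  obtain ⟨s, h5, h6, h7⟩ := h4 n
  have := H h _ (abs_pos.mpr hh) h1 (Z n (t + h)) ((D.cfg _ h3).crv n) ⟨s, fun ξ => (h5 ξ).1⟩ h6
  simpa using this

theorem Dyn.speed (hα0 : 0 < α) (hα : α ≤ 1 / 4) (hT : 0 < T) (D : Dyn α γ T cα M θ Ω Z c) :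
    ∃ c0 > 0, ∀ n, ∀ t ∈ Ico 0 T, c0 ≤ c n t := by
  have : ∀ᶠ c0 in nhdsWithin (0:ℝ) (Ioi 0), ∀ n, ∀ t ∈ Ico 0 T, c0 ≤ c n t := by
    refine eventually_all.mpr fun n => ?_
    set A := fun t => ∫ ξ in (0:ℝ)..(2 * π), crs (Z n t ξ) (deriv (Z n t) ξ) with hA
    have hd := fun t ht => D.area_der hα0 hα n (t := t) ht
    have mid : T / 2 ∈ Ioo 0 T := ⟨by linarith, by linarith⟩
    have hc : ∀ t ∈ Ioo 0 T, A t = A (T / 2) := fun t ht =>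
      isOpen_Ioo.is_const_of_deriv_eq_zero isPreconnected_Ioo (fun x hx => (hd x hx).differentiableAt.differentiableWithinAt)
        (fun x hx => (hd x hx).deriv) ht mid
    have hA0 : 0 < A (T / 2) := (D.cfg _ ⟨mid.1.le, mid.2⟩).ccw n
    have z0 : (0:ℝ) ∈ Ico 0 T := ⟨le_rfl, hT⟩
    have c00 := ((D.cfg 0 z0).crv n).cpos
    have M1 := ((D.cfg 0 z0).crv n).M1
    have hpos : 0 < min (c n 0) (A (T / 2) / (2 * π * M)) := by
      have := two_pi_pos; positivity
    filter_upwards [nhdsWithin_le_nhds (Iic_mem_nhds hpos)] with c0 hc0 t ht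
    rcases eq_or_lt_of_le ht.1 with h0 | h0
    · rw [← h0]; exact hc0.trans (min_le_left _ _)
    · have h1 : c0 ≤ _ := hc0.trans (min_le_right _ _)
      rw [← hc t ⟨h0, ht.2⟩] at h1
      refine h1.trans ?_
      have cv := (D.cfg t ht).crv n
      have hπ := two_pi_pos
      rw [div_le_iff₀ (by positivity)]
      have := intervalIntegral.norm_integral_le_of_norm_le_const (a := (0:ℝ)) (b := 2 * π) (C := M * c n t)
        (f := fun ξ => crs (Z n t ξ) (deriv (Z n t) ξ)) (fun ξ _ => (abs_crs_le _ _).trans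
          (by rw [cv.spd]; exact mul_le_mul_of_nonneg_right (cv.bd ξ) cv.cpos.le))
      rw [sub_zero, abs_of_pos hπ] at this
      have := (le_abs_self _).trans this
      calc A t ≤ _ := this
        _ = _ := by ring
  obtain ⟨κ, h1, h2⟩ := (this.and self_mem_nhdsWithin).exists
  exact ⟨κ, h2, h1⟩
end

section
open Real Set Filter MeasureTheory

theorem crv_cross {M γ c c' ξ η s d ρ : ℝ} {y w : ℝ → R2} (hy : Crv M γ c y) (hw : Crv M γ c' w)
    (hs : s = crs (deriv y ξ) (deriv w η)) (hs0 : 0 < s) (hd : d = ‖y ξ - w η‖) (hd0 : 0 < d)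
    (hρ : ρ = 4 * M * d / s) (hsm : 100 * M ^ 2 * ρ ^ γ < s) :
    ∃ σ τ, |σ - ξ| ≤ ρ ∧ |τ - η| ≤ ρ ∧ y σ = w τ := by
  have hM := hy.M1
  have hM0 : 0 < M := by linarith
  have hρ0 : 0 < ρ := by rw [hρ]; positivity
  have hρs : ρ * s = 4 * M * d := by rw [hρ]; field_simp
  set e := deriv y ξ with he
  set f := deriv w η with hf
  have ne : ‖e‖ ≤ M := (hy.spd ξ).le.trans hy.cM
  have nf : ‖f‖ ≤ M := (hw.spd η).le.trans hw.cM
  have hyc := hy.cont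
  have hwc := hw.cont
  set b := M * ρ ^ γ * ρ with hb
  have hbs : 100 * M * b < 4 * M * d := by
    rw [← hρs, hb]; nlinarith
  have tb : ∀ {x x₀ : ℝ}, |x - x₀| ≤ ρ → M * |x - x₀| ^ γ * |x - x₀| ≤ b := by
    intro x x₀ h
    rw [hb]
    have := Real.rpow_le_rpow (abs_nonneg _) h hy.g0.le
    have := Real.rpow_nonneg (abs_nonneg (x - x₀)) γ
    gcongr
  have ty : ∀ σ, |σ - ξ| ≤ ρ → ‖y σ - y ξ - (σ - ξ) • e‖ ≤ b := fun σ h => (hy.taylor σ ξ).trans (tb h)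
  have tw : ∀ σ, |σ - η| ≤ ρ → ‖w σ - w η - (σ - η) • f‖ ≤ b := fun σ h => (hw.taylor σ η).trans (tb h)
  have key : ∀ σ τ v, |σ - ξ| ≤ ρ → |τ - η| ≤ ρ → ‖v‖ ≤ M →
      |crs (y σ - w τ) v - ((σ - ξ) * crs e v - (τ - η) * crs f v)| < 2 * M * d := by
    intro σ τ v h1 h2 hv
    have e : crs (y σ - w τ) v - ((σ - ξ) * crs e v - (τ - η) * crs f v) =
      crs ((y ξ - w η) + (y σ - y ξ - (σ - ξ) • e) - (w τ - w η - (τ - η) • f)) v := by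
      simp only [crs_add_left, crs_sub_left, crs_smul_left]; ring
    rw [e]
    refine (abs_crs_le _ _).trans_lt ?_
    have a1 := norm_sub_le ((y ξ - w η) + (y σ - y ξ - (σ - ξ) • deriv y ξ)) (w τ - w η - (τ - η) • f)
    have a2 := norm_add_le (y ξ - w η) (y σ - y ξ - (σ - ξ) • deriv y ξ)
    have a3 := ty σ h1
    have a4 := tw τ h2
    have a5 : ‖(y ξ - w η) + (y σ - y ξ - (σ - ξ) • deriv y ξ) - (w τ - w η - (τ - η) • f)‖ ≤ d + 2 * b := by
      rw [hd]; linarith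
    refine (mul_le_mul a5 hv (norm_nonneg _) (by positivity)).trans_lt ?_
    nlinarith
  have cef : crs f e = -s := by rw [hs, crs_comm]
  have hI : ∀ {x x₀ : ℝ}, x ∈ Icc (x₀ - ρ) (x₀ + ρ) → |x - x₀| ≤ ρ := by
    intro x x₀ h
    rw [abs_le]; constructor <;> linarith [h.1, h.2]
  have r1 : |η - ρ - η| ≤ ρ := hI ⟨le_rfl, by linarith⟩
  have r2 : |η + ρ - η| ≤ ρ := hI ⟨by linarith, le_rfl⟩
  have r3 : |ξ - ρ - ξ| ≤ ρ := hI ⟨le_rfl, by linarith⟩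
  have r4 : |ξ + ρ - ξ| ≤ ρ := hI ⟨by linarith, le_rfl⟩
  have m1 : ∀ σ ∈ Icc (ξ - ρ) (ξ + ρ), StrictMonoOn (fun τ => crs (y σ - w τ) e) (Icc (η - ρ) (η + ρ)) := by
    intro σ _
    refine strictMonoOn_of_der (f' := fun τ => - crs (deriv w τ) e) (fun τ => ?_) ?_
    · have := (hasDerivAt_crs (hw.der τ) e).const_sub (crs (y σ) e)
      refine this.congr_of_eventuallyEq (Eventually.of_forall fun x => ?_)
      simp only [crs_sub_left]
    · intro τ hτ
      have h1 := hw.hol τ η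
      have h2 := Real.rpow_le_rpow (abs_nonneg _) (hI hτ) hy.g0.le
      have h3 := abs_crs_le (deriv w τ - f) e
      have h4 : ‖deriv w τ - f‖ * ‖e‖ ≤ (M * ρ ^ γ) * M := by
        refine mul_le_mul (h1.trans (by gcongr)) ne (norm_nonneg _) (by positivity)
      rw [crs_sub_left, cef] at h3
      have := (abs_le.mp (h3.trans h4)).2
      have := Real.rpow_nonneg hρ0.le γ
      have : 0 ≤ M ^ 2 * ρ ^ γ := by positivity
      nlinarith
  have m2 : ∀ σ ∈ Icc (ξ - ρ) (ξ + ρ), crs (y σ - w (η - ρ)) e < 0 := by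
    intro σ hσ
    have := (abs_lt.mp (key σ (η - ρ) e (hI hσ) r1 ne)).2
    rw [crs_self, cef] at this
    nlinarith
  have m3 : ∀ σ ∈ Icc (ξ - ρ) (ξ + ρ), 0 < crs (y σ - w (η + ρ)) e := by
    intro σ hσ
    have := (abs_lt.mp (key σ (η + ρ) e (hI hσ) r2 ne)).1
    rw [crs_self, cef] at this
    nlinarith
  obtain ⟨θ, hθc, hθ⟩ := impl_zero (F := fun σ τ => crs (y σ - w τ) e) (a := η - ρ) (b := η + ρ)
    (S := Icc (ξ - ρ) (ξ + ρ)) (by unfold Function.uncurry; fun_prop) (by linarith) m1 m2 m3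
  have hc : ContinuousOn (fun σ => crs (y σ - w (θ σ)) f) (Icc (ξ - ρ) (ξ + ρ)) := by
    have h1 : ContinuousOn (fun σ => w (θ σ)) (Icc (ξ - ρ) (ξ + ρ)) := hwc.comp_continuousOn hθc
    have h2 : Continuous fun a : R2 => crs a f := by fun_prop
    exact h2.comp_continuousOn (hyc.continuousOn.sub h1)
  have hle : ξ - ρ ≤ ξ + ρ := by linarith
  obtain ⟨σ, hσ, h0⟩ := intermediate_value_Icc hle hc (show (0:ℝ) ∈ _ by
    have m1 := hθ (ξ - ρ) ⟨le_rfl, hle⟩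
    have m2 := hθ (ξ + ρ) ⟨hle, le_rfl⟩
    have k1 := abs_lt.mp (key (ξ - ρ) _ f r3 (hI m1.1) nf)
    have k2 := abs_lt.mp (key (ξ + ρ) _ f r4 (hI m2.1) nf)
    rw [crs_self, ← hs] at k1 k2
    constructor <;> nlinarith)
  exact ⟨σ, θ σ, hI hσ, hI (hθ σ hσ).1, sub_eq_zero.mp (eq_of_crs (by rw [← hs]; exact hs0.ne') (hθ σ hσ).2 h0)⟩

theorem pow_close {γ β s d K : ℝ} (hγ : 0 < γ) (hβ : β * (1 + γ) = γ) (hs : 0 < s) (hd : 0 ≤ d) (hK : 1 ≤ K)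
    (h : s ≤ K * (d / s) ^ γ) : s ≤ K * d ^ β := by
  by_contra hlt
  push Not at hlt
  have h0 : 0 ≤ d ^ β := Real.rpow_nonneg hd _
  have h1 : (K * d ^ β) ^ (1 + γ) < s ^ (1 + γ) := Real.rpow_lt_rpow (by positivity) hlt (by linarith)
  rw [Real.mul_rpow (by linarith) h0, ← Real.rpow_mul hd, hβ, Real.rpow_add hs, Real.rpow_one] at h1
  rw [Real.div_rpow hd hs.le, ← mul_div_assoc, le_div_iff₀ (Real.rpow_pos_of_pos hs γ)] at h
  have h2 : K ≤ K ^ (1 + γ) := by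
    conv_lhs => rw [← Real.rpow_one K]
    exact Real.rpow_le_rpow_of_exponent_le hK (by linarith)
  have h3 : 0 ≤ d ^ γ := Real.rpow_nonneg hd _
  nlinarith

theorem tang1 {M γ β c c' ξ η : ℝ} {y w : ℝ → R2} (hβ : β * (1 + γ) = γ) (hy : Crv M γ c y) (hw : Crv M γ c' w)
    (hcr : ∀ σ τ, y σ = w τ → ∀ ξ η, |crs (deriv y ξ) (deriv w η)| ≤ M ^ 2 * (|ξ - σ| + |η - τ|) ^ γ) :
    |crs (deriv y ξ) (deriv w η)| ≤ 400 * M ^ 3 * ‖y ξ - w η‖ ^ β := by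
  have hM := hy.M1
  have hγ := hy.g0
  set s := |crs (deriv y ξ) (deriv w η)| with hs
  set d := ‖y ξ - w η‖ with hd
  rcases eq_or_lt_of_le (abs_nonneg (crs (deriv y ξ) (deriv w η))) with h0 | hs0
  · rw [hs, ← h0]; positivity
  rw [← hs] at hs0
  rcases eq_or_lt_of_le (norm_nonneg (y ξ - w η)) with h0 | hd0
  · have := hcr ξ η (sub_eq_zero.mp (norm_eq_zero.mp h0.symm)) ξ η
    rw [sub_self, sub_self, abs_zero, add_zero, Real.zero_rpow hγ.ne', mul_zero] at this
    exact absurd this (not_le.mpr hs0)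
  rw [← hd] at hd0
  have big : s ≤ 100 * M ^ 2 * (4 * M * d / s) ^ γ := by
    by_contra hlt
    push Not at hlt
    set ρ := 4 * M * d / s with hρ
    have hρ0 : 0 < ρ := by rw [hρ]; positivity
    have hx : ∃ σ τ, |σ - ξ| ≤ ρ ∧ |τ - η| ≤ ρ ∧ y σ = w τ := by
      rcases abs_cases (crs (deriv y ξ) (deriv w η)) with ⟨h1, h2⟩ | ⟨h1, h2⟩
      · exact crv_cross hy hw (hs.trans h1) hs0 hd hd0 hρ hlt
      · obtain ⟨σ, τ, h3, h4, h5⟩ := crv_cross hw hy (s := s) (d := d) (ξ := η) (η := ξ) (by rw [hs, h1, crs_comm]; ring) hs0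
          (by rw [hd, norm_sub_rev]) hd0 hρ hlt
        exact ⟨τ, σ, h4, h3, h5.symm⟩
    obtain ⟨σ, τ, h3, h4, h5⟩ := hx
    have h6 := hcr σ τ h5 ξ η
    have h7 : (|ξ - σ| + |η - τ|) ^ γ ≤ 2 * ρ ^ γ := by
      rw [abs_sub_comm ξ, abs_sub_comm η]
      refine (Real.rpow_le_rpow (by positivity) (by linarith : _ ≤ 2 * ρ) hγ.le).trans ?_
      rw [Real.mul_rpow (by norm_num) hρ0.le]
      gcongr
      conv_rhs => rw [← Real.rpow_one 2]
      exact Real.rpow_le_rpow_of_exponent_le (by norm_num) hy.g1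
    have h8 : 0 ≤ M ^ 2 * ρ ^ γ := by positivity
    have h9 : s ≤ M ^ 2 * (2 * ρ ^ γ) := h6.trans (by gcongr)
    nlinarith
  refine pow_close hγ hβ hs0 hd0.le (one_le_mul_of_one_le_of_one_le (by norm_num) (one_le_pow₀ hM)) (big.trans ?_)
  rw [mul_div_assoc, Real.mul_rpow (by positivity) (by positivity)]
  have : (4 * M) ^ γ ≤ 4 * M := by
    conv_rhs => rw [← Real.rpow_one (4 * M)]
    exact Real.rpow_le_rpow_of_exponent_le (by linarith) hy.g1
  have := mul_le_mul_of_nonneg_left this (by positivity : 0 ≤ 100 * M ^ 2 * (d / s) ^ γ)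
  nlinarith

theorem tang2 {M γ β c ξ : ℝ} {y : ℝ → R2} (hβ : β * (1 + γ) = γ) (hy : Crv M γ c y) (hp : ∀ ξ, 0 ≤ y ξ 1) :
    |deriv y ξ 1| ≤ 4 * M * (y ξ 1) ^ β := by
  have hM := hy.M1
  have hγ := hy.g0
  set s := |deriv y ξ 1| with hs
  set d := y ξ 1 with hd
  rcases eq_or_lt_of_le (abs_nonneg (deriv y ξ 1)) with h0 | hs0
  · rw [hs, ← h0]; have := Real.rpow_nonneg (hp ξ) β; positivity
  rw [← hs] at hs0
  have main : ∀ ρ, 0 < ρ → s * ρ ≤ d + M * ρ ^ γ * ρ := by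
    intro ρ hρ
    have : ∃ x, |x - ξ| = ρ ∧ (x - ξ) * deriv y ξ 1 = - (ρ * s) := by
      rcases abs_cases (deriv y ξ 1) with ⟨h1, h2⟩ | ⟨h1, h2⟩
      · exact ⟨ξ - ρ, by rw [sub_sub_cancel_left, abs_neg, abs_of_pos hρ], by rw [hs, h1]; ring⟩
      · exact ⟨ξ + ρ, by rw [add_sub_cancel_left, abs_of_pos hρ], by rw [hs, h1]; ring⟩
    obtain ⟨x, h1, h2⟩ := this
    have h3 := hy.taylor x ξ
    have h4 := (le_abs_self _).trans ((abs_coord_le (y x - y ξ - (x - ξ) • deriv y ξ) 1).trans h3)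
    have h5 := hp x
    simp only [PiLp.sub_apply, PiLp.smul_apply, smul_eq_mul] at h4
    rw [h1] at h4
    linarith
  have hd0 : 0 < d := by
    by_contra hd'
    have hd0 : d = 0 := le_antisymm (not_lt.mp hd') (hp ξ)
    obtain ⟨r, hr0, hr1, hr⟩ := Crv.exists_r hγ hM (by linarith : 0 < s / 2)
    have := main r hr0
    rw [hd0] at this
    nlinarith
  refine pow_close hγ hβ hs0 hd0.le (by linarith) ?_
  have := main (2 * d / s) (by positivity)
  rw [show s * (2 * d / s) = 2 * d by field_simp] at this
  have h1 : M * (2 * d / s) ^ γ * (2 * d / s) = (2 * M * (2 * d / s) ^ γ / s) * d := by ring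
  rw [h1] at this
  have h2 : 1 ≤ 2 * M * (2 * d / s) ^ γ / s := by
    by_contra h; push Not at h; nlinarith
  rw [le_div_iff₀ hs0, one_mul, mul_div_assoc, Real.mul_rpow (by norm_num) (by positivity)] at h2
  have h3 : (2:ℝ) ^ γ ≤ 2 := by
    conv_rhs => rw [← Real.rpow_one 2]
    exact Real.rpow_le_rpow_of_exponent_le (by norm_num) hy.g1
  have h4 : 0 ≤ (d / s) ^ γ := by positivity
  have := mul_le_mul_of_nonneg_left h3 (by positivity : 0 ≤ 2 * M * (d / s) ^ γ)
  nlinarith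

theorem Cfg.pos {N : ℕ} {M γ : ℝ} {c : Fin N → ℝ} {Ω : Fin N → Set R2} {z : Fin N → ℝ → R2} (h : Cfg M γ c Ω z)
    (n : Fin N) (ξ : ℝ) : 0 ≤ z n ξ 1 := by
  have h1 : z n ξ ∈ closure (Ω n) := frontier_subset_closure (h.rng n ▸ mem_range_self ξ)
  have h2 : IsClosed {y : R2 | 0 ≤ y 1} := isClosed_le continuous_const (continuous_coord 1)
  have h3 : Ω n ⊆ {y : R2 | 0 ≤ y 1} := fun y hy => by
    have h4 : 0 < y 1 := h.sub n hy
    exact h4.le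
  exact closure_minimal h3 h2 h1

theorem Cfg.tang {N : ℕ} {M γ β : ℝ} {c : Fin N → ℝ} {Ω : Fin N → Set R2} {z : Fin N → ℝ → R2} (h : Cfg M γ c Ω z)
    (hβ : β * (1 + γ) = γ) (n j : Fin N) (ξ η : ℝ) :
    |crs (deriv (z n) ξ) (deriv (z j) η)| ≤ 400 * M ^ 3 * ‖z n ξ - z j η‖ ^ β := by
  refine tang1 hβ (h.crv n) (h.crv j) fun σ τ he ξ η => ?_
  have hnj : n = j := by
    by_contra hne; exact h.disj n j hne σ τ he
  subst hnj
  have cv := h.crv n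
  have e : crs (deriv (z n) ξ) (deriv (z n) η) = crs (deriv (z n) ξ) (deriv (z n) η - deriv (z n) ξ) := by
    rw [crs_sub_right, crs_self, sub_zero]
  rw [e]
  refine (abs_crs_le _ _).trans ?_
  rw [cv.spd, sq, mul_assoc]
  refine mul_le_mul cv.cM ((cv.holT η ξ).trans ?_) (norm_nonneg _) (by linarith [cv.M1])
  have : distT η ξ ≤ |ξ - σ| + |η - τ| := by
    have h1 := distT_triangle η τ ξ
    have h2 := distT_triangle τ σ ξ
    have h3 := cv.inj σ τ he
    rw [distT_comm] at h3
    have h4 := distT_le_abs η τ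
    have h5 := distT_le_abs σ ξ
    rw [abs_sub_comm] at h5
    linarith
  exact mul_le_mul_of_nonneg_left (Real.rpow_le_rpow (distT_nonneg _ _) this cv.g0.le) (by linarith [cv.M1])

/-- tangent alignment with reflected curve -/
theorem Cfg.tang' {N : ℕ} {M γ β : ℝ} {c : Fin N → ℝ} {Ω : Fin N → Set R2} {z : Fin N → ℝ → R2} (h : Cfg M γ c Ω z)
    (hβ : β * (1 + γ) = γ) (n j : Fin N) (ξ η : ℝ) :
    |crs (deriv (z n) ξ) (reflect (deriv (z j) η))| ≤ 400 * M ^ 3 * ‖z n ξ - reflect (z j η)‖ ^ β := by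
  have cv := h.crv n
  have cw := h.crv j
  have hM := cv.M1
  have hγ := cv.g0
  have hβ0 : 0 < β := by nlinarith
  set D := ‖z n ξ - reflect (z j η)‖ with hD
  have h1 : z n ξ 1 + z j η 1 ≤ D := by
    have := (le_abs_self _).trans (abs_coord_le (z n ξ - reflect (z j η)) 1)
    simpa using this
  have p1 := h.pos n ξ
  have p2 := h.pos j η
  have t1 := (tang2 (ξ := ξ) hβ cv (h.pos n)).trans (mul_le_mul_of_nonneg_left (Real.rpow_le_rpow p1 (by linarith : _ ≤ D) hβ0.le) (by linarith))
  have t2 := (tang2 (ξ := η) hβ cw (h.pos j)).trans (mul_le_mul_of_nonneg_left (Real.rpow_le_rpow p2 (by linarith : _ ≤ D) hβ0.le) (by linarith))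
  have q1 := (abs_coord_le (deriv (z n) ξ) 0).trans ((cv.spd ξ).le.trans cv.cM)
  have q2 := (abs_coord_le (deriv (z j) η) 0).trans ((cw.spd η).le.trans cw.cM)
  have e : crs (deriv (z n) ξ) (reflect (deriv (z j) η)) = -(deriv (z n) ξ 0 * deriv (z j) η 1) - deriv (z n) ξ 1 * deriv (z j) η 0 := by
    simp [crs]
  rw [e]
  refine (abs_sub _ _).trans ?_
  rw [abs_neg, abs_mul, abs_mul]
  have D0 : 0 ≤ D ^ β := Real.rpow_nonneg (norm_nonneg _) _
  have b1 := mul_le_mul q1 t2 (abs_nonneg _) (by linarith)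
  have b2 := mul_le_mul t1 q2 (abs_nonneg _) (by positivity)
  have : M * (M * D ^ β) ≤ M ^ 3 * D ^ β := by
    have : 0 ≤ M * (M * D ^ β) := by positivity
    nlinarith
  have : 0 ≤ M ^ 3 * D ^ β := by positivity
  linarith
end

section
open Real Set Filter MeasureTheory

theorem kdiff {P Q q : ℝ} (hP : 0 < P) (hPQ : P ≤ Q) (hq : 1 ≤ q) :
    0 ≤ P ^ (-q) - Q ^ (-q) ∧ (P ^ (-q) - Q ^ (-q)) * P ≤ P ^ (-q) * (q * (Q - P)) := by
  have hQ : 0 < Q := hP.trans_le hPQ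
  constructor
  · exact sub_nonneg.mpr (Real.rpow_le_rpow_of_nonpos hP hPQ (by linarith))
  have h1 := one_add_mul_self_le_rpow_one_add (s := P / Q - 1) (by have : 0 ≤ P / Q := by positivity
                                                                   linarith) hq
  rw [add_sub_cancel, Real.div_rpow hP.le hQ.le] at h1
  have hPq : 0 < P ^ (-q) := Real.rpow_pos_of_pos hP _
  have e : Q ^ (-q) = P ^ (-q) * (P ^ q / Q ^ q) := by
    rw [Real.rpow_neg hP.le, Real.rpow_neg hQ.le]; field_simp
  have h2 : 1 - P ^ q / Q ^ q ≤ q * (1 - P / Q) := by linarith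
  have h3 : (1 - P / Q) * P ≤ Q - P := by
    have : (1 - P / Q) * P = (Q - P) * (P / Q) := by field_simp
    rw [this]
    have : P / Q ≤ 1 := (div_le_one hQ).mpr hPQ
    nlinarith
  have e2 : (P ^ (-q) - Q ^ (-q)) * P = P ^ (-q) * ((1 - P ^ q / Q ^ q) * P) := by rw [e]; ring
  rw [e2]
  refine mul_le_mul_of_nonneg_left ?_ hPq.le
  have := mul_le_mul_of_nonneg_right h2 hP.le
  nlinarith

theorem KF0 {a P Q δ D α : ℝ} (hα0 : 0 < α) (hα : α ≤ 1 / 4) (ha : 0 < a) (haP : a ≤ P) (hPQ : P ≤ Q) (hd : |P - Q| ≤ δ)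
    (hD : a + D ≤ 5 * (P + δ)) :
    a * |P ^ (-(2 + 2 * α)) - Q ^ (-(2 + 2 * α))| * (a + D) ≤ 20 * δ * a ^ (-(1 + 2 * α)) := by
  have hP : 0 < P := ha.trans_le haP
  have hδ : 0 ≤ δ := (abs_nonneg _).trans hd
  obtain ⟨h1, h2⟩ := kdiff hP hPQ (q := 2 + 2 * α) (by linarith)
  rw [abs_of_nonneg h1]
  set K := P ^ (-(2 + 2 * α)) - Q ^ (-(2 + 2 * α)) with hK
  have hQ0 : 0 ≤ Q ^ (-(2 + 2 * α)) := Real.rpow_nonneg (hP.le.trans hPQ) _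
  have h3 : P ^ (-(2 + 2 * α)) ≤ a ^ (-(2 + 2 * α)) := Real.rpow_le_rpow_of_nonpos ha haP (by linarith)
  have e : a ^ (-(1 + 2 * α)) = a * a ^ (-(2 + 2 * α)) := by
    have := Real.rpow_add ha 1 (-(2 + 2 * α))
    rw [Real.rpow_one] at this
    rw [← this]; congr 1; ring
  rw [e]
  set B := a ^ (-(2 + 2 * α)) with hB
  have hP0 : 0 ≤ P ^ (-(2 + 2 * α)) := Real.rpow_nonneg hP.le _
  have h4 : K * P ≤ B * (3 * δ) := by
    refine h2.trans ?_
    have h5 : Q - P ≤ δ := by rw [abs_le] at hd; linarith [hd.1]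
    have h6 : (2 + 2 * α) * (Q - P) ≤ 3 * δ := by nlinarith
    exact mul_le_mul h3 h6 (by nlinarith) (by positivity)
  have h7 : K ≤ B := by linarith
  have h8 : K * (a + D) ≤ 20 * δ * B := by nlinarith
  nlinarith

theorem KF {a P Q δ D α : ℝ} (hα0 : 0 < α) (hα : α ≤ 1 / 4) (ha : 0 < a) (haP : a ≤ P) (haQ : a ≤ Q) (hd : |P - Q| ≤ δ)
    (hD : a + D ≤ 5 * P) :
    a * |P ^ (-(2 + 2 * α)) - Q ^ (-(2 + 2 * α))| * (a + D) ≤ 20 * δ * a ^ (-(1 + 2 * α)) := by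
  have hδ : 0 ≤ δ := (abs_nonneg _).trans hd
  rcases le_total P Q with h | h
  · exact KF0 hα0 hα ha haP h hd (by linarith)
  · rw [abs_sub_comm]
    rw [abs_sub_comm] at hd
    have := abs_le.mp hd
    exact KF0 hα0 hα ha haQ h hd (by linarith)

/-- far bound -/
theorem KFfar {a P Q δ α r : ℝ} (hα0 : 0 < α) (hα : α ≤ 1 / 4) (hr : 0 < r) (haP : |a| ≤ P) (haQ : |a| ≤ Q) (hd : |P - Q| ≤ δ)
    (hP : r ≤ P) (hQ : r ≤ Q) :
    |a * (P ^ (-(2 + 2 * α)) - Q ^ (-(2 + 2 * α)))| ≤ 3 * r ^ (-(2 + 2 * α)) * δ := by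
  wlog hPQ : P ≤ Q generalizing P Q with H
  · have := H haQ haP (by rwa [abs_sub_comm]) hQ hP (not_le.mp hPQ).le
    rwa [abs_mul, abs_sub_comm, ← abs_mul] at this
  have hP0 : 0 < P := hr.trans_le hP
  obtain ⟨h1, h2⟩ := kdiff hP0 hPQ (q := 2 + 2 * α) (by linarith)
  have h3 : P ^ (-(2 + 2 * α)) ≤ r ^ (-(2 + 2 * α)) := Real.rpow_le_rpow_of_nonpos hr hP (by linarith)
  have h0 : 0 ≤ P ^ (-(2 + 2 * α)) := by positivity
  rw [abs_mul, abs_of_nonneg h1]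
  have hd' : Q - P ≤ δ := by rw [abs_le] at hd; linarith [hd.1]
  have h6 : (2 + 2 * α) * (Q - P) ≤ 3 * δ := by nlinarith
  have h7 := mul_le_mul h3 h6 (by nlinarith) (by positivity)
  have h8 := mul_le_mul_of_nonneg_right haP h1
  nlinarith

theorem J1 {s r : ℝ} (hs : 0 < s) (hr : 0 ≤ r) : ∫⁻ a in Ioc 0 r, ENNReal.ofReal (a ^ (s - 1)) = ENNReal.ofReal (r ^ s / s) := by
  have hi := (intervalIntegrable_iff_integrableOn_Ioc_of_le hr).mp
    (intervalIntegral.intervalIntegrable_rpow' (a := 0) (b := r) (r := s - 1) (by linarith))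
  rw [← ofReal_integral_eq_lintegral_ofReal hi ((ae_restrict_iff' measurableSet_Ioc).mpr
    (Eventually.of_forall fun a ha => Real.rpow_nonneg ha.1.le _)), ← intervalIntegral.integral_of_le hr,
    integral_rpow (Or.inl (by linarith))]
  rw [sub_add_cancel, Real.zero_rpow hs.ne', sub_zero]

theorem J2 {β D : ℝ} (hβ0 : 0 < β) (hβ : β < 1) (hD : 0 ≤ D) :
    ∫⁻ a in Ioi 0, ENNReal.ofReal (D ^ β * a ^ (-β) / (a + D)) ≤ ENNReal.ofReal (1 / (1 - β) + 1 / β) := by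
  rcases eq_or_lt_of_le hD with h0 | hD0
  · rw [← h0, Real.zero_rpow hβ0.ne']
    simp
  have hb : 0 < 1 - β := by linarith
  rw [← Ioc_union_Ioi_eq_Ioi hD, ENNReal.ofReal_add (by positivity) (by positivity)]
  refine (lintegral_union_le _ _ _).trans (add_le_add ?_ ?_)
  · calc ∫⁻ a in Ioc 0 D, ENNReal.ofReal (D ^ β * a ^ (-β) / (a + D))
        ≤ ∫⁻ a in Ioc 0 D, ENNReal.ofReal (D ^ (β - 1)) * ENNReal.ofReal (a ^ ((1 - β) - 1)) := by
          refine setLIntegral_mono' measurableSet_Ioc fun a ha => ?_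
          rw [← ENNReal.ofReal_mul (by positivity)]
          refine ENNReal.ofReal_le_ofReal ?_
          rw [Real.rpow_sub_one hD0.ne', show (1 - β) - 1 = -β by ring, div_mul_eq_mul_div]
          have := ha.1
          gcongr
          linarith
      _ = ENNReal.ofReal (D ^ (β - 1)) * ENNReal.ofReal (D ^ (1 - β) / (1 - β)) := by
          rw [lintegral_const_mul' _ _ ENNReal.ofReal_ne_top, J1 hb hD]
      _ ≤ _ := by
          rw [← ENNReal.ofReal_mul (by positivity), mul_div_assoc', ← Real.rpow_add hD0]
          simp
  · calc ∫⁻ a in Ioi D, ENNReal.ofReal (D ^ β * a ^ (-β) / (a + D))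
        ≤ ∫⁻ a in Ioi D, ENNReal.ofReal (D ^ β) * ENNReal.ofReal (a ^ (-β - 1)) := by
          refine setLIntegral_mono' measurableSet_Ioi fun a ha => ?_
          have ha0 : 0 < a := hD0.trans ha
          rw [← ENNReal.ofReal_mul (by positivity)]
          refine ENNReal.ofReal_le_ofReal ?_
          rw [Real.rpow_sub_one ha0.ne', mul_div_assoc']
          gcongr
          linarith
      _ = ENNReal.ofReal (D ^ β) * ENNReal.ofReal (D ^ (-β) / β) := by
          rw [lintegral_const_mul' _ _ ENNReal.ofReal_ne_top, ← ofReal_integral_eq_lintegral_ofReal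
            (integrableOn_Ioi_rpow_of_lt (by linarith) hD0) ((ae_restrict_iff' measurableSet_Ioi).mpr
            (Eventually.of_forall fun a ha => Real.rpow_nonneg (hD0.trans ha).le _)),
            integral_Ioi_rpow_of_lt (by linarith) hD0, sub_add_cancel, neg_div_neg_eq]
      _ ≤ _ := by
          rw [← ENNReal.ofReal_mul (by positivity), mul_div_assoc', ← Real.rpow_add hD0]
          simp

theorem lint_abs (G : ℝ → ENNReal) : ∫⁻ a : ℝ, G |a| ≤ 2 * ∫⁻ a in Ici 0, G a := by
  have h1 : ∫⁻ a in Ici (0:ℝ), G |a| = ∫⁻ a in Ici 0, G a :=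
    setLIntegral_congr_fun measurableSet_Ici fun a ha => by
      show G |a| = G a
      rw [abs_of_nonneg ha]
  have h2 : ∫⁻ a in Iic (0:ℝ), G |a| = ∫⁻ a in Ici 0, G |a| := by
    have hm := Measure.measurePreserving_neg (volume : Measure ℝ)
    have := hm.setLIntegral_comp_preimage_emb (MeasurableEquiv.neg ℝ).measurableEmbedding (fun a => G |a|) (Ici 0)
    rw [← this]
    simp
  rw [two_mul, ← setLIntegral_univ, ← Iic_union_Ici (a := (0:ℝ))]
  refine (lintegral_union_le _ _ _).trans ?_
  rw [h2, h1]

def Wset (r B D β γ y0 : ℝ) : Set (ℝ × ℝ) :=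
  {p | (0 < |p.1| ∧ |p.1| ≤ r) ∧ |p.2 - y0| ≤ B * |p.1| * (D ^ β + |p.1| ^ γ)}

theorem Wset_meas (r B D β γ y0 : ℝ) : MeasurableSet (Wset r B D β γ y0) := by
  have m1 : MeasurableSet {p : ℝ × ℝ | 0 < |p.1|} := measurableSet_lt measurable_const (by fun_prop)
  have m2 : MeasurableSet {p : ℝ × ℝ | |p.1| ≤ r} := measurableSet_le (by fun_prop) measurable_const
  have m3 : MeasurableSet {p : ℝ × ℝ | |p.2 - y0| ≤ B * |p.1| * (D ^ β + |p.1| ^ γ)} :=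
    measurableSet_le (by fun_prop) (by fun_prop)
  exact (m1.inter m2).inter m3

theorem W_int {β γ r B D y0 : ℝ} (hβ0 : 0 < β) (hβ : β < 1) (hγ : β < γ) (hr : 0 < r) (hB : 0 ≤ B) (hD : 0 ≤ D) :
    ∫⁻ p in Wset r B D β γ y0, ENNReal.ofReal (|p.1| ^ (-(1 + β)) / (|p.1| + D))
      ≤ ENNReal.ofReal (4 * B * (1 / (1 - β) + 1 / β + r ^ (γ - β) / (γ - β))) := by
  have hm := Wset_meas r B D β γ y0
  set G : ℝ → ENNReal := fun a => (Ioc 0 r).indicator (fun a => ENNReal.ofReal (a ^ (-(1 + β)) / (a + D)) *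
    ENNReal.ofReal (2 * (B * a * (D ^ β + a ^ γ)))) a with hG
  have hb : 0 < 1 - β := by linarith
  have hg : 0 < γ - β := by linarith
  calc ∫⁻ p in Wset r B D β γ y0, ENNReal.ofReal (|p.1| ^ (-(1 + β)) / (|p.1| + D))
      = ∫⁻ p, (Wset r B D β γ y0).indicator (fun p => ENNReal.ofReal (|p.1| ^ (-(1 + β)) / (|p.1| + D))) p := by
        rw [lintegral_indicator hm]
    _ = ∫⁻ a, ∫⁻ h, (Wset r B D β γ y0).indicator (fun p => ENNReal.ofReal (|p.1| ^ (-(1 + β)) / (|p.1| + D))) (a, h) := by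
        rw [Measure.volume_eq_prod, lintegral_prod]
        exact (Measurable.indicator (by fun_prop) hm).aemeasurable
    _ = ∫⁻ a, G |a| := by
        refine lintegral_congr fun a => ?_
        by_cases ha : |a| ∈ Ioc 0 r
        · simp only [hG, Set.indicator_of_mem ha]
          have e : ∀ h, (Wset r B D β γ y0).indicator (fun p => ENNReal.ofReal (|p.1| ^ (-(1 + β)) / (|p.1| + D))) (a, h)
              = (Metric.closedBall y0 (B * |a| * (D ^ β + |a| ^ γ))).indicator (fun _ => ENNReal.ofReal (|a| ^ (-(1 + β)) / (|a| + D))) h := by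
            intro h
            by_cases hh : |h - y0| ≤ B * |a| * (D ^ β + |a| ^ γ)
            · rw [Set.indicator_of_mem (show (a, h) ∈ Wset r B D β γ y0 from ⟨ha, hh⟩),
                Set.indicator_of_mem (by rw [Metric.mem_closedBall, Real.dist_eq]; exact hh)]
            · rw [Set.indicator_of_notMem (fun hc : (a, h) ∈ Wset r B D β γ y0 => hh hc.2),
                Set.indicator_of_notMem (by rw [Metric.mem_closedBall, Real.dist_eq]; exact hh)]
          simp_rw [e]
          rw [lintegral_indicator Metric.isClosed_closedBall.measurableSet, setLIntegral_const, Real.volume_closedBall]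
        · simp only [hG, Set.indicator_of_notMem ha]
          have e : ∀ h, (Wset r B D β γ y0).indicator (fun p => ENNReal.ofReal (|p.1| ^ (-(1 + β)) / (|p.1| + D))) (a, h) = 0 :=
            fun h => Set.indicator_of_notMem (fun hc : (a, h) ∈ Wset r B D β γ y0 => ha hc.1) _
          simp_rw [e]; simp
    _ ≤ 2 * ∫⁻ a in Ici 0, G a := lint_abs G
    _ = 2 * ∫⁻ a in Ioi 0, G a := by rw [setLIntegral_congr Ioi_ae_eq_Ici.symm]
    _ ≤ 2 * ∫⁻ a in Ioi 0, ENNReal.ofReal (2 * B) * (ENNReal.ofReal (D ^ β * a ^ (-β) / (a + D)) +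
          (Ioc 0 r).indicator (fun a => ENNReal.ofReal (a ^ (γ - β - 1))) a) := by
        gcongr 2 * ?_
        refine setLIntegral_mono' measurableSet_Ioi fun a ha => ?_
        have ha : 0 < a := ha
        by_cases har : a ∈ Ioc 0 r
        · simp only [hG, Set.indicator_of_mem har]
          rw [← ENNReal.ofReal_mul (by positivity), ← ENNReal.ofReal_add (by positivity) (by positivity),
            ← ENNReal.ofReal_mul (by positivity)]
          refine ENNReal.ofReal_le_ofReal ?_
          have e1 : a ^ (-(1 + β)) = a ^ (-β) / a := by
            rw [show -(1 + β) = -β - 1 by ring, Real.rpow_sub_one ha.ne']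
          have e2 : a ^ (γ - β - 1) = a ^ (-β) * a ^ γ / a := by
            rw [Real.rpow_sub_one ha.ne', ← Real.rpow_add ha]; congr 2; ring
          have hl : a ^ (-β) / a / (a + D) * (2 * (B * a * (D ^ β + a ^ γ))) =
            2 * B * (D ^ β * a ^ (-β) / (a + D) + a ^ (-β) * a ^ γ / (a + D)) := by field_simp
          rw [e1, e2, hl]
          gcongr
          linarith
        · simp only [hG, Set.indicator_of_notMem har]
          positivity
    _ ≤ 2 * (ENNReal.ofReal (2 * B) * (ENNReal.ofReal (1 / (1 - β) + 1 / β) + ENNReal.ofReal (r ^ (γ - β) / (γ - β)))) := by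
        rw [lintegral_const_mul' _ _ ENNReal.ofReal_ne_top, lintegral_add_left (by fun_prop)]
        gcongr 2 * (_ * (?_ + ?_))
        · exact J2 hβ0 hβ hD
        · rw [setLIntegral_indicator measurableSet_Ioc, inter_eq_left.mpr (fun a ha => ha.1), J1 hg hr.le]
    _ = _ := by
        rw [← ENNReal.ofReal_add (by positivity) (by positivity), ← ENNReal.ofReal_mul (by positivity),
          show (2:ENNReal) = ENNReal.ofReal 2 by simp, ← ENNReal.ofReal_mul (by norm_num)]
        congr 1; ring
end

section
open Real Set Filter MeasureTheory

theorem hit_frontier {E : Set R2} (hE : IsOpen E) {g : ℝ → R2} (hg : Continuous g) {a b : ℝ} (ha : g a ∈ E) (hb : g b ∉ E) :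
    ∃ s ∈ uIcc a b, g s ∈ frontier E := by
  by_contra hc
  push Not at hc
  have hp : IsPreconnected (g '' uIcc a b) := isPreconnected_uIcc.image _ hg.continuousOn
  have h1 : g '' uIcc a b ⊆ E ∪ (closure E)ᶜ := by
    rintro _ ⟨s, hs, rfl⟩
    by_contra hn
    simp only [mem_union, mem_compl_iff, not_or, not_not] at hn
    refine hc s hs ?_
    rw [hE.frontier_eq]
    exact ⟨hn.2, hn.1⟩
  have h2 := hp.subset_left_of_subset_union hE isClosed_closure.isOpen_compl
    (Set.disjoint_left.mpr fun w hw hw2 => hw2 (subset_closure hw)) h1 ⟨g a, ⟨a, left_mem_uIcc, rfl⟩, ha⟩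
  exact hb (h2 ⟨b, right_mem_uIcc, rfl⟩)

theorem sub_ballM {E : Set R2} (hE : IsOpen E) (hb : Bornology.IsBounded E) {M : ℝ} (hM : ∀ p ∈ frontier E, ‖p‖ ≤ M) :
    E ⊆ Metric.closedBall 0 M := by
  intro w hw
  rw [mem_closedBall_zero_iff]
  by_contra hlt
  push Not at hlt
  rcases eq_or_lt_of_le (norm_nonneg w) with h0 | h0
  · obtain ⟨R, hR⟩ := hb.subset_closedBall 0
    have hne : (frontier E).Nonempty := nonempty_frontier_iff.mpr ⟨⟨w, hw⟩, fun h => by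
      have h2 : mk2 (|R| + 1) 0 ∈ Metric.closedBall (0:R2) R := hR (h ▸ mem_univ _)
      rw [mem_closedBall_zero_iff] at h2
      have h3 := abs_coord_le (mk2 (|R| + 1) 0) 0
      rw [mk2_0] at h3
      have := le_abs_self (|R| + 1); have := le_abs_self R; linarith⟩
    obtain ⟨p, hp⟩ := hne
    have := hM p hp; have := norm_nonneg p; linarith
  obtain ⟨R, hR⟩ := hb.subset_closedBall 0
  set b := (|R| + 1) / ‖w‖ + 1
  have hb1 : (1:ℝ) ≤ b := by have : 0 ≤ (|R| + 1) / ‖w‖ := by positivity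
                             linarith
  have hbn : b • w ∉ E := by
    intro h
    have h2 := hR h
    rw [mem_closedBall_zero_iff, norm_smul, Real.norm_eq_abs, abs_of_nonneg (by linarith)] at h2
    have : b * ‖w‖ = |R| + 1 + ‖w‖ := by simp only [b]; field_simp
    have := le_abs_self R; linarith
  obtain ⟨s, hs, hf⟩ := hit_frontier hE (g := fun s => s • w) (by fun_prop) (a := 1) (b := b) (by simpa using hw) hbn
  rw [uIcc_of_le hb1] at hs
  have := hM _ hf
  rw [norm_smul, Real.norm_eq_abs, abs_of_nonneg (by linarith [hs.1])] at this
  nlinarith [hs.1]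

theorem odd_int {f : ℝ × ℝ → ℝ} (hodd : ∀ a h, f (-a, h) = - f (a, h)) {S : Set (ℝ × ℝ)} (hS : MeasurableSet S)
    (hf : IntegrableOn f S) :
    ‖∫ p in S, f p‖ₑ ≤ ∫⁻ p in S \ (fun p : ℝ × ℝ => (-p.1, p.2)) ⁻¹' S, ‖f p‖ₑ := by
  set τ : ℝ × ℝ → ℝ × ℝ := fun p => (-p.1, p.2) with hτ
  have hmp : MeasurePreserving τ volume volume :=
    (Measure.measurePreserving_neg (volume : Measure ℝ)).prod (MeasurePreserving.id (volume : Measure ℝ))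
  have hemb : MeasurableEmbedding τ :=
    ((MeasurableEquiv.neg ℝ).prodCongr (MeasurableEquiv.refl ℝ)).measurableEmbedding
  have hτS : MeasurableSet (τ ⁻¹' S) := hemb.measurable hS
  have h0 : ∫ p in S ∩ τ ⁻¹' S, f p = 0 := by
    have h1 := hmp.setIntegral_preimage_emb hemb f (S ∩ τ ⁻¹' S)
    have e : τ ⁻¹' (S ∩ τ ⁻¹' S) = S ∩ τ ⁻¹' S := by
      rw [preimage_inter, ← preimage_comp, inter_comm]
      congr 1
      have : τ ∘ τ = id := by ext p <;> simp [hτ]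
      rw [this]; rfl
    rw [e] at h1
    have h2 : ∀ p, f (τ p) = - f p := fun p => hodd p.1 p.2
    simp_rw [h2] at h1
    rw [integral_neg] at h1
    linarith
  rw [← integral_inter_add_sdiff hτS hf, h0, zero_add]
  exact enorm_integral_le_lintegral_enorm _

theorem arc_est {M γ c c0 β K r lam l : ℝ} {ζ : ℝ → R2} (hz : Crv M γ c ζ) (hc0 : 0 < c0) (hc : c0 ≤ c) (hβ0 : 0 < β) (hK : 0 ≤ K)
    (hr : 0 < r) (hlam : 0 < lam) (h1 : K * r ^ β ≤ c0 / 8) (h2 : M * lam ^ γ ≤ c0 / 8) {x n : R2} (hn : ‖n‖ = 1)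
    (hT : ∀ σ, |dt (deriv ζ σ) n| ≤ K * ‖x - ζ σ‖ ^ β) :
    ∃ Y D : ℝ, 0 ≤ D ∧ ∀ a h P σ : ℝ, σ ∈ Icc l (l + lam) → P ≤ r → 0 < a → a ≤ P → |h| ≤ P → ‖x - ζ σ‖ ≤ P →
      dt (ζ σ - x) n = h → |dt (ζ σ - x) (perp n)| ≤ a →
      a + D ≤ 5 * P ∧ |h - Y| ≤ (4 / c0 * (K + M * (4 / c0) ^ γ)) * a * (D ^ β + a ^ γ) := by
  obtain ⟨s, hs, hmin⟩ := (isCompact_Icc (a := l) (b := l + lam)).exists_isMinOn ⟨l, by constructor <;> linarith⟩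
    (f := fun σ => |dt (ζ σ - x) (perp n)|) (by have := hz.cont; fun_prop)
  refine ⟨dt (ζ s - x) n, ‖x - ζ s‖, norm_nonneg _, fun a h P σ hσ hP ha haP hhP hσP hh hX => ?_⟩
  have hM := hz.M1
  have hγ := hz.g0
  have hd : |σ - s| ≤ lam := by rw [abs_le]; constructor <;> linarith [hs.1, hs.2, hσ.1, hσ.2]
  have hXs : |dt (ζ s - x) (perp n)| ≤ |dt (ζ σ - x) (perp n)| := hmin hσ
  have hY' : |dt (deriv ζ σ) n| ≤ c0 / 8 := by
    refine (hT σ).trans (le_trans ?_ h1)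
    gcongr
    exact hσP.trans hP
  have hX' : 7 / 8 * c0 ≤ |dt (deriv ζ σ) (perp n)| := by
    have h3 := lagr (deriv ζ σ) n
    rw [hz.spd, hn, mul_one, crs_comm, neg_sq, ← dperp] at h3
    have h4 := abs_nonneg (dt (deriv ζ σ) (perp n))
    have h5 := sq_abs (dt (deriv ζ σ) (perp n))
    have h6 := sq_abs (dt (deriv ζ σ) n)
    have h7 := abs_nonneg (dt (deriv ζ σ) n)
    by_contra hlt
    push Not at hlt
    nlinarith
  have tay : ∀ p q : ℝ, |p - q| ≤ lam → ∀ m : R2, ‖m‖ = 1 → |dt (ζ p) m - dt (ζ q) m - (p - q) * dt (deriv ζ q) m| ≤ M * |p - q| ^ γ * |p - q| := by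
    intro p q _ m hm
    have := hz.taylor p q
    rw [← dt_smul_left, ← dt_sub_left, ← dt_sub_left]
    exact (abs_dt_le _ _).trans (by rwa [hm, mul_one])
  have hsm : M * |σ - s| ^ γ ≤ c0 / 8 := by
    refine le_trans ?_ h2
    gcongr
  have hnp : ‖perp n‖ = 1 := by rw [norm_perp, hn]
  have t1 := tay s σ (by rwa [abs_sub_comm]) (perp n) hnp
  have t2 := tay s σ (by rwa [abs_sub_comm]) n hn
  have t3 := tay σ s hd n hn
  rw [abs_sub_comm s σ] at t1 t2
  rw [dt_sub_left] at hXs hX hh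
  rw [dt_sub_left] at hXs
  have hu : 0 ≤ |σ - s| := abs_nonneg _
  have hm1 : M * |σ - s| ^ γ * |σ - s| ≤ c0 / 8 * |σ - s| := by gcongr
  have hσs : |σ - s| ≤ 4 / c0 * a := by
    have k1 : |(s - σ) * dt (deriv ζ σ) (perp n)| = |σ - s| * |dt (deriv ζ σ) (perp n)| := by rw [abs_mul, abs_sub_comm]
    have k2 : 7 / 8 * c0 * |σ - s| ≤ |(s - σ) * dt (deriv ζ σ) (perp n)| := by rw [k1, mul_comm]; gcongr
    have k3 : 3 / 4 * c0 * |σ - s| ≤ 2 * a := by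
      have := abs_sub_abs_le_abs_sub ((s - σ) * dt (deriv ζ σ) (perp n)) (dt (ζ s) (perp n) - dt (ζ σ) (perp n))
      rw [abs_sub_comm ((s - σ) * dt (deriv ζ σ) (perp n))] at this
      have k4 : |dt (ζ s) (perp n) - dt (ζ σ) (perp n)| ≤ 2 * a := by
        have k5 := abs_le.mp (hXs.trans hX)
        have k6 := abs_le.mp hX
        rw [abs_le]
        constructor <;> linarith
      linarith
    rw [div_mul_eq_mul_div, le_div_iff₀ hc0]
    nlinarith
  have hYY : |dt (ζ s - x) n - h| ≤ a := by
    rw [dt_sub_left, ← hh]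
    have k1 : |(s - σ) * dt (deriv ζ σ) n| ≤ |σ - s| * (c0 / 8) := by rw [abs_mul, abs_sub_comm]; gcongr
    have k2 : |σ - s| * (c0 / 4) ≤ a := by
      calc _ ≤ 4 / c0 * a * (c0 / 4) := by gcongr
        _ = a := by field_simp
    rw [abs_le] at *
    constructor <;> linarith
  constructor
  · have hD : ‖x - ζ s‖ ≤ 3 * P := by
      have h3 := lagr (ζ s - x) n
      rw [hn, mul_one] at h3
      have e : crs (ζ s - x) n = - dt (ζ s - x) (perp n) := by simp [dt, crs]; ring
      rw [e, neg_sq] at h3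
      rw [norm_sub_rev]
      have p1 : |dt (ζ s - x) (perp n)| ≤ P := by rw [dt_sub_left]; linarith
      have p2 : |dt (ζ s - x) n| ≤ 2 * P := by
        rw [abs_le] at *; constructor <;> linarith
      refine abs_le_of_sq_le_sq' ?_ (by linarith) |>.2
      rw [← h3]
      nlinarith [sq_abs (dt (ζ s - x) (perp n)), sq_abs (dt (ζ s - x) n), abs_nonneg (dt (ζ s - x) (perp n)), abs_nonneg (dt (ζ s - x) n)]
    linarith
  · have k0 : h - dt (ζ s - x) n = dt (ζ σ) n - dt (ζ s) n := by rw [← hh, dt_sub_left]; ring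
    have k1 : |(σ - s) * dt (deriv ζ s) n| ≤ 4 / c0 * a * (K * ‖x - ζ s‖ ^ β) := by
      rw [abs_mul]; gcongr; exact hT s
    have k2 : M * |σ - s| ^ γ * |σ - s| ≤ M * ((4 / c0) ^ γ * a ^ γ) * (4 / c0 * a) := by
      rw [← Real.mul_rpow (by positivity) ha.le]
      gcongr
    rw [k0]
    have k3 : |dt (ζ σ) n - dt (ζ s) n| ≤ 4 / c0 * a * (K * ‖x - ζ s‖ ^ β) + M * ((4 / c0) ^ γ * a ^ γ) * (4 / c0 * a) := by
      rw [abs_le] at *; constructor <;> linarith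
    refine k3.trans ?_
    have e1 : 0 ≤ 4 / c0 * a * K * a ^ γ := by positivity
    have e2 : 0 ≤ 4 / c0 * a * (M * (4 / c0) ^ γ) * ‖x - ζ s‖ ^ β := by positivity
    have e3 : 4 / c0 * (K + M * (4 / c0) ^ γ) * a * (‖x - ζ s‖ ^ β + a ^ γ) =
      4 / c0 * a * (K * ‖x - ζ s‖ ^ β) + M * ((4 / c0) ^ γ * a ^ γ) * (4 / c0 * a) + 4 / c0 * a * K * a ^ γ +
      4 / c0 * a * (M * (4 / c0) ^ γ) * ‖x - ζ s‖ ^ β := by ring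
    linarith
end

section
open Real Set Filter MeasureTheory

def rotE (n : R2) (hn : ‖n‖ = 1) : R2 ≃ₗᵢ[ℝ] R2 where
  toFun := fun v => v 0 • perp n + v 1 • n
  invFun := fun w => mk2 (dt w (perp n)) (dt w n)
  left_inv := fun v => by
    have h := nsq n
    rw [hn] at h
    apply R2_ext
    · simp [dt]; linear_combination (-v 0) * h
    · simp [dt]; linear_combination (-v 1) * h
  right_inv := fun w => by
    have h := nsq n
    rw [hn] at h
    apply R2_ext
    · simp [dt]; linear_combination (-w 0) * h
    · simp [dt]; linear_combination (-w 1) * h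
  map_add' := fun x y => by apply R2_ext <;> simp <;> ring
  map_smul' := fun r x => by apply R2_ext <;> simp <;> ring
  norm_map' := fun x => by
    have h := nsq n
    rw [hn] at h
    have h2 : ‖x 0 • perp n + x 1 • n‖ ^ 2 = ‖x‖ ^ 2 := by
      rw [nsq, nsq]; simp; linear_combination (-(x 0 ^ 2 + x 1 ^ 2)) * h
    exact (pow_left_inj₀ (norm_nonneg _) (norm_nonneg _) two_ne_zero).mp h2

def Psi (x n : R2) (p : ℝ × ℝ) : R2 := x + (p.1 • perp n + p.2 • n)

theorem Psi_mp (x : R2) {n : R2} (hn : ‖n‖ = 1) : MeasurePreserving (Psi x n) volume volume ∧ MeasurableEmbedding (Psi x n) := by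
  have a1 : MeasurePreserving (MeasurableEquiv.finTwoArrow (α := ℝ)).symm volume volume :=
    (volume_preserving_finTwoArrow ℝ).symm _
  have a2 : MeasurePreserving (MeasurableEquiv.toLp 2 (Fin 2 → ℝ)) volume volume := PiLp.volume_preserving_toLp (Fin 2)
  have a3 := (rotE n hn).measurePreserving
  have a4 := measurePreserving_add_left (volume : Measure R2) x
  have e : Psi x n = (fun v => x + v) ∘ (rotE n hn) ∘ (MeasurableEquiv.toLp 2 (Fin 2 → ℝ)) ∘ (MeasurableEquiv.finTwoArrow (α := ℝ)).symm := by
    funext p; rfl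
  rw [e]
  refine ⟨a4.comp (a3.comp (a2.comp a1)), ?_⟩
  exact (Homeomorph.addLeft x).measurableEmbedding.comp ((rotE n hn).toHomeomorph.measurableEmbedding.comp
    ((MeasurableEquiv.measurableEmbedding _).comp (MeasurableEquiv.measurableEmbedding _)))

theorem dt_Psi {x n : R2} (hn : ‖n‖ = 1) (a h : ℝ) : dt (Psi x n (a, h) - x) n = h ∧ dt (Psi x n (a, h) - x) (perp n) = a := by
  have h1 := nsq n
  rw [hn] at h1
  constructor
  · simp [Psi, dt]; linear_combination (-h) * h1
  · simp [Psi, dt]; linear_combination (-a) * h1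

theorem norm_decomp {n : R2} (hn : ‖n‖ = 1) (w : R2) : ‖w‖ ^ 2 = dt w (perp n) ^ 2 + dt w n ^ 2 := by
  have := lagr w n
  rw [hn, mul_one, crs_comm, neg_sq, ← dperp] at this
  exact this.symm

theorem dt_kern {α : ℝ} {n : R2} (w : R2) : dt (kern α w) n = ‖w‖ ^ (-(2 + 2 * α)) * (- dt w (perp n)) := by
  unfold kern
  rw [dt_smul_left, Real.rpow_neg (norm_nonneg _)]
  congr 1
  simp [dt]

def ff (α : ℝ) (x y n : R2) (p : ℝ × ℝ) : ℝ :=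
  p.1 * (‖x - Psi x n p‖ ^ (-(2 + 2 * α)) - ‖y - Psi x n p‖ ^ (-(2 + 2 * α)))

theorem dt_zero_kern {x y n : R2} {δ : ℝ} (hn : ‖n‖ = 1) (hxy : x - y = δ • n) (α a h : ℝ) :
    dt (kern α (x - Psi x n (a, h)) - kern α (y - Psi x n (a, h))) n = ff α x y n (a, h) := by
  rw [dt_sub_left, dt_kern, dt_kern]
  have e1 : dt (x - Psi x n (a, h)) (perp n) = -a := by
    have := (dt_Psi (x := x) hn a h).2
    rw [dt_sub_left] at this ⊢; linarith
  have e2 : dt (y - Psi x n (a, h)) (perp n) = -a := by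
    have h0 : dt (x - y) (perp n) = 0 := by rw [hxy]; simp [dt]; ring
    rw [dt_sub_left] at h0 e1 ⊢; linarith
  rw [e1, e2, ff]; ring

theorem ff_facts {x y n : R2} {δ : ℝ} (hn : ‖n‖ = 1) (hδ : 0 < δ) (hxy : x - y = δ • n) (a h : ℝ) :
    ‖x - Psi x n (a, h)‖ ^ 2 = a ^ 2 + h ^ 2 ∧ ‖y - Psi x n (a, h)‖ ^ 2 = a ^ 2 + (h + δ) ^ 2 ∧
    |‖x - Psi x n (a, h)‖ - ‖y - Psi x n (a, h)‖| ≤ δ := by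
  obtain ⟨h1, h2⟩ := dt_Psi (x := x) hn a h
  have h3 : dt (x - y) (perp n) = 0 := by rw [hxy]; simp [dt]; ring
  have h4 : dt (x - y) n = δ := by rw [hxy, dt_smul_left, dt_self, hn]; ring
  rw [dt_sub_left] at h1 h2 h3 h4
  refine ⟨?_, ?_, ?_⟩
  · rw [norm_decomp hn, dt_sub_left, dt_sub_left,
      show dt x (perp n) - dt (Psi x n (a, h)) (perp n) = -a by linarith, show dt x n - dt (Psi x n (a, h)) n = -h by linarith]; ring
  · rw [norm_decomp hn, dt_sub_left, dt_sub_left,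
      show dt y (perp n) - dt (Psi x n (a, h)) (perp n) = -a by linarith, show dt y n - dt (Psi x n (a, h)) n = -(h + δ) by linarith]; ring
  · refine (abs_norm_sub_norm_le _ _).trans ?_
    rw [sub_sub_sub_cancel_right, hxy, norm_smul, hn, mul_one, Real.norm_eq_abs, abs_of_pos hδ]

theorem ff_odd {x y n : R2} {δ : ℝ} (hn : ‖n‖ = 1) (hδ : 0 < δ) (hxy : x - y = δ • n) (α a h : ℝ) :
    ff α x y n (-a, h) = - ff α x y n (a, h) := by
  obtain ⟨h1, h2, _⟩ := ff_facts hn hδ hxy a h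
  obtain ⟨h3, h4, _⟩ := ff_facts hn hδ hxy (-a) h
  rw [neg_sq, ← h1] at h3
  rw [neg_sq, ← h2] at h4
  rw [pow_left_inj₀ (norm_nonneg _) (norm_nonneg _) two_ne_zero] at h3 h4
  unfold ff
  rw [h3, h4]; ring

theorem vel_lint {α : ℝ} (hα : α ≤ 1 / 4) {E : Set R2} (hE : IsOpen E) (hb : Bornology.IsBounded E)
    {x y n : R2} {δ : ℝ} (hn : ‖n‖ = 1) (hδ : 0 < δ) (hxy : x - y = δ • n) :
    ENNReal.ofReal |dt (Vv α E x - Vv α E y) n| ≤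
      ∫⁻ p in Psi x n ⁻¹' E \ (fun p : ℝ × ℝ => (-p.1, p.2)) ⁻¹' (Psi x n ⁻¹' E), ENNReal.ofReal |ff α x y n p| := by
  obtain ⟨hmp, hemb⟩ := Psi_mp x hn
  have hi : IntegrableOn (fun w => kern α (x - w) - kern α (y - w)) E := (kern_int hα x hb).sub (kern_int hα y hb)
  have e0 : Vv α E x - Vv α E y = ∫ w in E, (kern α (x - w) - kern α (y - w)) := by
    unfold Vv; rw [integral_sub (kern_int hα x hb) (kern_int hα y hb)]
  let L : R2 →L[ℝ] ℝ := innerSL ℝ n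
  have hL : ∀ w, L w = dt w n := by
    intro w
    simp [L, dt, PiLp.inner_apply, Fin.sum_univ_two]
  have e1 : dt (Vv α E x - Vv α E y) n = ∫ w in E, dt (kern α (x - w) - kern α (y - w)) n := by
    rw [e0, ← hL, ← L.integral_comp_comm hi]
    simp_rw [hL]
  have hi2 : IntegrableOn (fun w => dt (kern α (x - w) - kern α (y - w)) n) E := by
    have := L.integrable_comp hi
    simp_rw [hL] at this
    exact this
  have e2 := hmp.setIntegral_preimage_emb hemb (fun w => dt (kern α (x - w) - kern α (y - w)) n) E
  have hi3 := (hmp.integrableOn_comp_preimage hemb (f := fun w => dt (kern α (x - w) - kern α (y - w)) n) (s := E)).mpr hi2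
  have e3 : (fun p => dt (kern α (x - Psi x n p) - kern α (y - Psi x n p)) n) = ff α x y n := by
    funext p; exact dt_zero_kern hn hxy α p.1 p.2
  have hi4 : IntegrableOn (ff α x y n) (Psi x n ⁻¹' E) := by rw [← e3]; exact hi3
  have h := odd_int (fun a h => ff_odd hn hδ hxy α a h) (hemb.measurable hE.measurableSet) hi4
  rw [e1, ← e2]
  simp only [enorm_eq_ofReal_abs] at h
  rw [← e3] at h ⊢
  exact h

set_option maxHeartbeats 1600000 in
theorem vel_est {α γ M c0 K : ℝ} (hα0 : 0 < α) (hα : α ≤ 1 / 4) (hγ : 2 * α < γ) (hM : 1 ≤ M) (hc0 : 0 < c0) (hK : 0 < K) :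
    ∃ C d : ℝ, 0 < C ∧ 0 < d ∧ ∀ (E : Set R2) (ζ : ℝ → R2) (c : ℝ) (x y n : R2) (δ : ℝ), IsOpen E → Bornology.IsBounded E → frontier E = range ζ →
      Crv M γ c ζ → c0 ≤ c → ‖n‖ = 1 → 0 < δ → δ ≤ d → x - y = δ • n →
      (∀ σ, |dt (deriv ζ σ) n| ≤ K * ‖x - ζ σ‖ ^ (2 * α)) → |dt (Vv α E x - Vv α E y) n| ≤ C * δ := by
  have hβ0 : 0 < 2 * α := by linarith
  obtain ⟨r, hr, hr1, hrK⟩ : ∃ r, 0 < r ∧ r ≤ 1 ∧ (K + 1) * r ^ (2 * α) ≤ c0 / 8 := Crv.exists_r hβ0 (by linarith) (by positivity)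
  obtain ⟨l0, hl0, hl1, hlM⟩ : ∃ r, 0 < r ∧ r ≤ 1 ∧ M * r ^ γ ≤ c0 / 8 := Crv.exists_r (by linarith) hM (by positivity)
  obtain ⟨m, hm⟩ := exists_nat_gt (2 * π / l0)
  have hm0 : (0:ℝ) < m := lt_trans (by positivity) hm
  set lam := 2 * π / m with hlam
  have hlam0 : 0 < lam := by positivity
  have hlaml : lam ≤ l0 := by rw [hlam, div_le_iff₀ hm0]; rw [div_lt_iff₀ hl0] at hm; linarith
  have hlam2 : M * lam ^ γ ≤ c0 / 8 := le_trans (by gcongr; linarith) hlM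
  have hrK2 : K * r ^ (2 * α) ≤ c0 / 8 := le_trans (by gcongr; linarith) hrK
  set B := 4 / c0 * (K + M * (4 / c0) ^ γ) with hB
  have hB0 : 0 < B := by positivity
  set C1 := 3 * (r / 2) ^ (-(2 + 2 * α)) with hC1
  set C2 := 4 * B * (1 / (1 - 2 * α) + 1 / (2 * α) + r ^ (γ - 2 * α) / (γ - 2 * α)) with hC2
  have hb1 : 0 < 1 - 2 * α := by linarith
  have hb2 : 0 < γ - 2 * α := by linarith
  have hC20 : 0 < C2 := by positivity
  have hC10 : 0 < C1 := by positivity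
  set V := (volume (Metric.closedBall (0:R2) M)).toReal with hV
  have hVt : volume (Metric.closedBall (0:R2) M) ≠ ⊤ := measure_closedBall_lt_top.ne
  refine ⟨C1 * V + m * (20 * C2), r / 2, by positivity, by positivity, fun E ζ c x y n δ hE hEb hfr hz hc hn hδ hδd hxy hT => ?_⟩
  choose Y D hD0 hYD using fun i : ℕ => arc_est (l := lam * i) hz hc0 hc hβ0 hK.le hr hlam0 hrK2 hlam2 hn hT
  obtain ⟨hmp, hemb⟩ := Psi_mp x hn
  set E' := Psi x n ⁻¹' E with hE'
  have hE'm : MeasurableSet E' := hemb.measurable hE.measurableSet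
  set S := E' \ (fun p : ℝ × ℝ => (-p.1, p.2)) ⁻¹' E' with hS
  have hSm : MeasurableSet S := hE'm.diff ((by fun_prop : Measurable (fun p : ℝ × ℝ => (-p.1, p.2))) hE'm)
  set G : ℕ → ℝ × ℝ → ENNReal := fun i p => ENNReal.ofReal (20 * δ) * ENNReal.ofReal (|p.1| ^ (-(1 + 2 * α)) / (|p.1| + D i)) with hG
  set W : ℕ → Set (ℝ × ℝ) := fun i => Wset r B (D i) (2 * α) γ (Y i) with hW
  have hWm : ∀ i, MeasurableSet (W i) := fun i => Wset_meas _ _ _ _ _ _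
  have key : ∀ p ∈ S, ENNReal.ofReal |ff α x y n p| ≤ ENNReal.ofReal (C1 * δ) + ∑ i ∈ Finset.range m, (W i).indicator (G i) p := by
    rintro ⟨a, h⟩ ⟨hp1, hp2⟩
    have hp1 : Psi x n (a, h) ∈ E := hp1
    have hp2 : Psi x n (-a, h) ∉ E := hp2
    obtain ⟨f1, f2, f3⟩ := ff_facts hn hδ hxy a h
    set P := ‖x - Psi x n (a, h)‖ with hP
    set Q := ‖y - Psi x n (a, h)‖ with hQ
    have hP0 : 0 ≤ P := norm_nonneg _
    have hQ0 : 0 ≤ Q := norm_nonneg _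
    have haP : |a| ≤ P := abs_le_of_sq_le_sq (by rw [f1]; linarith [sq_nonneg h]) hP0
    have haQ : |a| ≤ Q := abs_le_of_sq_le_sq (by rw [f2]; linarith [sq_nonneg (h + δ)]) hQ0
    have hhP : |h| ≤ P := abs_le_of_sq_le_sq (by rw [f1]; linarith [sq_nonneg a]) hP0
    have hff : ff α x y n (a, h) = a * (P ^ (-(2 + 2 * α)) - Q ^ (-(2 + 2 * α))) := rfl
    rcases le_or_gt r P with hrP | hrP
    · refine le_trans (ENNReal.ofReal_le_ofReal ?_) le_self_add
      rw [hff]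
      exact KFfar hα0 hα (by positivity) haP haQ f3 (by linarith) (by have := abs_le.mp f3; linarith)
    · have ha0 : 0 < |a| := by
        rw [abs_pos]; rintro rfl
        rw [neg_zero] at hp2; exact hp2 hp1
      obtain ⟨s, hs, hsf⟩ := hit_frontier hE (g := fun s => Psi x n (s, h)) (by unfold Psi; fun_prop) hp1 hp2
      rw [hfr] at hsf
      obtain ⟨σ', hσ'⟩ := hsf
      obtain ⟨k, hk⟩ := Crv.reduce σ'
      set σ := σ' + 2 * π * k with hσ
      have hσz : ζ σ = Psi x n (s, h) := by rw [hσ, hz.zk, hσ']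
      have hsa : |s| ≤ |a| := by
        rcases le_total 0 a with h0 | h0
        · rw [uIcc_of_ge (by linarith)] at hs
          rw [abs_of_nonneg h0, abs_le]; exact hs
        · rw [uIcc_of_le (by linarith)] at hs
          rw [abs_of_nonpos h0, abs_le, neg_neg]; exact hs
      obtain ⟨i, hi, hiσ⟩ : ∃ i ∈ Finset.range m, σ ∈ Icc (lam * i) (lam * i + lam) := by
        rcases eq_or_lt_of_le hk.2 with he | he
        · refine ⟨m - 1, Finset.mem_range.mpr (by have : 0 < m := by exact_mod_cast hm0
                                                  omega), ?_⟩
          have h1 : 1 ≤ m := by exact_mod_cast hm0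
          rw [he, Nat.cast_sub h1, Nat.cast_one]
          have : lam * m = 2 * π := by rw [hlam]; field_simp
          constructor <;> nlinarith
        · have hq : 0 ≤ σ / lam := by have := hk.1; positivity
          refine ⟨⌊σ / lam⌋₊, Finset.mem_range.mpr ?_, ?_⟩
          · rw [Nat.floor_lt hq, div_lt_iff₀ hlam0, hlam]
            have : (m:ℝ) * (2 * π / m) = 2 * π := by field_simp
            rw [this]; exact he
          · have h1 := Nat.floor_le hq
            have h2 := Nat.lt_floor_add_one (σ / lam)
            rw [le_div_iff₀ hlam0] at h1
            rw [div_lt_iff₀ hlam0] at h2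
            constructor <;> nlinarith
      have g1 := (dt_Psi (x := x) hn s h)
      rw [← hσz] at g1
      have g2 : ‖x - ζ σ‖ ≤ P := by
        have := (ff_facts hn hδ hxy s h).1
        rw [← hσz] at this
        have h3 : s ^ 2 ≤ a ^ 2 := sq_le_sq.mpr hsa
        exact (sq_le_sq₀ (norm_nonneg _) hP0).mp (by rw [this, f1]; linarith)
      obtain ⟨q1, q2⟩ := hYD i |a| h P σ hiσ hrP.le ha0 haP hhP g2 g1.1 (by rw [g1.2]; exact hsa)
      have hmem : ((a, h) : ℝ × ℝ) ∈ W i := ⟨⟨ha0, haP.trans hrP.le⟩, q2⟩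
      refine le_trans ?_ le_add_self
      refine le_trans ?_ (Finset.single_le_sum (f := fun i => (W i).indicator (G i) (a, h)) (fun _ _ => zero_le) hi)
      simp only [Set.indicator_of_mem hmem, hG]
      rw [← ENNReal.ofReal_mul (by positivity)]
      refine ENNReal.ofReal_le_ofReal ?_
      have := KF hα0 hα ha0 haP haQ f3 q1
      have hD := hD0 i
      rw [hff, abs_mul, mul_div_assoc', le_div_iff₀ (by positivity)]
      exact this
  have hfin : ENNReal.ofReal |dt (Vv α E x - Vv α E y) n| ≤ ENNReal.ofReal ((C1 * V + m * (20 * C2)) * δ) := by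
    calc _ ≤ ∫⁻ p in S, ENNReal.ofReal |ff α x y n p| := vel_lint hα hE hEb hn hδ hxy
      _ ≤ ∫⁻ p in S, (ENNReal.ofReal (C1 * δ) + ∑ i ∈ Finset.range m, (W i).indicator (G i) p) := setLIntegral_mono' hSm key
      _ = ENNReal.ofReal (C1 * δ) * volume S + ∫⁻ p in S, ∑ i ∈ Finset.range m, (W i).indicator (G i) p := by
          rw [lintegral_add_left measurable_const, setLIntegral_const]
      _ ≤ ENNReal.ofReal (C1 * δ) * ENNReal.ofReal V + ∫⁻ p, ∑ i ∈ Finset.range m, (W i).indicator (G i) p := by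
          gcongr
          · calc volume S ≤ volume E' := measure_mono sdiff_subset
              _ = volume E := hmp.measure_preimage_emb hemb E
              _ ≤ volume (Metric.closedBall (0:R2) M) := measure_mono (sub_ballM hE hEb (by
                  rw [hfr]; rintro _ ⟨σ, rfl⟩; exact hz.bd σ))
              _ = ENNReal.ofReal V := by rw [hV, ENNReal.ofReal_toReal hVt]
          · exact Measure.restrict_le_self
      _ = ENNReal.ofReal (C1 * δ) * ENNReal.ofReal V + ∑ i ∈ Finset.range m, ∫⁻ p in W i, G i p := by
          rw [lintegral_finsetSum _ (fun i _ => Measurable.indicator (by simp only [hG]; fun_prop) (hWm i))]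
          congr 1
          exact Finset.sum_congr rfl fun i _ => lintegral_indicator (hWm i) _
      _ ≤ ENNReal.ofReal (C1 * δ) * ENNReal.ofReal V + ∑ i ∈ Finset.range m, ENNReal.ofReal (20 * δ) * ENNReal.ofReal C2 := by
          gcongr with i _
          simp only [hG]
          rw [lintegral_const_mul' _ _ ENNReal.ofReal_ne_top]
          gcongr
          exact W_int hβ0 (by linarith) hγ hr hB0.le (hD0 i)
      _ = _ := by
          rw [Finset.sum_const, Finset.card_range, nsmul_eq_mul, ← ENNReal.ofReal_mul (by positivity), ← ENNReal.ofReal_mul (by positivity),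
            ← ENNReal.ofReal_natCast, ← ENNReal.ofReal_mul (by positivity), ← ENNReal.ofReal_add (by positivity) (by positivity)]
          congr 1; ring
  exact (ENNReal.ofReal_le_ofReal_iff (by positivity)).mp hfin
end

section
open Real Set Filter MeasureTheory

theorem Crv.refl {M γ c : ℝ} {z : ℝ → R2} (h : Crv M γ c z) :
    (∀ ξ, deriv (fun ξ => reflect (z ξ)) ξ = reflect (deriv z ξ)) ∧ Crv M γ c (fun ξ => reflect (z ξ)) := by
  have hd : ∀ ξ, HasDerivAt (fun ξ => reflect (z ξ)) (reflect (deriv z ξ)) ξ := fun ξ =>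
    (reflE.toContinuousLinearEquiv.toContinuousLinearMap.hasFDerivAt.comp_hasDerivAt ξ (h.der ξ) :)
  have hs : ∀ a b : R2, reflect a - reflect b = reflect (a - b) := fun a b => (map_sub reflE a b).symm
  refine ⟨fun ξ => (hd ξ).deriv, ?_⟩
  refine ⟨fun ξ => by rw [h.per], fun ξ η he => h.inj ξ η (reflE.injective he), fun ξ => by rw [(hd ξ).deriv]; exact hd ξ, h.cpos,
    fun ξ => by rw [(hd ξ).deriv, norm_reflect, h.spd], fun ξ => by rw [norm_reflect]; exact h.bd ξ, fun ξ η => ?_, h.g0, h.g1, h.M1, h.cM⟩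
  rw [(hd ξ).deriv, (hd η).deriv, hs, norm_reflect]
  exact h.hol ξ η

theorem dt_of_crs {v w e : R2} {c c0 A : ℝ} (he : ‖e‖ = 1) (hc0 : 0 < c0) (hc : c0 ≤ c) (hv : ‖v‖ = c) (hve : dt v e = 0) (h : |crs v w| ≤ A) :
    |dt w e| ≤ A / c0 := by
  have h1 := nsq e
  rw [he] at h1
  have h2 : crs v w = - (dt v (perp e) * dt w e) + dt v e * crs e w := by
    simp only [crs, dt, perp_0, perp_1]
    linear_combination (v 0 * w 1 - v 1 * w 0) * h1
  have h3 := norm_decomp he v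
  rw [hve, hv] at h3
  have h4 : |dt v (perp e)| = c := by
    rw [← abs_of_pos (hc0.trans_le hc), ← sq_eq_sq_iff_abs_eq_abs]; linarith
  rw [h2, hve, zero_mul, add_zero, abs_neg, abs_mul, h4] at h
  rw [le_div_iff₀ hc0]
  have := abs_nonneg (dt w e)
  nlinarith

theorem Cfg.vel {N : ℕ} {α γ M c0 cα : ℝ} (θ : Fin N → ℝ) (hα0 : 0 < α) (hα : α ≤ 1 / 4) (hγ : 2 * α < γ) (hβ : 2 * α * (1 + γ) = γ)
    (hM : 1 ≤ M) (hc0 : 0 < c0) :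
    ∃ C d : ℝ, 0 < C ∧ 0 < d ∧ ∀ (c : Fin N → ℝ) (Ω : Fin N → Set R2) (z : Fin N → ℝ → R2), Cfg M γ c Ω z → (∀ n, c0 ≤ c n) →
      ∀ (n : Fin N) (ξ : ℝ) (y e : R2) (δ : ℝ), ‖e‖ = 1 → 0 < δ → δ ≤ d → z n ξ - y = δ • e → dt (deriv (z n) ξ) e = 0 →
      |dt (gSQGvel α cα θ Ω (z n ξ) - gSQGvel α cα θ Ω y) e| ≤ C * δ := by
  obtain ⟨C, d, hC, hd, H⟩ := vel_est (K := 400 * M ^ 3 / c0) hα0 hα hγ hM hc0 (by positivity)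
  refine ⟨|cα| * (∑ n, |θ n| * (2 * C)) + 1, d, by positivity, hd, fun c Ω z cf hc n ξ y e δ he hδ hδd hxy hp => ?_⟩
  have h1 : ∀ j, |dt (Vv α (Ω j) (z n ξ) - Vv α (Ω j) y) e| ≤ C * δ := fun j =>
    H (Ω j) (z j) (c j) _ _ e δ (cf.opn j) (cf.bdd j) (cf.rng j).symm (cf.crv j) (hc j) he hδ hδd hxy fun σ => by
      rw [div_mul_eq_mul_div]
      exact dt_of_crs he hc0 (hc n) ((cf.crv n).spd ξ) hp (cf.tang hβ n j ξ σ)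
  have h2 : ∀ j, |dt (Vv α (reflect ⁻¹' (Ω j)) (z n ξ) - Vv α (reflect ⁻¹' (Ω j)) y) e| ≤ C * δ := fun j => by
    obtain ⟨hd1, hcr⟩ := (cf.crv j).refl
    refine H (reflect ⁻¹' (Ω j)) (fun ξ => reflect (z j ξ)) (c j) _ _ e δ ((cf.opn j).preimage continuous_reflect) (refl_bdd (cf.bdd j)) ?_
      hcr (hc j) he hδ hδd hxy fun σ => ?_
    · have := reflE.toHomeomorph.preimage_frontier (Ω j)
      rw [← cf.rng j] at this
      refine Eq.trans this.symm ?_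
      ext w
      constructor
      · rintro ⟨σ, hσ⟩
        refine ⟨σ, ?_⟩
        have hσ : z j σ = reflect w := hσ
        show reflect (z j σ) = w
        rw [hσ, reflect_reflect]
      · rintro ⟨σ, rfl⟩
        exact ⟨σ, (reflect_reflect _).symm⟩
    · rw [div_mul_eq_mul_div, hd1]
      exact dt_of_crs he hc0 (hc n) ((cf.crv n).spd ξ) hp (cf.tang' hβ n j ξ σ)
  have hsum : ∀ f : Fin N → R2, dt (∑ j, f j) e = ∑ j, dt (f j) e := by
    intro f
    simp only [dt, WithLp.ofLp_sum, Finset.sum_apply, Finset.sum_mul, Finset.sum_add_distrib]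
  rw [vel_eq hα θ cf.bdd, vel_eq hα θ cf.bdd, ← smul_sub, ← Finset.sum_sub_distrib, dt_smul_left, hsum, abs_mul]
  have h3 : |∑ j, dt (θ j • (Vv α (Ω j) (z n ξ) - Vv α (reflect ⁻¹' (Ω j)) (z n ξ)) - θ j • (Vv α (Ω j) y - Vv α (reflect ⁻¹' (Ω j)) y)) e|
      ≤ ∑ j, |θ j| * (2 * C) * δ := by
    refine (Finset.abs_sum_le_sum_abs _ _).trans (Finset.sum_le_sum fun j _ => ?_)
    rw [← smul_sub, dt_smul_left, abs_mul, mul_assoc]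
    gcongr
    rw [sub_sub_sub_comm, dt_sub_left]
    have k1 := abs_le.mp (h1 j)
    have k2 := abs_le.mp (h2 j)
    rw [abs_le]; constructor <;> linarith
  rw [← Finset.sum_mul] at h3
  calc _ ≤ |cα| * ((∑ j, |θ j| * (2 * C)) * δ) := by gcongr
    _ ≤ _ := by nlinarith
end

section
open Real Set Filter MeasureTheory

def Pr {N : ℕ} (r : ℝ) (n j : Fin N) (ξ η : ℝ) : Prop := n ≠ j ∨ r ≤ distT ξ η

theorem Cfg.exmin {N : ℕ} {M γ r : ℝ} {c : Fin N → ℝ} {Ω : Fin N → Set R2} {z : Fin N → ℝ → R2} (h : Cfg M γ c Ω z)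
    (hne : ∃ n j ξ η, Pr (N := N) r n j ξ η) :
    ∃ n j ξ η, Pr r n j ξ η ∧ ∀ n' j' ξ' η', Pr r n' j' ξ' η' → ‖z n ξ - z j η‖ ≤ ‖z n' ξ' - z j' η'‖ := by
  have red : ∀ n j ξ η, Pr r n j ξ η → ∃ ξ' ∈ Icc 0 (2 * π), ∃ η' ∈ Icc 0 (2 * π), Pr r n j ξ' η' ∧ z n ξ' = z n ξ ∧ z j η' = z j η := by
    intro n j ξ η hp
    obtain ⟨k, hk⟩ := Crv.reduce ξ
    obtain ⟨l, hl⟩ := Crv.reduce η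
    refine ⟨_, hk, _, hl, ?_, (h.crv n).zk _ _, (h.crv j).zk _ _⟩
    rcases hp with hp | hp
    · exact Or.inl hp
    · right
      refine hp.trans ?_
      obtain ⟨i, hi⟩ := distT_exists (ξ + 2 * π * k) (η + 2 * π * l)
      have := distT_le ξ η (k - l + i)
      rw [hi]
      refine this.trans (le_of_eq ?_)
      congr 1; push_cast; ring
  obtain ⟨S, hS⟩ : ∃ S : Set (Fin N × Fin N × ℝ × ℝ), S = {p | Pr r p.1 p.2.1 p.2.2.1 p.2.2.2} ∩
    univ ×ˢ univ ×ˢ Icc (0:ℝ) (2 * π) ×ˢ Icc (0:ℝ) (2 * π) := ⟨_, rfl⟩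
  have mS : ∀ n j ξ η, Pr r n j ξ η → ξ ∈ Icc 0 (2 * π) → η ∈ Icc 0 (2 * π) → (n, j, ξ, η) ∈ S := fun n j ξ η h1 h2 h3 => by
    rw [hS]; exact ⟨h1, mem_univ _, mem_univ _, h2, h3⟩
  have hcl : IsClosed {p : Fin N × Fin N × ℝ × ℝ | Pr r p.1 p.2.1 p.2.2.1 p.2.2.2} := by
    have h1 : IsClosed {p : Fin N × Fin N × ℝ × ℝ | p.1 ≠ p.2.1} :=
      (isClosed_discrete {q : Fin N × Fin N | q.1 ≠ q.2}).preimage (f := fun p : Fin N × Fin N × ℝ × ℝ => (p.1, p.2.1)) (by fun_prop)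
    have h2 : IsClosed {p : Fin N × Fin N × ℝ × ℝ | r ≤ distT p.2.2.1 p.2.2.2} :=
      isClosed_le continuous_const (distT_continuous.comp (f := fun p : Fin N × Fin N × ℝ × ℝ => p.2.2) (by fun_prop))
    exact h1.union h2
  have hK : IsCompact S := hS ▸ ((isCompact_univ.prod (isCompact_univ.prod (isCompact_Icc.prod isCompact_Icc))).inter_left hcl)
  have hne' : S.Nonempty := by
    obtain ⟨n, j, ξ, η, hp⟩ := hne
    obtain ⟨ξ', h1, η', h2, h3, _⟩ := red n j ξ η hp
    exact ⟨(n, j, ξ', η'), mS _ _ _ _ h3 h1 h2⟩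
  have hc : Continuous (fun p : Fin N × Fin N × ℝ × ℝ => ‖z p.1 p.2.2.1 - z p.2.1 p.2.2.2‖) := by
    rw [continuous_prod_of_discrete_left]; intro n
    rw [continuous_prod_of_discrete_left]; intro j
    have h1 := (h.crv n).cont
    have h2 := (h.crv j).cont
    exact ((h1.comp continuous_fst).sub (h2.comp continuous_snd)).norm
  obtain ⟨p, hm, hmin⟩ := hK.exists_isMinOn hne' hc.continuousOn
  obtain ⟨n, j, ξ, η⟩ := p
  have hm1 : Pr r n j ξ η := by rw [hS] at hm; exact hm.1
  refine ⟨n, j, ξ, η, hm1, fun n' j' ξ' η' hp => ?_⟩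
  obtain ⟨a, h1, b, h2, h3, h4, h5⟩ := red n' j' ξ' η' hp
  rw [← h4, ← h5]
  exact isMinOn_iff.mp hmin (n', j', a, b) (mS _ _ _ _ h3 h1 h2)

theorem inner_dt (a b : R2) : inner ℝ a b = dt a b := by
  simp [dt, PiLp.inner_apply, Fin.sum_univ_two]; ring

theorem Cfg.perp_min {N : ℕ} {M γ r : ℝ} {c : Fin N → ℝ} {Ω : Fin N → Set R2} {z : Fin N → ℝ → R2} (h : Cfg M γ c Ω z)
    {n j : Fin N} {ξ η : ℝ} (hp : n ≠ j ∨ r < distT ξ η)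
    (hmin : ∀ n' j' ξ' η', Pr r n' j' ξ' η' → ‖z n ξ - z j η‖ ≤ ‖z n' ξ' - z j' η'‖) :
    dt (deriv (z n) ξ) (z n ξ - z j η) = 0 := by
  have hl : IsLocalMin (fun σ => ‖z n σ - z j η‖ ^ 2) ξ := by
    have : ∀ᶠ σ in nhds ξ, Pr r n j σ η := by
      rcases hp with hp | hp
      · exact Eventually.of_forall fun σ => Or.inl hp
      · have hc : Continuous (fun σ => distT σ η) := distT_continuous.comp (f := fun σ : ℝ => (σ, η)) (by fun_prop)
        filter_upwards [hc.continuousAt.eventually (lt_mem_nhds hp)] with σ hσ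
        exact Or.inr (le_of_lt hσ)
    filter_upwards [this] with σ hσ
    have := hmin n j σ η hσ
    gcongr
  have hd := (((h.crv n).der ξ).sub_const (z j η)).norm_sq
  have := hl.hasDerivAt_eq_zero hd
  rw [inner_dt, dt_comm] at this
  linarith

theorem norm_step {δ k C ε : ℝ} {v w e : R2} (he : ‖e‖ = 1) (hδ : 0 < δ) (hk : 0 < k) (hC : 0 ≤ C) (hε : 0 ≤ ε) (hv : v = δ • e)
    (hw : |dt w e| ≤ C * δ) (hs : k * ‖w‖ ^ 2 ≤ 2 * δ * ε) : ‖v - k • w‖ ≤ δ + k * (C * δ + ε) := by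
  have h1 : ‖v - k • w‖ ^ 2 = δ ^ 2 - 2 * k * δ * dt w e + k ^ 2 * ‖w‖ ^ 2 := by
    have e1 : ‖e‖ ^ 2 = 1 := by rw [he]; norm_num
    rw [nsq] at e1
    rw [nsq, nsq, hv]
    simp [dt]; linear_combination δ ^ 2 * e1
  refine (sq_le_sq₀ (norm_nonneg _) (by positivity)).mp ?_
  rw [h1]
  have h2 := (abs_le.mp hw).1
  have h3 : - (2 * k * δ * dt w e) ≤ 2 * k * δ * (C * δ) := by
    have : 0 ≤ 2 * k * δ := by positivity
    nlinarith
  have h4 : k ^ 2 * ‖w‖ ^ 2 ≤ k * (2 * δ * ε) := by rw [sq, mul_assoc]; gcongr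
  have h5 : 0 ≤ (k * (C * δ + ε)) ^ 2 := sq_nonneg _
  nlinarith
end

section
open Real Set Filter MeasureTheory
section
variable {N : ℕ} {α γ T cα M : ℝ} {θ : Fin N → ℝ} {Ω : Fin N → ℝ → Set R2} {Z : Fin N → ℝ → ℝ → R2}
    {c : Fin N → ℝ → ℝ}

theorem Dyn.back (hα0 : 0 < α) (hα : α ≤ 1 / 4) (D : Dyn α γ T cα M θ Ω Z c) {t r C δ : ℝ} (ht : t ∈ Ioo 0 T) {n j : Fin N} {ξ η : ℝ}
    (hp : n ≠ j ∨ r < distT ξ η) {e : R2} (he : ‖e‖ = 1) (hδ : 0 < δ) (hC : 0 ≤ C) (hxy : Z n t ξ - Z j t η = δ • e)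
    (hu : |dt (gSQGvel α cα θ (fun n => Ω n t) (Z n t ξ) - gSQGvel α cα θ (fun n => Ω n t) (Z j t η)) e| ≤ C * δ) :
    ∃ k > 0, t - k ∈ Ico 0 T ∧ ∃ ξ' η', Pr r n j ξ' η' ∧ ‖Z n (t - k) ξ' - Z j (t - k) η'‖ ≤ δ * (1 + (C + 1) * k) := by
  have cf := D.cfg t ⟨ht.1.le, ht.2⟩
  set u := gSQGvel α cα θ (fun n => Ω n t) with hu'
  set x := Z n t ξ with hx
  set y := Z j t η with hy
  obtain ⟨κ, hκ, hac⟩ := (cf.crv n).arcchord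
  obtain ⟨g, hg, hgp⟩ : ∃ g > 0, n ≠ j ∨ r + g ≤ distT ξ η := by
    rcases hp with hp | hp
    · exact ⟨1, one_pos, Or.inl hp⟩
    · exact ⟨distT ξ η - r, by linarith, Or.inr (by linarith)⟩
  set ε := min (δ / 6) (κ * g / 8) with hε
  have hε0 : 0 < ε := by positivity
  have hε1 : ε ≤ δ / 6 := min_le_left _ _
  have hε2 : ε ≤ κ * g / 8 := min_le_right _ _
  have tt : Tendsto (fun k : ℝ => -k) (nhdsWithin 0 (Ioi 0)) (nhdsWithin 0 {0}ᶜ) := by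
    refine tendsto_nhdsWithin_iff.mpr ⟨?_, ?_⟩
    · have : Tendsto (fun k : ℝ => -k) (nhds 0) (nhds (-0)) := continuous_neg.tendsto 0
      rw [neg_zero] at this
      exact this.mono_left nhdsWithin_le_nhds
    · filter_upwards [self_mem_nhdsWithin] with k hk
      have hk : 0 < k := hk
      simp [hk.ne']
  have ev := tt.eventually (D.matching hα0 hα ht hε0)
  have lin : ∀ A B : ℝ, 0 < B → ∀ᶠ k in nhdsWithin (0:ℝ) (Ioi 0), k * A ≤ B := by
    intro A B hB
    have h1 : Tendsto (fun k : ℝ => k * A) (nhds 0) (nhds (0 * A)) := (continuous_id.mul continuous_const).tendsto 0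
    rw [zero_mul] at h1
    filter_upwards [(h1.mono_left nhdsWithin_le_nhds).eventually (gt_mem_nhds hB)] with k hk
    exact le_of_lt hk
  obtain ⟨k, ⟨⟨htk, hm⟩, h1, h2, h3, h4⟩, hk⟩ := ((ev.and ((lin 1 1 one_pos).and ((lin ‖u x‖ (κ * g / 8) (by positivity)).and
    ((lin ‖u y‖ (κ * g / 8) (by positivity)).and (lin (‖u x - u y‖ ^ 2) (2 * δ * (δ / 3)) (by positivity)))))).and
    self_mem_nhdsWithin).exists
  have hk : 0 < k := hk
  rw [← sub_eq_add_neg] at htk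
  simp only [← sub_eq_add_neg, abs_neg, abs_of_pos hk, neg_smul] at hm
  refine ⟨k, hk, htk, ?_⟩
  obtain ⟨s, hs1, _, hs2⟩ := hm n
  obtain ⟨ξ', hξ'⟩ := hs2 ξ
  obtain ⟨s', hs1', _, hs2'⟩ := hm j
  obtain ⟨η', hη'⟩ := hs2' η
  have hεk : ε * k ≤ ε := by nlinarith
  have hns := norm_step (ε := δ / 3) he hδ hk hC (by positivity) hxy hu h4
  refine ⟨ξ', η', ?_, ?_⟩
  · rcases hgp with hgp | hgp
    · exact Or.inl hgp
    by_cases hnj : n = j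
    · right
      have key : ∀ (σ φ : ℝ) , k * ‖u (Z n t φ)‖ ≤ κ * g / 8 → ‖Z n (t - k) σ - (Z n t φ - k • u (Z n t φ))‖ ≤ ε * k → distT (σ + s) φ ≤ g / 2 := by
        intro σ φ hb hc
        have e1 := hac (σ + s) φ
        have e2 := (hs1 σ).1
        have e3 : ‖Z n t (σ + s) - Z n t φ‖ ≤ ε + ε * k + κ * g / 8 := by
          have : Z n t (σ + s) - Z n t φ = -(Z n (t - k) σ - Z n t (σ + s)) + (Z n (t - k) σ - (Z n t φ - k • u (Z n t φ))) - k • u (Z n t φ) := by abel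
          rw [this]
          refine (norm_sub_le _ _).trans (add_le_add ((norm_add_le _ _).trans (add_le_add ?_ hc)) ?_)
          · rwa [norm_neg]
          · rw [norm_smul, Real.norm_eq_abs, abs_of_pos hk]; exact hb
        have e4 : κ * distT (σ + s) φ ≤ κ * (g / 2) := by linarith
        exact le_of_mul_le_mul_left e4 hκ
      subst hnj
      have d1 := key ξ' ξ h2 hξ'
      have d2 := key η' η h3 hη'
      have d3 := distT_triangle ξ (ξ' + s) η
      have d4 := distT_triangle (ξ' + s) (η' + s) η
      rw [distT_shift] at d4
      rw [distT_comm ξ (ξ' + s)] at d3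
      linarith
    · exact Or.inl hnj
  · have e1 : Z n (t - k) ξ' - Z j (t - k) η' = (x - y - k • (u x - u y)) + (Z n (t - k) ξ' - (x - k • u x)) - (Z j (t - k) η' - (y - k • u y)) := by
      rw [smul_sub]; abel
    rw [e1]
    have e2 := norm_sub_le ((x - y - k • (u x - u y)) + (Z n (t - k) ξ' - (x - k • u x))) (Z j (t - k) η' - (y - k • u y))
    have e3 := norm_add_le (x - y - k • (u x - u y)) (Z n (t - k) ξ' - (x - k • u x))
    have e4 : ε * k ≤ δ / 6 * k := by gcongr
    nlinarith

theorem Dyn.lower (hα0 : 0 < α) (hα : α ≤ 1 / 4) (hγ : 2 * α < γ) (hβ : 2 * α * (1 + γ) = γ) (hM : 1 ≤ M) (hT : 0 < T)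
    (D : Dyn α γ T cα M θ Ω Z c) {c0 r : ℝ} (hc0 : 0 < c0) (hc : ∀ n, ∀ t ∈ Ico 0 T, c0 ≤ c n t) (hr : 0 < r) (hrM : M * r ^ γ ≤ c0 / 2) :
    ∃ μ > 0, ∀ t ∈ Ico 0 T, ∀ n j ξ η, Pr r n j ξ η → μ ≤ ‖Z n t ξ - Z j t η‖ := by
  obtain ⟨C, d, hC, hd, hvel⟩ := Cfg.vel (cα := cα) θ hα0 hα hγ hβ hM hc0
  by_cases hne : ∃ n j ξ η, Pr (N := N) r n j ξ η
  swap
  · push Not at hne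
    exact ⟨1, one_pos, fun t _ n j ξ η h => absurd h (hne n j ξ η)⟩
  have pos : ∀ t ∈ Ico 0 T, ∀ n j ξ η, Pr r n j ξ η → 0 < ‖Z n t ξ - Z j t η‖ := by
    intro t ht n j ξ η hp
    rw [norm_pos_iff, sub_ne_zero]
    by_cases hnj : n = j
    · subst hnj
      intro he
      have h1 := ((D.cfg t ht).crv n).inj ξ η he
      rcases hp with hp | hp
      · exact hp rfl
      · linarith
    · exact (D.cfg t ht).disj n j hnj ξ η
  have h0 : (0:ℝ) ∈ Ico 0 T := ⟨le_rfl, hT⟩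
  obtain ⟨n0, j0, ξ0, η0, hp0, hmin0⟩ := (D.cfg 0 h0).exmin hne
  set m := min (‖Z n0 0 ξ0 - Z j0 0 η0‖ / 2) (min d (c0 * r / 4)) with hm
  have hpos0 := pos 0 h0 n0 j0 ξ0 η0 hp0
  have hm0 : 0 < m := by positivity
  have hm1 : m < ‖Z n0 0 ξ0 - Z j0 0 η0‖ := lt_of_le_of_lt (min_le_left _ _) (by linarith)
  have hm2 : m ≤ d := (min_le_right _ _).trans (min_le_left _ _)
  have hm3 : m ≤ c0 * r / 4 := (min_le_right _ _).trans (min_le_right _ _)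
  set G : ℝ → ℝ := fun t => m * exp (-((C + 1) * t)) with hG
  have hGc : Continuous G := by simp only [hG]; fun_prop
  have hGm : ∀ t, 0 ≤ t → G t ≤ m := fun t ht => by
    have : exp (-((C + 1) * t)) ≤ 1 := Real.exp_le_one_iff.mpr (by nlinarith)
    simp only [hG]; nlinarith
  refine ⟨G T, by simp only [hG]; positivity, fun t1 ht1 n1 j1 ξ1 η1 hp1 => ?_⟩
  by_contra hlt
  push Not at hlt
  set S : Set ℝ := {t | ∃ n j ξ η, Pr r n j ξ η ∧ ‖Z n t ξ - Z j t η‖ ≤ G t} with hS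
  have ht1S : t1 ∈ S := ⟨n1, j1, ξ1, η1, hp1, hlt.le.trans (by
    simp only [hG]; gcongr; exact ht1.2.le)⟩
  have hsub : ∀ t ∈ Icc 0 t1, t ∈ Ico 0 T := fun t ht => ⟨ht.1, ht.2.trans_lt ht1.2⟩
  have hclosed : IsClosed (S ∩ Icc 0 t1) := by
    rw [← closure_subset_iff_isClosed]
    intro t0 ht0
    have ht0I : t0 ∈ Icc 0 t1 := by
      have := closure_mono (inter_subset_right (s := S)) ht0
      rwa [isClosed_Icc.closure_eq] at this
    refine ⟨?_, ht0I⟩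
    have ht0T := hsub t0 ht0I
    obtain ⟨n, j, ξ, η, hp, hmin⟩ := (D.cfg t0 ht0T).exmin hne
    refine ⟨n, j, ξ, η, hp, ?_⟩
    refine le_of_forall_pos_le_add fun ε hε => ?_
    have ev : ∀ᶠ t in nhdsWithin t0 (Ico 0 T), ∀ n, ∃ s, ∀ ξ, ‖Z n t ξ - Z n t0 (ξ + s)‖ ≤ ε / 3 ∧
      ‖deriv (Z n t) ξ - deriv (Z n t0) (ξ + s)‖ ≤ ε / 3 := eventually_all.mpr fun n => D.conv n ht0T (by positivity)
    have ev2 : ∀ᶠ t in nhdsWithin t0 (Ico 0 T), G t < G t0 + ε / 3 :=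
      (hGc.continuousAt.eventually (gt_mem_nhds (by linarith))).filter_mono nhdsWithin_le_nhds
    have hfr : ∃ᶠ t in nhdsWithin t0 (Ico 0 T), t ∈ S := by
      have h1 : ∃ᶠ t in nhds t0, t ∈ S ∩ Icc 0 t1 := mem_closure_iff_frequently.mp ht0
      rw [frequently_nhdsWithin_iff]
      exact h1.mono fun t ht => ⟨ht.1, hsub t ht.2⟩
    obtain ⟨t, ⟨n', j', ξ', η', hp', hle⟩, hcv, hGt⟩ := (hfr.and_eventually (ev.and ev2)).exists
    choose s hs using hcv
    have hp2 : Pr r n' j' (ξ' + s n') (η' + s j') := by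
      by_cases hnj : n' = j'
      · subst hnj
        rcases hp' with h | h
        · exact absurd rfl h
        · right; rwa [distT_shift]
      · exact Or.inl hnj
    have h1 := hmin _ _ _ _ hp2
    have h2 := (hs n' ξ').1
    have h3 := (hs j' η').1
    have h4 : ‖Z n' t0 (ξ' + s n') - Z j' t0 (η' + s j')‖ ≤ ‖Z n' t ξ' - Z j' t η'‖ + ε / 3 + ε / 3 := by
      have : Z n' t0 (ξ' + s n') - Z j' t0 (η' + s j') = (Z n' t ξ' - Z j' t η') - (Z n' t ξ' - Z n' t0 (ξ' + s n')) + (Z j' t η' - Z j' t0 (η' + s j')) := by abel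
      rw [this]
      exact (norm_add_le _ _).trans (add_le_add ((norm_sub_le _ _).trans (add_le_add le_rfl h2)) h3)
    linarith
  have hstep : ∀ t ∈ S ∩ Ioc 0 t1, (S ∩ Ico 0 t).Nonempty := by
    rintro t ⟨⟨n', j', ξ', η', hp', hle'⟩, htI⟩
    have htT : t ∈ Ioo 0 T := ⟨htI.1, htI.2.trans_lt ht1.2⟩
    have htT' : t ∈ Ico 0 T := ⟨htI.1.le, htT.2⟩
    have cf := D.cfg t htT'
    obtain ⟨n, j, ξ, η, hp, hmin⟩ := cf.exmin hne
    have hle := (hmin _ _ _ _ hp').trans hle'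
    have hδ := pos t htT' n j ξ η hp
    set δ := ‖Z n t ξ - Z j t η‖ with hδd
    have hδm := hle.trans (hGm t htI.1.le)
    have hpp : n ≠ j ∨ r < distT ξ η := by
      rcases hp with hp | hp
      · exact Or.inl hp
      by_cases hnj : n = j
      · subst hnj
        refine Or.inr (lt_of_le_of_ne hp fun he => ?_)
        have hcc := hc n t htT'
        have h1 := (cf.crv n).short (r := r) (by linarith) he.symm.le
        rw [← he] at h1
        have h2 : c0 / 2 * r ≤ c n t / 2 * r := by gcongr
        have h3 : 0 < c0 * r := by positivity
        have h4 : c n t / 2 * r ≤ δ := h1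
        linarith
      · exact Or.inl hnj
    have hperp := cf.perp_min hpp hmin
    set e := δ⁻¹ • (Z n t ξ - Z j t η) with he
    have he1 : ‖e‖ = 1 := by rw [he, norm_smul, norm_inv, Real.norm_eq_abs, abs_of_pos hδ, ← hδd, inv_mul_cancel₀ hδ.ne']
    have hxy : Z n t ξ - Z j t η = δ • e := by rw [he, smul_smul, mul_inv_cancel₀ hδ.ne', one_smul]
    have hpe : dt (deriv (Z n t) ξ) e = 0 := by rw [he, dt_smul_right, hperp, mul_zero]
    have hu := hvel _ _ _ cf (fun n => hc n t htT') n ξ (Z j t η) e δ he1 hδ (hδm.trans hm2) hxy hpe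
    obtain ⟨k, hk, htk, ξ2, η2, hp2, hle2⟩ := D.back hα0 hα htT hpp he1 hδ hC.le hxy hu
    refine ⟨t - k, ⟨n, j, ξ2, η2, hp2, hle2.trans ?_⟩, htk.1, by linarith⟩
    have h1 : 1 + (C + 1) * k ≤ exp ((C + 1) * k) := by linarith [Real.add_one_le_exp ((C + 1) * k)]
    calc δ * (1 + (C + 1) * k) ≤ G t * exp ((C + 1) * k) := by gcongr
      _ = G (t - k) := by
        simp only [hG]; rw [mul_assoc, ← Real.exp_add]; congr 2; ring
  obtain ⟨n, j, ξ, η, hp, hle⟩ := hclosed.mem_of_ge_of_forall_exists_lt ht1S ht1.1 hstep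
  have h1 := hmin0 _ _ _ _ hp
  have h2 := hGm 0 le_rfl
  linarith

theorem Dyn.final (hα0 : 0 < α) (hα : α ≤ 1 / 4) (hγ : 2 * α < γ) (hβ : 2 * α * (1 + γ) = γ) (hM : 1 ≤ M) (hT : 0 < T)
    (D : Dyn α γ T cα M θ Ω Z c) :
    ∃ C : ℝ, ∀ t ∈ Ico 0 T, ∀ n j : Fin N, ∀ ξ η : ℝ, (n ≠ j ∨ distT ξ η ≠ 0) →
      (|((n : ℕ) : ℤ) - ((j : ℕ) : ℤ)| : ℝ) + distT ξ η ≤ C * ‖Z n t ξ - Z j t η‖ := by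
  obtain ⟨c0, hc0, hc⟩ := D.speed hα0 hα hT
  obtain ⟨r, hr, hr1, hrM⟩ := Crv.exists_r (M := M) (γ := γ) (c := c0 / 2) (by linarith) hM (by positivity)
  obtain ⟨μ, hμ, hlow⟩ := D.lower hα0 hα hγ hβ hM hT hc0 hc hr hrM
  refine ⟨(N + π) / μ + 2 / c0, fun t ht n j ξ η _ => ?_⟩
  have hpi := distT_le_pi ξ η
  have h0 := norm_nonneg (Z n t ξ - Z j t η)
  have a1 : 0 ≤ (N + π) / μ * ‖Z n t ξ - Z j t η‖ := by positivity
  have a2 : 0 ≤ 2 / c0 * ‖Z n t ξ - Z j t η‖ := by positivity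
  rw [add_mul]
  by_cases hp : Pr r n j ξ η
  · have h1 := hlow t ht n j ξ η hp
    have h2 : (|((n : ℕ) : ℤ) - ((j : ℕ) : ℤ)| : ℝ) ≤ N := by
      have hn : ((n : ℕ) : ℝ) ≤ N := by exact_mod_cast n.2.le
      have hj : ((j : ℕ) : ℝ) ≤ N := by exact_mod_cast j.2.le
      have hn0 : (0:ℝ) ≤ ((n : ℕ) : ℝ) := by positivity
      have hj0 : (0:ℝ) ≤ ((j : ℕ) : ℝ) := by positivity
      push_cast
      rw [abs_le]; constructor <;> linarith
    have h3 : (N + π) ≤ (N + π) / μ * ‖Z n t ξ - Z j t η‖ := by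
      rw [div_mul_eq_mul_div, le_div_iff₀ hμ]; gcongr
    linarith
  · unfold Pr at hp
    push Not at hp
    obtain ⟨hnj, hd⟩ := hp
    subst hnj
    have hcc := hc n t ht
    have h1 := ((D.cfg t ht).crv n).short (r := r) (by linarith) hd.le
    have h2 : c0 / 2 * distT ξ η ≤ c n t / 2 * distT ξ η := by
      have := distT_nonneg ξ η
      gcongr
    have h3 : distT ξ η ≤ 2 / c0 * ‖Z n t ξ - Z n t η‖ := by
      rw [div_mul_eq_mul_div, le_div_iff₀ hc0]; linarith
    simp only [sub_self, abs_zero, zero_add]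
    linarith
end
end

theorem haus_two {S W : Set R2} (hS : S.Nonempty) (hW : W.Nonempty) (bS : Bornology.IsBounded S) (bW : Bornology.IsBounded W)
    {r : ℝ} (h : Metric.hausdorffDist S W < r) :
    (∀ x ∈ S, ∃ y ∈ W, ‖x - y‖ ≤ r) ∧ ∀ y ∈ W, ∃ x ∈ S, ‖x - y‖ ≤ r := by
  have fin := Metric.hausdorffEDist_ne_top_of_nonempty_of_bounded hS hW bS bW
  constructor
  · intro x hx
    obtain ⟨y, hy, hd⟩ := Metric.exists_dist_lt_of_hausdorffDist_lt hx h fin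
    exact ⟨y, hy, by rw [← dist_eq_norm]; exact hd.le⟩
  · intro y hy
    obtain ⟨x, hx, hd⟩ := Metric.exists_dist_lt_of_hausdorffDist_lt' hy h fin
    exact ⟨x, hx, by rw [← dist_eq_norm]; exact hd.le⟩

theorem red_Ico (ξ : ℝ) : ∃ k : ℤ, ξ + 2 * π * k ∈ Ico 0 (2 * π) := by
  have hp : (0:ℝ) < 2 * π := by positivity
  refine ⟨-toIcoDiv hp 0 ξ, ?_⟩
  have h := toIcoMod_mem_Ico hp 0 ξ
  rw [zero_add, toIcoMod, zsmul_eq_mul] at h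
  push_cast
  convert h using 1
  ring

/-- (Theorem 1.4, absence of splash-like singularities on the half-plane) Let `α ∈ (0,1/4]`,
`γ = 2α/(1−2α)`, and let `ω = Σ_{n} θₙ χ_{Ωₙ(t)}` be a patch solution to the g-SQG equation
on the half-plane `D = ℝ×(0,∞)` (with the Dirichlet velocity) on `[0,T)`, `T < ∞`, whose
patch boundaries are parameterized by constant-speed counterclockwise parameterizations
`zₙ(·,t)`, with
`sup_{t∈[0,T)} ‖Ω(t)‖_{C^{1,γ}} < ∞`.  Then
`sup_{t∈[0,T)} sup_{(n,ξ)≠(j,η)} (|n−j| + |ξ−η|)/|zₙ(ξ,t) − z_j(η,t)| < ∞`: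
no splash-like singularity can occur at time `T`. -/
theorem no_splash_singularity_half_plane
    (α γ T cα : ℝ) (N : ℕ) (θ : Fin N → ℝ)
    (Ω : Fin N → ℝ → Set R2) (z : Fin N → ℝ → ℝ → R2)
    (hα0 : 0 < α) (hα : α ≤ 1 / 4) (hγ : γ = 2 * α / (1 - 2 * α))
    (hT : 0 < T) (hcα : 0 < cα) (hθ : ∀ n, θ n ≠ 0)
    -- each `Ωₙ(t)` is a bounded open subset of the half-plane `D`
    (hsub : ∀ n, ∀ t ∈ Ico 0 T, Ω n t ⊆ halfPlane)
    (hopen : ∀ n, ∀ t ∈ Ico 0 T, IsOpen (Ω n t))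
    (hbdd : ∀ n, ∀ t ∈ Ico 0 T, Bornology.IsBounded (Ω n t))
    -- the boundaries are pairwise disjoint
    (hdisj : ∀ t ∈ Ico 0 T, ∀ n j : Fin N, n ≠ j →
      frontier (Ω n t) ∩ frontier (Ω j t) = ∅)
    -- `zₙ(·,t)` is a simple closed `C¹` curve parameterizing `∂Ωₙ(t)`
    (hzper : ∀ n, ∀ t ∈ Ico 0 T, ∀ ξ : ℝ, z n (ξ + 2 * π) t = z n ξ t)
    (hzinj : ∀ n, ∀ t ∈ Ico 0 T, InjOn (fun ξ => z n ξ t) (Ico 0 (2 * π)))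
    (hzC1 : ∀ n, ∀ t ∈ Ico 0 T, ContDiff ℝ 1 (fun ξ => z n ξ t))
    (hzim : ∀ n, ∀ t ∈ Ico 0 T, (fun ξ => z n ξ t) '' Ico 0 (2 * π) = frontier (Ω n t))
    -- with constant speed
    (hspeed : ∀ n, ∀ t ∈ Ico 0 T, ∃ c : ℝ, 0 < c ∧
      ∀ ξ : ℝ, ‖deriv (fun ζ => z n ζ t) ξ‖ = c)
    -- counterclockwise (positive signed area)
    (hccw : ∀ n, ∀ t ∈ Ico 0 T,
      0 < ∫ ξ in (0:ℝ)..(2 * π),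
        (z n ξ t 0 * (deriv (fun ζ => z n ζ t) ξ) 1
          - z n ξ t 1 * (deriv (fun ζ => z n ζ t) ξ) 0))
    -- each boundary is continuous in time w.r.t. Hausdorff distance
    (hHaus : ∀ n, ∀ t₀ ∈ Ico 0 T,
      Tendsto (fun t => Metric.hausdorffDist (frontier (Ω n t)) (frontier (Ω n t₀)))
        (nhdsWithin t₀ (Ico 0 T)) (nhds 0))
    -- patch solution: `lim_{h→0} d_H(∂Ω(t+h), X^h_{u(·,t)}[∂Ω(t)])/h = 0`
    (hpatch : ∀ t ∈ Ioo 0 T,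
      Tendsto (fun h =>
          Metric.hausdorffDist (⋃ n, frontier (Ω n (t + h)))
            ((fun x => x + h • gSQGvel α cα θ (fun n => Ω n t) x) ''
              ⋃ n, frontier (Ω n t)) / |h|)
        (nhdsWithin 0 {h : ℝ | t + h ∈ Ico 0 T ∧ h ≠ 0}) (nhds 0))
    -- uniform `C^{1,γ}` bound on the patch boundaries
    (hC1γ : ∃ M : ℝ, ∀ n, ∀ t ∈ Ico 0 T, ∀ ξ η : ℝ,
      ‖z n ξ t‖ ≤ M ∧ ‖deriv (fun ζ => z n ζ t) ξ‖ ≤ M ∧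
        ‖deriv (fun ζ => z n ζ t) ξ - deriv (fun ζ => z n ζ t) η‖ ≤ M * |ξ - η| ^ γ) :
    -- conclusion: the arc-chord ratio stays uniformly bounded up to time `T`
    ∃ C : ℝ, ∀ t ∈ Ico 0 T, ∀ n j : Fin N, ∀ ξ η : ℝ, (n ≠ j ∨ distT ξ η ≠ 0) →
      (|((n : ℕ) : ℤ) - ((j : ℕ) : ℤ)| : ℝ) + distT ξ η ≤ C * ‖z n ξ t - z j η t‖ := by
  obtain ⟨M, hM⟩ := hC1γ
  have h12 : 0 < 1 - 2 * α := by linarith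
  have hg0 : 0 < γ := by rw [hγ]; positivity
  have hg1 : γ ≤ 1 := by rw [hγ, div_le_one h12]; linarith
  have hg2 : 2 * α < γ := by
    rw [hγ, lt_div_iff₀ h12]; nlinarith [mul_pos hα0 hα0]
  have hg3 : 2 * α * (1 + γ) = γ := by
    rw [hγ]; field_simp; ring
  have hMM : 1 ≤ max M 1 := le_max_right _ _
  have hML : M ≤ max M 1 := le_max_left _ _
  have hcrv : ∀ t ∈ Ico 0 T, ∀ n, Crv (max M 1) γ (‖deriv (fun ζ => z n ζ t) 0‖) (fun ζ => z n ζ t) := by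
    intro t ht n
    obtain ⟨c, hc0, hc⟩ := hspeed n t ht
    have hper := hzper n t ht
    refine ⟨hper, ?_, ?_, ?_, ?_, ?_, ?_, hg0, hg1, hMM, ?_⟩
    · intro ξ η he
      obtain ⟨k, hk⟩ := red_Ico ξ
      obtain ⟨l, hl⟩ := red_Ico η
      have hpi := per_int (z := fun ζ => z n ζ t) hper
      have e : ξ + 2 * π * k = η + 2 * π * l := by
        refine hzinj n t ht hk hl ?_
        exact (hpi ξ k).trans (he.trans (hpi η l).symm)
      have h1 := distT_le ξ η (k - l)
      have h2 : ξ - η + 2 * π * ((k - l : ℤ) : ℝ) = 0 := by push_cast; linarith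
      rw [h2, abs_zero] at h1
      exact le_antisymm h1 (distT_nonneg _ _)
    · intro ξ
      exact (((hzC1 n t ht).differentiable (by norm_num)) ξ).hasDerivAt
    · rw [hc]; exact hc0
    · intro ξ; rw [hc, hc]
    · intro ξ; exact ((hM n t ht ξ 0).1).trans hML
    · intro ξ η
      exact ((hM n t ht ξ η).2.2).trans (mul_le_mul_of_nonneg_right hML (by positivity))
    · exact ((hM n t ht 0 0).2.1).trans hML
  have hrng : ∀ t ∈ Ico 0 T, ∀ n, range (fun ζ => z n ζ t) = frontier (Ω n t) := by
    intro t ht n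
    rw [← hzim n t ht]
    apply Subset.antisymm
    · rintro _ ⟨ξ, rfl⟩
      obtain ⟨k, hk⟩ := red_Ico ξ
      exact ⟨_, hk, per_int (z := fun ζ => z n ζ t) (hzper n t ht) ξ k⟩
    · exact image_subset_range _ _
  have hne : ∀ t ∈ Ico 0 T, ∀ n, (frontier (Ω n t)).Nonempty := by
    intro t ht n; rw [← hrng t ht n]; exact range_nonempty _
  have hcp : ∀ t ∈ Ico 0 T, ∀ n, IsCompact (frontier (Ω n t)) := by
    intro t ht n; rw [← hrng t ht n]; exact (hcrv t ht n).range_closed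
  have D : Dyn α γ T cα (max M 1) θ Ω (fun n t ξ => z n ξ t) (fun n t => ‖deriv (fun ζ => z n ζ t) 0‖) := by
    refine ⟨?_, ?_, ?_⟩
    · intro t ht
      refine ⟨hcrv t ht, hrng t ht, fun n => hopen n t ht, fun n => hbdd n t ht, fun n => hsub n t ht, ?_, fun n => hccw n t ht⟩
      intro n j hnj ξ η he
      have h1 : z n ξ t ∈ frontier (Ω n t) := by rw [← hrng t ht n]; exact ⟨ξ, rfl⟩
      have h2 : z n ξ t ∈ frontier (Ω j t) := by rw [← hrng t ht j]; exact ⟨η, he.symm⟩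
      have h3 : z n ξ t ∈ frontier (Ω n t) ∩ frontier (Ω j t) := ⟨h1, h2⟩
      rw [hdisj t ht n j hnj] at h3
      exact h3
    · intro n t₀ ht₀ ε hε
      filter_upwards [(hHaus n t₀ ht₀).eventually (gt_mem_nhds hε), self_mem_nhdsWithin] with t h1 ht
      obtain ⟨ha, hb⟩ := haus_two (hne t ht n) (hne t₀ ht₀ n) (hcp t ht n).isBounded (hcp t₀ ht₀ n).isBounded h1
      rw [← hrng t ht n, ← hrng t₀ ht₀ n] at ha hb
      constructor
      · intro ξ
        obtain ⟨_, ⟨η, rfl⟩, h⟩ := ha _ ⟨ξ, rfl⟩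
        exact ⟨η, h⟩
      · intro η
        obtain ⟨_, ⟨ξ, rfl⟩, h⟩ := hb _ ⟨η, rfl⟩
        exact ⟨ξ, h⟩
    · intro t ht ε hε
      have ht' : t ∈ Ico 0 T := ⟨ht.1.le, ht.2⟩
      rcases isEmpty_or_nonempty (Fin N) with hN | hN
      · exact Eventually.of_forall fun h => ⟨fun n => isEmptyElim n, fun n => isEmptyElim n⟩
      have huc : Continuous (gSQGvel α cα θ (fun n => Ω n t)) := vel_cont hα0 hα θ (fun n => hbdd n t ht')
      have hn : nhdsWithin (0:ℝ) {h : ℝ | t + h ∈ Ico 0 T ∧ h ≠ 0} = nhdsWithin (0:ℝ) {0}ᶜ := by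
        have hs : {h : ℝ | t + h ∈ Ico 0 T} ∈ nhds (0:ℝ) := by
          have : ContinuousAt (fun h : ℝ => t + h) 0 := by fun_prop
          exact this.preimage_mem_nhds (by rw [add_zero]; exact Ico_mem_nhds ht.1 ht.2)
        exact nhdsWithin_inter_of_mem (s := {h : ℝ | t + h ∈ Ico 0 T}) (t := {0}ᶜ) (mem_nhdsWithin_of_mem_nhds hs)
      have hev := (hpatch t ht).eventually (gt_mem_nhds hε)
      have hmem : ∀ᶠ h in nhdsWithin (0:ℝ) {h : ℝ | t + h ∈ Ico 0 T ∧ h ≠ 0}, t + h ∈ Ico 0 T ∧ h ≠ 0 := self_mem_nhdsWithin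
      rw [hn] at hev hmem
      filter_upwards [hev, hmem] with h h1 h2
      rw [div_lt_iff₀ (abs_pos.mpr h2.2)] at h1
      have c1 : IsCompact (⋃ n, frontier (Ω n (t + h))) := isCompact_iUnion (hcp _ h2.1)
      have c2 : IsCompact (⋃ n, frontier (Ω n t)) := isCompact_iUnion (hcp _ ht')
      have c3 := c2.image (f := fun x => x + h • gSQGvel α cα θ (fun n => Ω n t) x) (by fun_prop)
      obtain ⟨ha, hb⟩ := haus_two (nonempty_iUnion.mpr ⟨Classical.arbitrary _, hne _ h2.1 _⟩)
        ((nonempty_iUnion.mpr ⟨Classical.arbitrary _, hne _ ht' _⟩).image _) c1.isBounded c3.isBounded h1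
      constructor
      · intro n ξ
        obtain ⟨_, ⟨y, hy, rfl⟩, h⟩ := ha (z n ξ (t + h)) (mem_iUnion.mpr ⟨n, by rw [← hrng _ h2.1 n]; exact ⟨ξ, rfl⟩⟩)
        obtain ⟨j, hj⟩ := mem_iUnion.mp hy
        rw [← hrng _ ht' j] at hj
        obtain ⟨φ, rfl⟩ := hj
        exact ⟨j, φ, h⟩
      · intro j φ
        obtain ⟨x, hx, h⟩ := hb _ ⟨z j φ t, mem_iUnion.mpr ⟨j, by rw [← hrng _ ht' j]; exact ⟨φ, rfl⟩⟩, rfl⟩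
        obtain ⟨n, hn⟩ := mem_iUnion.mp hx
        rw [← hrng _ h2.1 n] at hn
        obtain ⟨ξ, rfl⟩ := hn
        exact ⟨n, ξ, h⟩
  exact D.final hα0 hα hg2 hg3 hMM hT

end
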